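/- arXiv:2508.12847 — 4 statements merged into one kernel-verified Lean document; each statement's English description precedes it below -/
import Mathlib

section
/- Lower bound L₁^r of Theorem 1 (perfect parity): Let (S,X,T) be jointly distributed random variables with values in finite sets and let r satisfy 0 ≤ r ≤ H(X|S). Then there exists a probability space carrying random variables (S',X',T',Y) such that (S',X',T') has the same joint distribution as (S,X,T), Y takes values in a finite set, I(Y;S') = 0, I(X';Y) ≤ r, and I(Y;T') ≥ H(T|(X,S)) + r − H((X,S)|T). -/
open MeasureTheory ProbabilityTheory

/-- Shannon entropy (base 2) of a random variable with values in a finite type,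
with the convention `0 · log₂ 0 = 0`. -/
noncomputable def ent {Ω α : Type*} [MeasurableSpace Ω] [Fintype α]
    (μ : Measure Ω) (X : Ω → α) : ℝ :=
  ∑ a : α, -((μ (X ⁻¹' {a})).toReal * Real.logb 2 ((μ (X ⁻¹' {a})).toReal))

/-- Conditional Shannon entropy `H(X | Y)` (base 2). -/
noncomputable def condEnt {Ω α β : Type*} [MeasurableSpace Ω] [Fintype α] [Fintype β]
    (μ : Measure Ω) (X : Ω → α) (Y : Ω → β) : ℝ :=
  ent μ (fun ω => (X ω, Y ω)) - ent μ Y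

/-- Mutual information `I(X ; Y)` (base 2). -/
noncomputable def mutInf {Ω α β : Type*} [MeasurableSpace Ω] [Fintype α] [Fintype β]
    (μ : Measure Ω) (X : Ω → α) (Y : Ω → β) : ℝ :=
  ent μ X + ent μ Y - ent μ (fun ω => (X ω, Y ω))

/-- Conditional mutual information `I(X ; Y | Z)` (base 2). -/
noncomputable def condMutInf {Ω α β γ : Type*} [MeasurableSpace Ω] [Fintype α] [Fintype β]
    [Fintype γ] (μ : Measure Ω) (X : Ω → α) (Y : Ω → β) (Z : Ω → γ) : ℝ :=
  ent μ (fun ω => (X ω, Z ω)) + ent μ (fun ω => (Y ω, Z ω))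
    - ent μ (fun ω => (X ω, Y ω, Z ω)) - ent μ Z

open Classical in
theorem aux_marg {Ω α β : Type*} [MeasurableSpace Ω] [DiscreteMeasurableSpace Ω] [Fintype α]
    (μ : Measure Ω) [IsProbabilityMeasure μ] (W : Ω → α) (g : α → β) (b : β) :
    (μ ((fun ω => g (W ω)) ⁻¹' {b})).toReal
      = ∑ a, if g a = b then (μ (W ⁻¹' {a})).toReal else 0 := by
  have h1 : ((fun ω => g (W ω)) ⁻¹' {b}) = ⋃ a ∈ (Finset.univ.filter fun a => g a = b), W ⁻¹' {a} := by
    ext ω; simp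
  rw [h1, measure_biUnion_finset, ENNReal.toReal_sum, Finset.sum_filter]
  · intro a _; exact measure_ne_top _ _
  · intro a _ c _ hac
    refine Set.disjoint_left.2 fun ω h h' => hac ?_
    simp at h h'; rw [← h, ← h']
  · intro a _; exact MeasurableSet.of_discrete

theorem aux_sum_one {Ω α : Type*} [MeasurableSpace Ω] [DiscreteMeasurableSpace Ω] [Fintype α]
    (μ : Measure Ω) [IsProbabilityMeasure μ] (W : Ω → α) :
    ∑ a, (μ (W ⁻¹' {a})).toReal = 1 := by
  have := aux_marg μ W (fun _ => ()) ()
  simpa using this.symm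

theorem aux_rep {Ω α β : Type*} [MeasurableSpace Ω] [DiscreteMeasurableSpace Ω] [Fintype α]
    [Fintype β]
    (μ : Measure Ω) [IsProbabilityMeasure μ] (W : Ω → α) (g : α → β) :
    ent μ (fun ω => g (W ω)) = ∑ a, -((μ (W ⁻¹' {a})).toReal *
      Real.logb 2 ((μ ((fun ω => g (W ω)) ⁻¹' {g a})).toReal)) := by
  classical
  unfold ent
  have : ∀ b, -((μ ((fun ω => g (W ω)) ⁻¹' {b})).toReal *
      Real.logb 2 ((μ ((fun ω => g (W ω)) ⁻¹' {b})).toReal)) =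
      ∑ a, if g a = b then -((μ (W ⁻¹' {a})).toReal *
      Real.logb 2 ((μ ((fun ω => g (W ω)) ⁻¹' {g a})).toReal)) else 0 := by
    intro b
    nth_rewrite 1 [aux_marg μ W g b]
    rw [Finset.sum_mul, ← Finset.sum_neg_distrib]
    refine Finset.sum_congr rfl fun a _ => ?_
    split_ifs with h
    · rw [h]
    · simp
  rw [Finset.sum_congr rfl fun b _ => this b, Finset.sum_comm]
  simp

theorem aux_le {Ω α β : Type*} [MeasurableSpace Ω]
    (μ : Measure Ω) [IsProbabilityMeasure μ] (W : Ω → α) (g : α → β) (a : α) :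
    (μ (W ⁻¹' {a})).toReal ≤ (μ ((fun ω => g (W ω)) ⁻¹' {g a})).toReal := by
  refine ENNReal.toReal_mono (measure_ne_top _ _) (measure_mono ?_)
  intro ω h
  simp at h ⊢; rw [h]

theorem aux_mono {Ω α β : Type*} [MeasurableSpace Ω] [DiscreteMeasurableSpace Ω] [Fintype α]
    [Fintype β]
    (μ : Measure Ω) [IsProbabilityMeasure μ] (W : Ω → α) (g : α → β) :
    ent μ (fun ω => g (W ω)) ≤ ent μ W := by
  rw [aux_rep]
  unfold ent
  refine Finset.sum_le_sum fun a _ => ?_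
  have h0 : 0 ≤ (μ (W ⁻¹' {a})).toReal := ENNReal.toReal_nonneg
  rcases h0.eq_or_lt with h | h
  · rw [← h]; simp
  · have := Real.logb_le_logb_of_le (b := 2) (by norm_num) h (aux_le μ W g a)
    exact neg_le_neg (mul_le_mul_of_nonneg_left this h0)

theorem aux_indep {Ω α β : Type*} [MeasurableSpace Ω] [DiscreteMeasurableSpace Ω] [Fintype α]
    [Fintype β]
    (μ : Measure Ω) [IsProbabilityMeasure μ] (A : Ω → α) (B : Ω → β)
    (h : ∀ a b, (μ ((fun ω => (A ω, B ω)) ⁻¹' {(a, b)})).toReal =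
      (μ (A ⁻¹' {a})).toReal * (μ (B ⁻¹' {b})).toReal) :
    ent μ (fun ω => (A ω, B ω)) = ent μ A + ent μ B := by
  have hA := aux_sum_one μ A
  have hB := aux_sum_one μ B
  unfold ent
  rw [Fintype.sum_prod_type]
  simp only [h]
  have key : ∀ x y : ℝ, -(x * y * Real.logb 2 (x * y)) =
     -(x * Real.logb 2 x) * y + x * -(y * Real.logb 2 y) := by
    intro x y
    rcases eq_or_ne x 0 with rfl | hx
    · simp
    rcases eq_or_ne y 0 with rfl | hy
    · simp
    rw [Real.logb_mul hx hy]; ring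
  simp only [key, Finset.sum_add_distrib, ← Finset.mul_sum, ← Finset.sum_mul, hA, hB]
  ring

theorem aux_submod {Ω α β γ : Type*} [MeasurableSpace Ω] [DiscreteMeasurableSpace Ω] [Fintype α]
    [Fintype β] [Fintype γ]
    (μ : Measure Ω) [IsProbabilityMeasure μ] (A : Ω → α) (Y : Ω → β) (g : α → γ) :
    ent μ (fun ω => g (A ω)) + ent μ (fun ω => (A ω, Y ω)) ≤
      ent μ A + ent μ (fun ω => (g (A ω), Y ω)) := by
  classical
  have e1 := aux_rep μ (fun ω => (A ω, Y ω)) (fun w => g w.1)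
  have e2 := aux_rep μ (fun ω => (A ω, Y ω)) (fun w => w.1)
  have e3 := aux_rep μ (fun ω => (A ω, Y ω)) (fun w => (g w.1, w.2))
  have e4 := aux_rep μ (fun ω => (A ω, Y ω)) (fun w => w)
  simp only at e1 e2 e3 e4
  have e2' : ent μ A = ent μ (fun ω => A ω) := rfl
  rw [e2', e1, e2, e3, e4, ← sub_nonpos, ← Finset.sum_add_distrib, ← Finset.sum_add_distrib,
    ← Finset.sum_sub_distrib]
  set p : α × β → ℝ := fun w => (μ ((fun ω => (A ω, Y ω)) ⁻¹' {w})).toReal with hp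
  set pa : α → ℝ := fun w => (μ ((fun ω => A ω) ⁻¹' {w})).toReal with hpa
  set pg : γ → ℝ := fun w => (μ ((fun ω => g (A ω)) ⁻¹' {w})).toReal with hpg
  set pgy : γ × β → ℝ := fun w => (μ ((fun ω => (g (A ω), Y ω)) ⁻¹' {w})).toReal with hpgy
  have bound : ∀ w : α × β, (-(p w * Real.logb 2 (pg (g w.1))) + -(p w * Real.logb 2 (p w)) -
      (-(p w * Real.logb 2 (pa w.1)) + -(p w * Real.logb 2 (pgy (g w.1, w.2)))))
      ≤ (pa w.1 * pgy (g w.1, w.2) / pg (g w.1) - p w) / Real.log 2 := by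
    intro w
    have h1 : p w ≤ pg (g w.1) := aux_le μ (fun ω => (A ω, Y ω)) (fun w => g w.1) w
    have h2 : p w ≤ pa w.1 := aux_le μ (fun ω => (A ω, Y ω)) (fun w => w.1) w
    have h3 : p w ≤ pgy (g w.1, w.2) := aux_le μ (fun ω => (A ω, Y ω)) (fun w => (g w.1, w.2)) w
    have h0 : 0 ≤ p w := ENNReal.toReal_nonneg
    have hl : 0 < Real.log 2 := Real.log_pos (by norm_num)
    rcases h0.eq_or_lt with h | h
    · rw [← h] at h1 h2 h3 ⊢
      simp; positivity
    · have q1 := h.trans_le h1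
      have q2 := h.trans_le h2
      have q3 := h.trans_le h3
      have hz : 0 < pa w.1 * pgy (g w.1, w.2) / (pg (g w.1) * p w) := by positivity
      have hlog := Real.log_le_sub_one_of_pos hz
      rw [Real.log_div (by positivity) (by positivity), Real.log_mul q2.ne' q3.ne',
        Real.log_mul q1.ne' h.ne'] at hlog
      have := mul_le_mul_of_nonneg_left hlog h0
      rw [le_div_iff₀ hl]
      simp only [Real.logb]
      calc _ = p w * (Real.log (pa w.1) + Real.log (pgy (g w.1, w.2)) -
              (Real.log (pg (g w.1)) + Real.log (p w))) := by field_simp; ring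
        _ ≤ _ := this
        _ = _ := by field_simp
  refine (Finset.sum_le_sum fun w _ => bound w).trans ?_
  rw [← Finset.sum_div]
  refine div_nonpos_of_nonpos_of_nonneg ?_ (Real.log_nonneg (by norm_num))
  rw [Finset.sum_sub_distrib, sub_nonpos]
  have s1 : ∑ w, p w = 1 := aux_sum_one μ _
  have s2 : ∑ a, pa a = 1 := aux_sum_one μ _
  have s3 : ∀ c, ∑ y, pgy (c, y) = pg c := by
    intro c
    have := aux_marg μ (fun ω => (g (A ω), Y ω)) (fun w => w.1) c
    simp only [Fintype.sum_prod_type] at this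
    simp only [hpg, this]
    rw [Finset.sum_eq_single c]
    · simp [hpgy]
    · intro b _ hb; simp [hb]
    · simp
  rw [s1, ← s2, Fintype.sum_prod_type]
  refine Finset.sum_le_sum fun a _ => ?_
  simp only
  rw [← Finset.sum_div, ← Finset.mul_sum, s3]
  have : 0 ≤ pa a := ENNReal.toReal_nonneg
  rcases eq_or_ne (pg (g a)) 0 with h | h
  · rw [h]; simpa
  · rw [mul_div_assoc, div_self h, mul_one]

theorem aux_kernel {Ω α β : Type*} [MeasurableSpace Ω] (μ : Measure Ω) [IsProbabilityMeasure μ]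
    [MeasurableSpace α] [MeasurableSingletonClass α]
    [MeasurableSpace β] [MeasurableSingletonClass β]
    (A : Ω → α) (B : Ω → β) (hA : Measurable A) (hB : Measurable B) :
    ∃ ν : α → Measure β, (∀ a, IsProbabilityMeasure (ν a)) ∧
      ∀ a b, μ (A ⁻¹' {a}) * ν a {b} = μ (A ⁻¹' {a} ∩ B ⁻¹' {b}) := by
  classical
  refine ⟨fun a => if μ (A ⁻¹' {a}) = 0 then μ.map B else (μ[|A ⁻¹' {a}]).map B, ?_, ?_⟩
  · intro a
    dsimp only
    split_ifs with h
    · exact Measure.isProbabilityMeasure_map hB.aemeasurable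
    · have := cond_isProbabilityMeasure (μ := μ) h
      exact Measure.isProbabilityMeasure_map hB.aemeasurable
  · intro a b
    dsimp only
    split_ifs with h
    · rw [h, zero_mul]
      exact (measure_mono_null Set.inter_subset_left h).symm
    · rw [Measure.map_apply hB (measurableSet_singleton b), mul_comm,
        cond_mul_eq_inter (hA (measurableSet_singleton a))]

theorem aux_ent_congr {Ω Ω' α : Type*} [MeasurableSpace Ω] [MeasurableSpace Ω'] [Fintype α]
    [MeasurableSpace α] [MeasurableSingletonClass α] {μ : Measure Ω} {μ' : Measure Ω'}
    {A : Ω → α} {A' : Ω' → α} (h : IdentDistrib A A' μ μ') : ent μ A = ent μ' A' := by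
  unfold ent
  refine Finset.sum_congr rfl fun a _ => ?_
  rw [h.measure_preimage_eq (measurableSet_singleton a)]

theorem aux_ent_swap {Ω α β : Type*} [MeasurableSpace Ω] [Fintype α] [Fintype β] (μ : Measure Ω)
    (A : Ω → α) (B : Ω → β) : ent μ (fun ω => (A ω, B ω)) = ent μ (fun ω => (B ω, A ω)) := by
  unfold ent
  refine Fintype.sum_equiv (Equiv.prodComm α β) _ _ fun w => ?_
  have : (fun ω => (A ω, B ω)) ⁻¹' {w} = (fun ω => (B ω, A ω)) ⁻¹' {Equiv.prodComm α β w} := by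
    ext ω; simp [Prod.ext_iff, and_comm]
  rw [this]

/-- entropy of an erased variable -/
theorem aux_mask {Ω α β : Type*} [MeasurableSpace Ω] [Fintype α] [Fintype β]
    (μ : Measure Ω) (M : Ω → Option α) (A : Ω → β) (U : Ω → α) (e : ℝ)
    (h1 : ∀ b, (μ ((fun ω => (A ω, M ω)) ⁻¹' {(b, none)})).toReal = (1 - e) * (μ (A ⁻¹' {b})).toReal)
    (h2 : ∀ b u, (μ ((fun ω => (A ω, M ω)) ⁻¹' {(b, some u)})).toReal
      = e * (μ ((fun ω => (A ω, U ω)) ⁻¹' {(b, u)})).toReal)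
    (s1 : ∑ b, (μ (A ⁻¹' {b})).toReal = 1)
    (s2 : ∑ w, (μ ((fun ω => (A ω, U ω)) ⁻¹' {w})).toReal = 1) :
    ent μ (fun ω => (A ω, M ω)) = (-((1-e) * Real.logb 2 (1-e)) - e * Real.logb 2 e)
      + (1 - e) * ent μ A + e * ent μ (fun ω => (A ω, U ω)) := by
  unfold ent
  have key : ∀ x y : ℝ, -(x * y * Real.logb 2 (x * y)) =
     -(x * Real.logb 2 x) * y + x * -(y * Real.logb 2 y) := by
    intro x y
    rcases eq_or_ne x 0 with rfl | hx
    · simp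
    rcases eq_or_ne y 0 with rfl | hy
    · simp
    rw [Real.logb_mul hx hy]; ring
  rw [Fintype.sum_prod_type] at s2 ⊢
  rw [Fintype.sum_prod_type]
  simp only [Fintype.sum_option, h1, h2, key, Finset.sum_add_distrib, ← Finset.mul_sum, s1, s2]
  ring

/-- **Lower bound `L₁^r` of Theorem 1 (perfect parity).** For `0 ≤ r ≤ H(X|S)` there is a representation `Y` with `I(Y;S') = 0`, `I(X';Y) ≤ r`, and `I(Y;T') ≥ H(T|(X,S)) + r − H((X,S)|T)`. -/
theorem lower_bound_L1r_perfect_parity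
    {Ω 𝒮 𝒳 𝒯 : Type} [MeasurableSpace Ω] (μ : Measure Ω) [IsProbabilityMeasure μ]
    [Fintype 𝒮] [MeasurableSpace 𝒮] [MeasurableSingletonClass 𝒮]
    [Fintype 𝒳] [MeasurableSpace 𝒳] [MeasurableSingletonClass 𝒳]
    [Fintype 𝒯] [MeasurableSpace 𝒯] [MeasurableSingletonClass 𝒯]
    (S : Ω → 𝒮) (X : Ω → 𝒳) (T : Ω → 𝒯)
    (hS : Measurable S) (hX : Measurable X) (hT : Measurable T)
    (r : ℝ) (hr0 : 0 ≤ r) (hr1 : r ≤ condEnt μ X S) :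
    ∃ (Ω' : Type) (_ : MeasurableSpace Ω') (μ' : Measure Ω')
      (𝒴 : Type) (_ : Fintype 𝒴) (_ : MeasurableSpace 𝒴)
      (S' : Ω' → 𝒮) (X' : Ω' → 𝒳) (T' : Ω' → 𝒯) (Y : Ω' → 𝒴),
      IsProbabilityMeasure μ' ∧
      Measurable S' ∧ Measurable X' ∧ Measurable T' ∧ Measurable Y ∧
      IdentDistrib (fun ω => (S ω, X ω, T ω)) (fun ω => (S' ω, X' ω, T' ω)) μ μ' ∧
      mutInf μ' Y S' = 0 ∧ mutInf μ' X' Y ≤ r ∧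
      mutInf μ' Y T' ≥ condEnt μ T (fun ω => (X ω, S ω)) + r - condEnt μ (fun ω => (X ω, S ω)) T := by
  classical
  obtain ⟨ν, hν, hνe⟩ := aux_kernel μ S X hS hX
  obtain ⟨κ, hκ, hκe⟩ := aux_kernel μ (fun ω => (X ω, S ω)) T (hX.prodMk hS) hT
  -- erasure probability
  obtain ⟨e, he0, he1, her⟩ : ∃ e : ℝ, 0 ≤ e ∧ e ≤ 1 ∧ e * condEnt μ X S = r := by
    rcases (hr0.trans hr1).eq_or_lt with h | h
    · refine ⟨0, le_rfl, zero_le_one, ?_⟩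
      rw [← h] at hr1; linarith
    · exact ⟨r / condEnt μ X S, by positivity, (div_le_one h).2 hr1, div_mul_cancel₀ _ h.ne'⟩
  let β : Measure Bool := ENNReal.ofReal e • Measure.dirac true
    + ENNReal.ofReal (1 - e) • Measure.dirac false
  have hβt : (β {true}).toReal = e := by simp [β, he0]
  have hβf : (β {false}).toReal = 1 - e := by simp [β, he1]
  have hβ : IsProbabilityMeasure β := ⟨by
    simp [β, ← ENNReal.ofReal_add he0 (sub_nonneg.2 he1)]⟩
  have hσ : IsProbabilityMeasure (μ.map S) := Measure.isProbabilityMeasure_map hS.aemeasurable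
  let μ' : Measure (𝒮 × (𝒮 → 𝒳) × Bool × (𝒳 × 𝒮 → 𝒯)) :=
    (μ.map S).prod ((Measure.pi ν).prod (β.prod (Measure.pi κ)))
  have hμ' : IsProbabilityMeasure μ' := inferInstance
  have rect : ∀ (a : Set 𝒮) (b : Set (𝒮 → 𝒳)) (c : Set Bool) (d : Set (𝒳 × 𝒮 → 𝒯)),
      μ' (a ×ˢ b ×ˢ c ×ˢ d) = μ.map S a * (Measure.pi ν b * (β c * Measure.pi κ d)) := by
    intro a b c d
    simp only [μ', Measure.prod_prod]
  let S' : 𝒮 × (𝒮 → 𝒳) × Bool × (𝒳 × 𝒮 → 𝒯) → 𝒮 := fun w => w.1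
  let U : 𝒮 × (𝒮 → 𝒳) × Bool × (𝒳 × 𝒮 → 𝒯) → (𝒮 → 𝒳) := fun w => w.2.1
  let V : 𝒮 × (𝒮 → 𝒳) × Bool × (𝒳 × 𝒮 → 𝒯) → (𝒳 × 𝒮 → 𝒯) := fun w => w.2.2.2
  let M : 𝒮 × (𝒮 → 𝒳) × Bool × (𝒳 × 𝒮 → 𝒯) → Option (𝒮 → 𝒳) :=
    fun w => if w.2.2.1 then some w.2.1 else none
  let X' : 𝒮 × (𝒮 → 𝒳) × Bool × (𝒳 × 𝒮 → 𝒯) → 𝒳 := fun w => w.2.1 w.1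
  let T' : 𝒮 × (𝒮 → 𝒳) × Bool × (𝒳 × 𝒮 → 𝒯) → 𝒯 := fun w => w.2.2.2 (X' w, S' w)
  let A' : 𝒮 × (𝒮 → 𝒳) × Bool × (𝒳 × 𝒮 → 𝒯) → 𝒳 × 𝒮 := fun w => (X' w, S' w)
  let Y : 𝒮 × (𝒮 → 𝒳) × Bool × (𝒳 × 𝒮 → 𝒯) → Option (𝒮 → 𝒳) × (𝒳 × 𝒮 → 𝒯) :=
    fun w => (M w, V w)
  have hid : IdentDistrib (fun ω => (S ω, X ω, T ω)) (fun ω => (S' ω, X' ω, T' ω)) μ μ' := by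
    refine ⟨(hS.prodMk (hX.prodMk hT)).aemeasurable, (Measurable.of_discrete).aemeasurable, ?_⟩
    refine Measure.ext_of_singleton ?_
    rintro ⟨s, x, t⟩
    rw [Measure.map_apply (hS.prodMk (hX.prodMk hT)) (measurableSet_singleton _),
      Measure.map_apply (Measurable.of_discrete) (measurableSet_singleton _)]
    have : (fun ω => (S' ω, X' ω, T' ω)) ⁻¹' {(s, x, t)} =
        {s} ×ˢ ((Function.eval s : (𝒮 → 𝒳) → 𝒳) ⁻¹' {x}) ×ˢ Set.univ ×ˢ ((Function.eval (x, s) : (𝒳 × 𝒮 → 𝒯) → 𝒯) ⁻¹' {t}) := by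
      ext ⟨a, b, c, d⟩
      simp only [S', X', T', Set.mem_preimage, Set.mem_singleton_iff, Prod.mk.injEq, Set.mem_prod,
        Set.mem_univ, true_and, Function.eval]
      constructor
      · rintro ⟨rfl, rfl, rfl⟩; simp
      · rintro ⟨rfl, rfl, rfl⟩; simp
    rw [this, rect, (measurePreserving_eval ν s).measure_preimage
      (measurableSet_singleton x).nullMeasurableSet,
      (measurePreserving_eval κ (x, s)).measure_preimage
      (measurableSet_singleton t).nullMeasurableSet, measure_univ, one_mul, ← mul_assoc,
      Measure.map_apply hS (measurableSet_singleton s), hνe]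
    have h2 : S ⁻¹' {s} ∩ X ⁻¹' {x} = (fun ω => (X ω, S ω)) ⁻¹' {(x, s)} := by
      ext ω; simp [and_comm]
    rw [h2, hκe]
    congr 1
    ext ω; simp; tauto
  have hidA : IdentDistrib (fun ω => (X ω, S ω)) A' μ μ' :=
    hid.comp (u := fun p : 𝒮 × 𝒳 × 𝒯 => (p.2.1, p.1)) Measurable.of_discrete
  have hidS : IdentDistrib S S' μ μ' :=
    hid.comp (u := fun p : 𝒮 × 𝒳 × 𝒯 => p.1) Measurable.of_discrete
  have hidT : IdentDistrib T T' μ μ' :=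
    hid.comp (u := fun p : 𝒮 × 𝒳 × 𝒯 => p.2.2) Measurable.of_discrete
  have eA := aux_ent_congr hidA
  have eS := aux_ent_congr hidS
  have eT := aux_ent_congr hidT
  -- independence facts
  have iSU : ent μ' (fun w => (S' w, U w)) = ent μ' S' + ent μ' U := by
    refine aux_indep μ' S' U fun s u => ?_
    have h1 : (fun w => (S' w, U w)) ⁻¹' {(s, u)} = {s} ×ˢ {u} ×ˢ Set.univ ×ˢ Set.univ := by
      ext ⟨a, b, c, d⟩; simp [S', U]
    have h2 : S' ⁻¹' {s} = {s} ×ˢ Set.univ ×ˢ Set.univ ×ˢ Set.univ := by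
      ext ⟨a, b, c, d⟩; simp [S']
    have h3 : U ⁻¹' {u} = Set.univ ×ˢ {u} ×ˢ Set.univ ×ˢ Set.univ := by
      ext ⟨a, b, c, d⟩; simp [U]
    rw [h1, h2, h3]; simp only [rect, measure_univ]; simp
  have iYS : ent μ' (fun w => (Y w, S' w)) = ent μ' Y + ent μ' S' := by
    refine aux_indep μ' Y S' fun y s => ?_
    have h1 : (fun w => (Y w, S' w)) ⁻¹' {(y, s)} =
        {s} ×ˢ {z : (𝒮 → 𝒳) × Bool × (𝒳 × 𝒮 → 𝒯) | ((if z.2.1 then some z.1 else none), z.2.2) = y} := by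
      ext ⟨a, b, c, d⟩; simp [S', Y, M, V, and_comm]
    have h2 : S' ⁻¹' {s} = {s} ×ˢ Set.univ := by
      ext ⟨a, b, c, d⟩; simp [S']
    have h3 : Y ⁻¹' {y} =
        Set.univ ×ˢ {z : (𝒮 → 𝒳) × Bool × (𝒳 × 𝒮 → 𝒯) | ((if z.2.1 then some z.1 else none), z.2.2) = y} := by
      ext ⟨a, b, c, d⟩; simp [Y, M, V]
    rw [h1, h2, h3]; simp only [μ', Measure.prod_prod]; simp [mul_comm]
  -- V is independent of every function of the other coordinates
  have iV : ∀ {ι : Type} [Fintype ι] (f : 𝒮 × (𝒮 → 𝒳) × Bool → ι),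
      ent μ' (fun w => (f (w.1, w.2.1, w.2.2.1), V w)) =
        ent μ' (fun w => f (w.1, w.2.1, w.2.2.1)) + ent μ' V := by
    intro ι _ f
    refine aux_indep μ' _ V fun i v => ?_
    let ρ : Measure (𝒮 × (𝒮 → 𝒳) × Bool) := (μ.map S).prod ((Measure.pi ν).prod β)
    let Φ : (𝒮 × (𝒮 → 𝒳) × Bool × (𝒳 × 𝒮 → 𝒯)) → (𝒮 × (𝒮 → 𝒳) × Bool) × (𝒳 × 𝒮 → 𝒯) :=
      fun w => ((w.1, w.2.1, w.2.2.1), w.2.2.2)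
    have hΦ : μ'.map Φ = ρ.prod (Measure.pi κ) := by
      refine Measure.ext_of_singleton ?_
      rintro ⟨⟨a, b, c⟩, d⟩
      rw [Measure.map_apply Measurable.of_discrete (measurableSet_singleton _)]
      have h1 : Φ ⁻¹' {((a, b, c), d)} = {a} ×ˢ {b} ×ˢ {c} ×ˢ {d} := by
        ext ⟨a, b, c, d⟩; simp [Φ, and_assoc]
      have h2 : ({((a, b, c), d)} : Set ((𝒮 × (𝒮 → 𝒳) × Bool) × (𝒳 × 𝒮 → 𝒯)))
          = ({a} ×ˢ {b} ×ˢ {c}) ×ˢ {d} := by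
        simp only [Set.singleton_prod_singleton]
      rw [h1, h2, rect]
      simp only [ρ, Measure.prod_prod, mul_assoc]
    have pre : ∀ s, μ' (Φ ⁻¹' s) = ρ.prod (Measure.pi κ) s := by
      intro s
      rw [← hΦ, Measure.map_apply Measurable.of_discrete MeasurableSet.of_discrete]
    have h1 : (fun w => (f (w.1, w.2.1, w.2.2.1), V w)) ⁻¹' {(i, v)} =
        Φ ⁻¹' ((f ⁻¹' {i}) ×ˢ {v}) := by
      ext ⟨a, b, c, d⟩; simp [Φ, V]
    have h2 : (fun w : 𝒮 × (𝒮 → 𝒳) × Bool × (𝒳 × 𝒮 → 𝒯) => f (w.1, w.2.1, w.2.2.1)) ⁻¹' {i} =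
        Φ ⁻¹' ((f ⁻¹' {i}) ×ˢ Set.univ) := by
      ext ⟨a, b, c, d⟩; simp [Φ]
    have h3 : V ⁻¹' {v} = Φ ⁻¹' (Set.univ ×ˢ {v}) := by
      ext ⟨a, b, c, d⟩; simp [Φ, V]
    rw [h1, h2, h3]; simp only [pre, Measure.prod_prod]
    simp [ρ]
  have iY : ent μ' Y = ent μ' M + ent μ' V :=
    iV (fun z => if z.2.2 then some z.2.1 else none)
  have iAY : ent μ' (fun w => (A' w, Y w)) = ent μ' (fun w => (A' w, M w)) + ent μ' V := by
    rw [← iV (fun z => ((z.2.1 z.1, z.1), (if z.2.2 then some z.2.1 else none)))]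
    refine le_antisymm ?_ ?_
    · exact aux_mono μ' (fun w => ((A' w, M w), V w)) (fun q => (q.1.1, (q.1.2, q.2)))
    · exact aux_mono μ' (fun w => (A' w, Y w)) (fun q => ((q.1, q.2.1), q.2.2))
  have iAU : ent μ' (fun w => (A' w, U w)) = ent μ' S' + ent μ' U := by
    rw [← iSU]
    refine le_antisymm ?_ ?_
    · exact aux_mono μ' (fun w => (S' w, U w)) (fun q => ((q.2 q.1, q.1), q.2))
    · exact aux_mono μ' (fun w => (A' w, U w)) (fun q => (q.1.2, q.2))
  -- the erasure
  have mask : ∀ {ι : Type} [Fintype ι] (f : 𝒮 × (𝒮 → 𝒳) → ι),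
      ent μ' (fun w => (f (w.1, w.2.1), M w)) = (-((1-e) * Real.logb 2 (1-e)) - e * Real.logb 2 e)
      + (1 - e) * ent μ' (fun w => f (w.1, w.2.1)) + e * ent μ' (fun w => (f (w.1, w.2.1), U w)) := by
    intro ι _ f
    let ρ : Measure (𝒮 × (𝒮 → 𝒳)) := (μ.map S).prod (Measure.pi ν)
    let Φ : (𝒮 × (𝒮 → 𝒳) × Bool × (𝒳 × 𝒮 → 𝒯)) → (𝒮 × (𝒮 → 𝒳)) × Bool :=
      fun w => ((w.1, w.2.1), w.2.2.1)
    have hΦ : μ'.map Φ = ρ.prod β := by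
      refine Measure.ext_of_singleton ?_
      rintro ⟨⟨a, b⟩, c⟩
      rw [Measure.map_apply Measurable.of_discrete (measurableSet_singleton _)]
      have h1 : Φ ⁻¹' {((a, b), c)} = {a} ×ˢ {b} ×ˢ {c} ×ˢ Set.univ := by
        ext ⟨a, b, c, d⟩; simp [Φ, and_assoc]
      have h2 : ({((a, b), c)} : Set ((𝒮 × (𝒮 → 𝒳)) × Bool))
          = ({a} ×ˢ {b}) ×ˢ {c} := by
        simp only [Set.singleton_prod_singleton]
      rw [h1, h2, rect]
      simp only [ρ, Measure.prod_prod, mul_assoc, measure_univ, mul_one]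
    have pre : ∀ s, μ' (Φ ⁻¹' s) = ρ.prod β s := by
      intro s
      rw [← hΦ, Measure.map_apply Measurable.of_discrete MeasurableSet.of_discrete]
    refine aux_mask μ' M _ U e ?_ ?_ (aux_sum_one μ' _) (aux_sum_one μ' _)
    · intro i
      have h1 : (fun w => (f (w.1, w.2.1), M w)) ⁻¹' {(i, none)} =
          Φ ⁻¹' ((f ⁻¹' {i}) ×ˢ {false}) := by
        ext ⟨a, b, c, d⟩; cases c <;> simp [Φ, M]
      have h2 : (fun w : 𝒮 × (𝒮 → 𝒳) × Bool × (𝒳 × 𝒮 → 𝒯) => f (w.1, w.2.1)) ⁻¹' {i} =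
          Φ ⁻¹' ((f ⁻¹' {i}) ×ˢ Set.univ) := by
        ext ⟨a, b, c, d⟩; simp [Φ]
      rw [h1, h2]; simp only [pre, Measure.prod_prod, ENNReal.toReal_mul, hβf, measure_univ]
      simp [mul_comm]
    · intro i u
      have h1 : (fun w => (f (w.1, w.2.1), M w)) ⁻¹' {(i, some u)} =
          Φ ⁻¹' (((f ⁻¹' {i}) ∩ {z | z.2 = u}) ×ˢ {true}) := by
        ext ⟨a, b, c, d⟩; cases c <;> simp [Φ, M]
      have h2 : (fun w => (f (w.1, w.2.1), U w)) ⁻¹' {(i, u)} =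
          Φ ⁻¹' (((f ⁻¹' {i}) ∩ {z | z.2 = u}) ×ˢ Set.univ) := by
        ext ⟨a, b, c, d⟩; simp [Φ, U]
      rw [h1, h2]; simp only [pre, Measure.prod_prod, ENNReal.toReal_mul, hβt, measure_univ]
      simp [mul_comm]
  have mA : ent μ' (fun w => (A' w, M w)) = (-((1-e) * Real.logb 2 (1-e)) - e * Real.logb 2 e)
      + (1 - e) * ent μ' A' + e * ent μ' (fun w => (A' w, U w)) :=
    mask (fun z => (z.2 z.1, z.1))
  have mM : ent μ' M = (-((1-e) * Real.logb 2 (1-e)) - e * Real.logb 2 e) + e * ent μ' U := by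
    have h := mask (fun _ => ())
    have h1 : ent μ' (fun _ => ()) = 0 := by simp [ent]
    have h2 : ent μ' (fun w => ((), M w)) = ent μ' M :=
      le_antisymm (aux_mono μ' M (fun q => ((), q))) (aux_mono μ' (fun w => ((), M w)) (fun q => q.2))
    have h3 : ent μ' (fun w => ((), U w)) = ent μ' U :=
      le_antisymm (aux_mono μ' U (fun q => ((), q))) (aux_mono μ' (fun w => ((), U w)) (fun q => q.2))
    rw [h1, h2, h3] at h
    rw [h]; ring
  have main : ent μ' A' + ent μ' Y - ent μ' (fun w => (A' w, Y w)) = r := by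
    rw [iAY, iY, mA, mM, iAU, ← her, condEnt, eA, eS]; ring
  letI : MeasurableSpace (Option (𝒮 → 𝒳) × (𝒳 × 𝒮 → 𝒯)) := ⊤
  refine ⟨_, inferInstance, μ', Option (𝒮 → 𝒳) × (𝒳 × 𝒮 → 𝒯), inferInstance, ⊤, S', X', T', Y, hμ',
    Measurable.of_discrete, Measurable.of_discrete, Measurable.of_discrete, Measurable.of_discrete,
    hid, ?_, ?_, ?_⟩
  · rw [mutInf, iYS]; ring
  · have h : ent μ' X' + ent μ' (fun ω => (A' ω, Y ω)) ≤
      ent μ' A' + ent μ' (fun ω => (X' ω, Y ω)) := aux_submod μ' A' Y (fun a => a.1)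
    rw [mutInf]; linarith
  · have h : ent μ' (fun ω => (Y ω, T' ω)) ≤ ent μ' (fun ω => (A' ω, Y ω)) :=
      aux_mono μ' (fun ω => (A' ω, Y ω)) (fun q => (q.2, q.2.2 q.1))
    have sw := aux_ent_swap μ T (fun ω => (X ω, S ω))
    rw [mutInf, condEnt, condEnt, sw, eA, eT]; linarith
end

section
/- Lower bound L₂ of Theorem 1 (perfect parity, improved via the tighter SFRL): Let (S,X,T) be jointly distributed random variables with values in finite sets. Then there exists a probability space carrying random variables (S',X',T',Y) such that (S',X',T') has the same joint distribution as (S,X,T), Y takes values in a finite set, Y is independent of the pair (X',S') (so in particular I(Y;S') = 0 and I(X';Y) = 0), and I(Y;T') ≥ H(T|(X,S)) − (log₂(I((X,S);T)+5.51)+1.06). -/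
open MeasureTheory ProbabilityTheory

/-- Exponential distribution with rate `ρ`. -/
noncomputable def mexp (ρ : ℝ) : Measure ℝ :=
  (volume.restrict (Set.Ioi 0)).withDensity (fun x => ENNReal.ofReal (ρ * Real.exp (-ρ * x)))

lemma lint_exp_Ioi (ρ c y : ℝ) (hρ : 0 ≤ ρ) (hc : 0 < c) :
    ∫⁻ x in Set.Ioi y, ENNReal.ofReal (ρ * Real.exp (-c * x))
      = ENNReal.ofReal (ρ * Real.exp (-c * y) / c) := by
  have hi : IntegrableOn (fun x => ρ * Real.exp (-c * x)) (Set.Ioi y) :=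
    (integrableOn_exp_mul_Ioi (by linarith : -c < 0) y).const_mul ρ
  rw [← ofReal_integral_eq_lintegral_ofReal hi
    (Filter.Eventually.of_forall (fun x => by positivity))]
  rw [integral_const_mul, integral_exp_mul_Ioi (by linarith : -c < 0)]
  congr 1
  field_simp

lemma mexp_Ioi (ρ y : ℝ) (hρ : 0 < ρ) (hy : 0 ≤ y) :
    mexp ρ (Set.Ioi y) = ENNReal.ofReal (Real.exp (-ρ * y)) := by
  rw [mexp, withDensity_apply _ measurableSet_Ioi, Measure.restrict_restrict measurableSet_Ioi,
    Set.inter_eq_left.mpr (Set.Ioi_subset_Ioi hy), lint_exp_Ioi _ _ _ hρ.le hρ]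
  congr 1
  field_simp

lemma mexp_Ioi_zero (ρ : ℝ) (hρ : 0 < ρ) : mexp ρ (Set.Ioi 0) = 1 := by
  rw [mexp_Ioi ρ 0 hρ le_rfl]; simp

lemma mexp_prob (ρ : ℝ) (hρ : 0 < ρ) : IsProbabilityMeasure (mexp ρ) := by
  constructor
  rw [← mexp_Ioi_zero ρ hρ, mexp, withDensity_apply _ MeasurableSet.univ,
    withDensity_apply _ measurableSet_Ioi, Measure.restrict_restrict measurableSet_Ioi]
  simp

lemma mexp_lintegral (ρ : ℝ) (f : ℝ → ENNReal) (hf : Measurable f) :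
    ∫⁻ x, f x ∂(mexp ρ) = ∫⁻ x in Set.Ioi 0, ENNReal.ofReal (ρ * Real.exp (-ρ * x)) * f x := by
  rw [mexp, lintegral_withDensity_eq_lintegral_mul _ (by fun_prop) hf]
  rfl

lemma mexp_ae_pos (ρ : ℝ) : ∀ᵐ x ∂(mexp ρ), 0 < x := by
  have : mexp ρ ≪ volume.restrict (Set.Ioi 0) := withDensity_absolutelyContinuous _ _
  exact this.ae_le (ae_restrict_mem measurableSet_Ioi)

lemma mexp_lintegral_le (ρ : ℝ) (hρ : 0 < ρ) (f : ℝ → ENNReal) (hf : Measurable f) :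
    ∫⁻ x, f x ∂(mexp ρ) ≤ ENNReal.ofReal ρ * ∫⁻ x in Set.Ioi 0, f x := by
  rw [mexp_lintegral ρ f hf, ← lintegral_const_mul _ hf]
  refine setLIntegral_mono (by fun_prop) (fun x hx => ?_)
  gcongr
  have : Real.exp (-ρ * x) ≤ 1 := by
    rw [Real.exp_le_one_iff]
    have : (0:ℝ) < x := hx
    nlinarith
  nlinarith

/-- The event that `t` wins the exponential race strictly. -/
def winSet {τ : Type} (r : τ → ℝ) (t : τ) : Set (τ → ℝ) :=
  {w | 0 < r t ∧ 0 < w t ∧ ∀ s, s ≠ t → w t * r s < w s * r t}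

lemma winSet_meas {τ : Type} [Fintype τ] (r : τ → ℝ) (t : τ) : MeasurableSet (winSet r t) := by
  classical
  unfold winSet
  have h1 : MeasurableSet {w : τ → ℝ | 0 < r t} := MeasurableSet.const _
  have h2 : MeasurableSet {w : τ → ℝ | 0 < w t} := measurableSet_lt (by fun_prop) (by fun_prop)
  have h3 : MeasurableSet {w : τ → ℝ | ∀ s, s ≠ t → w t * r s < w s * r t} := by
    have : {w : τ → ℝ | ∀ s, s ≠ t → w t * r s < w s * r t}
        = ⋂ s : τ, ⋂ _ : s ≠ t, {w | w t * r s < w s * r t} := by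
      ext w; simp
    rw [this]
    refine MeasurableSet.iInter (fun s => MeasurableSet.iInter (fun _ => ?_))
    exact measurableSet_lt (by fun_prop) (by fun_prop)
  exact h1.inter (h2.inter h3)

lemma winSet_disj {τ : Type} (r : τ → ℝ) {t t' : τ} {w : τ → ℝ}
    (h : w ∈ winSet r t) (h' : w ∈ winSet r t') : t = t' := by
  by_contra hne
  have h1 := h.2.2 t' (Ne.symm hne)
  have h2 := h'.2.2 t hne
  linarith

lemma winSet_prob {τ : Type} [Fintype τ] (ρ r : τ → ℝ) (hρ : ∀ t, 0 < ρ t)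
    (hr : ∀ t, 0 ≤ r t) (hsum : ∑ t, ρ t * r t = 1) (t : τ) :
    (Measure.pi (fun s => mexp (ρ s))) (winSet r t) = ENNReal.ofReal (ρ t * r t) := by
  classical
  have : ∀ s, IsProbabilityMeasure (mexp (ρ s)) := fun s => mexp_prob _ (hρ s)
  rcases (hr t).eq_or_lt with h0 | hpos
  · have : winSet r t = ∅ := by
      ext w; simp [winSet, ← h0]
    rw [this, ← h0]; simp
  have hmeas := winSet_meas r t
  rw [← lintegral_indicator_one hmeas]
  have hf : Measurable ((winSet r t).indicator (1 : (τ → ℝ) → ENNReal)) :=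
    measurable_one.indicator hmeas
  rw [lintegral_eq_lmarginal_univ (μ := fun s => mexp (ρ s)) (fun _ => 0),
    lmarginal_erase (X := fun _ => ℝ) (μ := fun s => mexp (ρ s)) _ hf (Finset.mem_univ t)]
  have key : ∀ y : ℝ, 0 < y →
      lmarginal (fun s => mexp (ρ s)) (Finset.univ.erase t)
        ((winSet r t).indicator (1 : (τ → ℝ) → ENNReal)) (Function.update (fun _ => 0) t y)
      = ENNReal.ofReal (Real.exp (- ((1 - ρ t * r t) / r t) * y)) := by
    intro y hy
    have hset : ∀ z : (i : {x // x ∈ Finset.univ.erase t}) → ℝ,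
        (winSet r t).indicator (1 : (τ → ℝ) → ENNReal)
          (Function.updateFinset (Function.update (fun _ => 0) t y) (Finset.univ.erase t) z)
        = (Set.univ.pi (fun i : {x // x ∈ Finset.univ.erase t} =>
            Set.Ioi (y * r i / r t))).indicator 1 z := by
      intro z
      refine Set.indicator_eq_indicator ?_ rfl
      simp only [winSet, Set.mem_ofPred_eq, Set.mem_univ_pi, Set.mem_Ioi]
      have ht : Function.updateFinset (Function.update (fun _ => (0:ℝ)) t y)
          (Finset.univ.erase t) z t = y := by
        simp [Function.updateFinset]
      rw [ht]
      constructor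
      · rintro ⟨_, _, h⟩ i
        have h3 := h i.1 (Finset.ne_of_mem_erase i.2)
        have : Function.updateFinset (Function.update (fun _ => (0:ℝ)) t y)
          (Finset.univ.erase t) z i.1 = z i := by
          have hi := Finset.ne_of_mem_erase i.2
          simp [Function.updateFinset, hi]
        rw [this] at h3
        rw [div_lt_iff₀ hpos]; exact h3
      · intro h
        refine ⟨hpos, hy, fun s hs => ?_⟩
        have h3 := h ⟨s, Finset.mem_erase.mpr ⟨hs, Finset.mem_univ s⟩⟩
        rw [div_lt_iff₀ hpos] at h3
        simpa [Function.updateFinset, hs] using h3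
    unfold lmarginal
    rw [lintegral_congr hset, lintegral_indicator_one
      (MeasurableSet.univ_pi (fun i => measurableSet_Ioi)), Measure.pi_pi]
    have : ∀ i : {x // x ∈ Finset.univ.erase t},
        mexp (ρ i) (Set.Ioi (y * r i / r t))
          = ENNReal.ofReal (Real.exp (-ρ i * (y * r i / r t))) := fun i =>
      mexp_Ioi _ _ (hρ _) (by have := hr i; positivity)
    rw [Finset.prod_congr rfl (fun i _ => this i),
      ← ENNReal.ofReal_prod_of_nonneg (fun i _ => (Real.exp_pos _).le), ← Real.exp_sum]
    congr 2
    rw [Finset.sum_coe_sort (Finset.univ.erase t) (fun i => -ρ i * (y * r i / r t))]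
    have h5 : ∑ i ∈ Finset.univ.erase t, ρ i * r i = 1 - ρ t * r t := by
      rw [← hsum, ← Finset.add_sum_erase _ _ (Finset.mem_univ t)]; ring
    rw [← h5, Finset.sum_div, ← Finset.sum_neg_distrib, Finset.sum_mul]
    refine Finset.sum_congr rfl (fun i _ => by ring)
  have hae : ∀ᵐ y ∂(mexp (ρ t)), lmarginal (fun s => mexp (ρ s)) (Finset.univ.erase t)
        ((winSet r t).indicator (1 : (τ → ℝ) → ENNReal)) (Function.update (fun _ => 0) t y)
      = ENNReal.ofReal (Real.exp (- ((1 - ρ t * r t) / r t) * y)) := by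
    filter_upwards [mexp_ae_pos (ρ t)] with y hy using key y hy
  rw [lintegral_congr_ae hae, mexp_lintegral _ _ (by fun_prop)]
  have : ∀ x : ℝ, ENNReal.ofReal (ρ t * Real.exp (-ρ t * x)) *
      ENNReal.ofReal (Real.exp (- ((1 - ρ t * r t) / r t) * x))
      = ENNReal.ofReal (ρ t * Real.exp (-(1 / r t) * x)) := by
    intro x
    rw [← ENNReal.ofReal_mul (by have := hρ t; positivity), mul_assoc, ← Real.exp_add]
    congr 3
    field_simp
    ring
  simp_rw [this]
  rw [lint_exp_Ioi _ _ _ (hρ t).le (by positivity)]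
  congr 1
  simp

/-- The exponential race. -/
lemma race {τ : Type} [Fintype τ] [MeasurableSpace τ] [MeasurableSingletonClass τ]
    (ρ r : τ → ℝ) (hρ : ∀ t, 0 < ρ t)
    (hr : ∀ t, 0 ≤ r t) (hsum : ∑ t, ρ t * r t = 1) :
    ∃ G : (τ → ℝ) → τ, Measurable G ∧ (∀ w, 0 < r (G w)) ∧
      (∀ t, (Measure.pi (fun s => mexp (ρ s))) (G ⁻¹' {t}) = ENNReal.ofReal (ρ t * r t)) ∧
      ∫⁻ w, ENNReal.ofReal (w (G w) / r (G w)) ∂(Measure.pi (fun s => mexp (ρ s))) ≤ 1 := by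
  classical
  have : ∀ s, IsProbabilityMeasure (mexp (ρ s)) := fun s => mexp_prob _ (hρ s)
  set P := Measure.pi (fun s => mexp (ρ s)) with hP
  obtain ⟨t0, ht0⟩ : ∃ t, 0 < r t := by
    by_contra! h
    have : ∑ t, ρ t * r t = 0 := Finset.sum_eq_zero (fun t _ => by
      rw [le_antisymm (h t) (hr t), mul_zero])
    linarith
  let G : (τ → ℝ) → τ := fun w => if h : ∃ t, w ∈ winSet r t then h.choose else t0
  have hG1 : ∀ w t, w ∈ winSet r t → G w = t := by
    intro w t hw
    have h : ∃ t, w ∈ winSet r t := ⟨t, hw⟩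
    simp only [G, dif_pos h]
    exact winSet_disj r h.choose_spec hw
  have hG2 : ∀ w, (¬ ∃ t, w ∈ winSet r t) → G w = t0 := by
    intro w h
    simp only [G, dif_neg h]
  have hGm : Measurable G := by
    refine measurable_to_countable' (fun t => ?_)
    have : G ⁻¹' {t} = winSet r t ∪ (if t = t0 then (⋃ s, winSet r s)ᶜ else ∅) := by
      ext w
      simp only [Set.mem_preimage, Set.mem_singleton_iff, Set.mem_union]
      by_cases h : ∃ s, w ∈ winSet r s
      · obtain ⟨s, hs⟩ := h
        rw [hG1 w s hs]
        constructor
        · rintro rfl; exact Or.inl hs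
        · rintro (h | h)
          · exact winSet_disj r hs h
          · split_ifs at h
            · exact absurd (Set.mem_iUnion.mpr ⟨s, hs⟩) h
            · exact absurd h (Set.notMem_empty _)
      · rw [hG2 w h]
        constructor
        · rintro rfl
          right
          simpa using h
        · rintro (h' | h')
          · exact absurd ⟨t, h'⟩ h
          · split_ifs at h' with ht
            · exact ht.symm
            · exact absurd h' (Set.notMem_empty _)
    rw [this]
    refine (winSet_meas r t).union ?_
    split_ifs
    · exact (MeasurableSet.iUnion (fun s => winSet_meas r s)).compl
    · exact MeasurableSet.empty
  have hU : P (⋃ s, winSet r s) = 1 := by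
    rw [measure_iUnion (fun s t hst => Set.disjoint_left.mpr
      (fun w h h' => hst (winSet_disj r h h'))) (fun s => winSet_meas r s), tsum_fintype]
    simp_rw [hP, winSet_prob ρ r hρ hr hsum]
    rw [← ENNReal.ofReal_sum_of_nonneg (fun t _ => mul_nonneg (hρ t).le (hr t)), hsum]
    simp
  have hae : ∀ᵐ w ∂P, ∃ t, w ∈ winSet r t := by
    have := (prob_compl_eq_zero_iff (μ := P) (MeasurableSet.iUnion (fun s => winSet_meas r s))).mpr hU
    rw [ae_iff]
    convert this using 2
    ext w; simp
  refine ⟨G, hGm, ?_, ?_, ?_⟩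
  · intro w
    by_cases h : ∃ t, w ∈ winSet r t
    · obtain ⟨t, ht⟩ := h
      rw [hG1 w t ht]; exact ht.1
    · rw [hG2 w h]; exact ht0
  · intro t
    rw [← winSet_prob ρ r hρ hr hsum t]
    refine measure_congr ?_
    filter_upwards [hae] with w hw
    obtain ⟨s, hs⟩ := hw
    refine propext ?_
    change G w = t ↔ w ∈ winSet r t
    rw [hG1 w s hs]
    constructor
    · rintro rfl; exact hs
    · intro h; exact winSet_disj r hs h
  · have hfm : Measurable (fun w : τ → ℝ => w (G w) / r (G w)) := by
      have h1 : Measurable (fun w : τ → ℝ => ∑ t, if G w = t then w t / r t else 0) := by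
        refine Finset.measurable_sum _ (fun t _ => Measurable.ite ?_ (by fun_prop) (by fun_prop))
        exact hGm (measurableSet_singleton t)
      convert h1 using 2 with w
      simp
    have hnn : ∀ᵐ w ∂P, 0 ≤ w (G w) / r (G w) := by
      filter_upwards [hae] with w hw
      obtain ⟨s, hs⟩ := hw
      rw [hG1 w s hs]
      exact div_nonneg hs.2.1.le hs.1.le
    rw [lintegral_eq_lintegral_meas_lt P hnn hfm.aemeasurable]
    calc ∫⁻ x in Set.Ioi 0, P {w | x < w (G w) / r (G w)}
        ≤ ∫⁻ x in Set.Ioi (0:ℝ), ENNReal.ofReal (1 * Real.exp (-1 * x)) := by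
          refine setLIntegral_mono (by fun_prop) (fun x hx => ?_)
          have hx : 0 < x := hx
          have hle : P {w | x < w (G w) / r (G w)}
              ≤ P (Set.univ.pi (fun s => Set.Ioi (x * r s))) := by
            refine measure_mono_ae ?_
            filter_upwards [hae] with w hw hlt
            obtain ⟨t, ht⟩ := hw
            have hlt : x < w (G w) / r (G w) := hlt
            rw [hG1 w t ht, lt_div_iff₀ ht.1] at hlt
            change w ∈ Set.univ.pi (fun s => Set.Ioi (x * r s))
            simp only [Set.mem_univ_pi, Set.mem_Ioi]
            intro s
            by_cases hs : s = t
            · rw [hs]; exact hlt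
            · have h1 := ht.2.2 s hs
              have h2 : x * r t * r s ≤ w t * r s := mul_le_mul_of_nonneg_right hlt.le (hr s)
              have h3 : (x * r s) * r t < w s * r t := by linarith
              exact lt_of_mul_lt_mul_right h3 ht.1.le
          refine hle.trans (le_of_eq ?_)
          rw [hP, Measure.pi_pi]
          rw [Finset.prod_congr rfl (fun s _ => mexp_Ioi (ρ s) (x * r s) (hρ s)
            (mul_nonneg hx.le (hr s))),
            ← ENNReal.ofReal_prod_of_nonneg (fun i _ => (Real.exp_pos _).le), ← Real.exp_sum]
          congr 1
          rw [one_mul]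
          congr 1
          rw [← hsum, ← Finset.sum_neg_distrib, Finset.sum_mul]
          exact Finset.sum_congr rfl (fun s _ => by ring)
      _ = 1 := by
          rw [lint_exp_Ioi _ _ _ zero_le_one zero_lt_one]; simp

lemma int_fin {W τ : Type} [MeasurableSpace W] (P : Measure W) [IsProbabilityMeasure P]
    [Fintype τ] [MeasurableSpace τ] [MeasurableSingletonClass τ] (G : W → τ) (hG : Measurable G)
    (f : τ → ℝ) :
    Integrable (fun w => f (G w)) P ∧ ∫ w, f (G w) ∂P = ∑ t, (P (G ⁻¹' {t})).toReal * f t := by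
  have hprob : IsProbabilityMeasure (P.map G) := Measure.isProbabilityMeasure_map hG.aemeasurable
  have hi : Integrable f (P.map G) := Integrable.of_finite
  have hf : Measurable f := measurable_of_countable f
  refine ⟨hi.comp_measurable hG, ?_⟩
  rw [← integral_map hG.aemeasurable hf.aestronglyMeasurable, integral_fintype hi]
  refine Finset.sum_congr rfl (fun t _ => ?_)
  rw [Measure.real, Measure.map_apply hG (measurableSet_singleton t), smul_eq_mul]

/-- weight function -/
noncomputable def wt (b s x : ℝ) : ℝ := s * b ^ s * (x + b) ^ (-1 - s)

lemma wt_lintegral (b s : ℝ) (hb : 0 < b) (hs : 0 < s) :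
    ∫⁻ x in Set.Ioi 0, ENNReal.ofReal (wt b s x) = 1 := by
  have hi : IntegrableOn (fun x => wt b s x) (Set.Ioi 0) :=
    (integrableOn_add_rpow_Ioi_of_lt (by linarith) (by linarith)).const_mul _
  have hnn : 0 ≤ᵐ[volume.restrict (Set.Ioi 0)] (fun x => wt b s x) := by
    filter_upwards [ae_restrict_mem measurableSet_Ioi] with x hx
    have : (0:ℝ) < x := hx
    simp only [wt, Pi.zero_apply]
    positivity
  rw [← ofReal_integral_eq_lintegral_ofReal hi hnn]
  unfold wt
  rw [integral_const_mul]
  have h1 : ∫ x in Set.Ioi (0:ℝ), (x + b) ^ (-1 - s) = b ^ (-s) / s := by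
    have h2 := (measurePreserving_add_right (volume : Measure ℝ) b).setIntegral_preimage_emb
      (measurableEmbedding_addRight b) (fun x : ℝ => x ^ (-1 - s)) (Set.Ioi b)
    rw [Set.preimage_add_const_Ioi, sub_self] at h2
    rw [h2, integral_Ioi_rpow_of_lt (by linarith) hb]
    have : -1 - s + 1 = -s := by ring
    rw [this]
    field_simp
  rw [h1, Real.rpow_neg hb.le]
  have : 0 < b ^ s := by positivity
  have h3 : s * b ^ s * ((b ^ s)⁻¹ / s) = 1 := by field_simp
  rw [h3]; simp

lemma gibbs_point (q v : ℝ) (hq : 0 ≤ q) (hv : 0 ≤ v) (h : 0 < q → 0 < v) :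
    Real.negMulLog q ≤ q * (-Real.log v) + v - q := by
  rcases hq.eq_or_lt with h0 | hpos
  · rw [← h0]; simpa using hv
  · have hv' := h hpos
    have h1 := Real.log_le_sub_one_of_pos (div_pos hv' hpos)
    rw [Real.log_div hv'.ne' hpos.ne'] at h1
    have h2 : q * (Real.log v - Real.log q) ≤ q * (v / q - 1) :=
      mul_le_mul_of_nonneg_left h1 hq
    have h3 : q * (v / q - 1) = v - q := by field_simp
    rw [h3] at h2
    unfold Real.negMulLog
    linarith

lemma neglog_wt (b s x r : ℝ) (hb : 0 < b) (hs : 0 < s) (hx : 0 < x) (hr : 0 < r) :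
    -Real.log (wt b s x) ≤ (-Real.log s - s * Real.log b + (1 + s) * (Real.log (1 + b) - 1))
      + (1 + s) * (Real.log r + (x / r + b / r) / (1 + b)) := by
  have hxb : 0 < x + b := by linarith
  have h1 : Real.log (wt b s x) = Real.log s + s * Real.log b + (-1 - s) * Real.log (x + b) := by
    unfold wt
    rw [Real.log_mul (by positivity) (by positivity), Real.log_mul hs.ne' (by positivity),
      Real.log_rpow hb, Real.log_rpow hxb]
  have h2 := Real.log_le_sub_one_of_pos (show 0 < (x + b) / (r * (1 + b)) by positivity)
  rw [Real.log_div hxb.ne' (by positivity), Real.log_mul hr.ne' (by positivity)] at h2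
  have h3 : (x + b) / (r * (1 + b)) = (x / r + b / r) / (1 + b) := by field_simp
  rw [h3] at h2
  rw [h1]
  have h4 : (1 + s) * Real.log (x + b) ≤ (1 + s) * (Real.log r + Real.log (1 + b)
      + (x / r + b / r) / (1 + b) - 1) := mul_le_mul_of_nonneg_left (by linarith) (by linarith)
  linarith

lemma core {α τ : Type} [Fintype α] [DecidableEq α] [Fintype τ] [DecidableEq τ] [MeasurableSpace τ]
    [MeasurableSingletonClass τ]
    (pA : α → ℝ) (k : α → τ → ℝ) (pT : τ → ℝ) (hpA : ∀ a, 0 ≤ pA a) (hA1 : ∑ a, pA a = 1)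
    (hk : ∀ a t, 0 ≤ k a t) (hk1 : ∀ a, ∑ t, k a t = 1) (hpT : ∀ t, 0 ≤ pT t)
    (hT1 : ∑ t, pT t = 1) (hk0 : ∀ a t, pT t = 0 → k a t = 0)
    (b s : ℝ) (hb : 0 < b) (hs : 0 < s) :
    ∃ ν : Measure (α → τ), IsProbabilityMeasure ν ∧
      (∀ a t, ν {g | g a = t} = ENNReal.ofReal (k a t)) ∧
      ∑ g : α → τ, (ν {g}).toReal *
          ∑ t, Real.negMulLog (∑ a, if g a = t then pA a else 0)
        ≤ (1 + s) * ((∑ a, pA a * ∑ t, k a t * Real.log (k a t / pT t)) + Real.log (1 + b))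
          - s * Real.log b - Real.log s := by
  classical
  let ρ : τ → ℝ := fun t => if pT t = 0 then 1 else pT t
  have hρ : ∀ t, 0 < ρ t := by
    intro t
    simp only [ρ]
    split_ifs with h
    · exact one_pos
    · exact lt_of_le_of_ne (hpT t) (Ne.symm h)
  let r : α → τ → ℝ := fun a t => k a t / ρ t
  have hr : ∀ a t, 0 ≤ r a t := fun a t => div_nonneg (hk a t) (hρ t).le
  have hρr : ∀ a t, ρ t * r a t = k a t := fun a t => mul_div_cancel₀ _ (hρ t).ne'
  have hrk : ∀ a t, 0 < r a t → pT t ≠ 0 := by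
    intro a t h h0
    have : r a t = 0 := by simp only [r]; rw [hk0 a t h0, zero_div]
    linarith
  have hrac := fun a => race ρ (r a) hρ (hr a) (by simp_rw [hρr]; exact hk1 a)
  choose G hGm hGpos hGp hGl using hrac
  have hprob1 : ∀ t, IsProbabilityMeasure (mexp (ρ t)) := fun t => mexp_prob _ (hρ t)
  set P := Measure.pi (fun t => mexp (ρ t)) with hP
  let Gf : (τ → ℝ) → (α → τ) := fun w a => G a w
  have hGf : Measurable Gf := measurable_pi_iff.mpr hGm
  have hGk : ∀ a t, (P (G a ⁻¹' {t})).toReal = k a t := by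
    intro a t
    rw [hGp a t, hρr, ENNReal.toReal_ofReal (hk a t)]
  let H : (α → τ) → ℝ := fun g => ∑ t, Real.negMulLog (∑ a, if g a = t then pA a else 0)
  let v : τ → ℝ → ℝ := fun t x => if pT t = 0 then 0 else wt b s x
  let C : ℝ := -Real.log s - s * Real.log b + (1 + s) * (Real.log (1 + b) - 1)
  let U : (τ → ℝ) → ℝ := fun w =>
    (∑ a, pA a * (C + (1 + s) * (Real.log (r a (G a w)) +
      (w (G a w) / r a (G a w) + b / r a (G a w)) / (1 + b)))) + (∑ t, v t (w t)) - 1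
  have haepos : ∀ᵐ w ∂P, ∀ t, 0 < w t := by
    rw [ae_all_iff]
    intro t
    have := (measurePreserving_eval (fun t => mexp (ρ t)) t).quasiMeasurePreserving.ae
      (mexp_ae_pos (ρ t))
    exact this
  have hpt : ∀ w : τ → ℝ, (∀ t, 0 < w t) → H (Gf w) ≤ U w := by
    intro w hw
    let q : τ → ℝ := fun t => ∑ a, if Gf w a = t then pA a else 0
    have hq0 : ∀ t, 0 ≤ q t := fun t => Finset.sum_nonneg (fun a _ => by
      split_ifs
      · exact hpA a
      · exact le_rfl)
    have hqsum : ∀ f : τ → ℝ, ∑ t, q t * f t = ∑ a, pA a * f (G a w) := by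
      intro f
      simp only [q, Finset.sum_mul, Gf]
      rw [Finset.sum_comm]
      refine Finset.sum_congr rfl (fun a _ => ?_)
      simp [ite_mul]
    have hwt : ∀ t, 0 < wt b s (w t) := by
      intro t
      have := hw t
      unfold wt; positivity
    have hv0 : ∀ t, 0 ≤ v t (w t) := by
      intro t
      simp only [v]
      split_ifs
      · exact le_rfl
      · exact (hwt t).le
    have hqv : ∀ t, 0 < q t → 0 < v t (w t) := by
      intro t ht
      have : ∃ a, G a w = t := by
        by_contra! h
        have : q t = 0 := Finset.sum_eq_zero (fun a _ => if_neg (h a))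
        linarith
      obtain ⟨a, rfl⟩ := this
      have := hrk a _ (hGpos a w)
      simp only [v, if_neg this]
      exact hwt _
    have h1 : H (Gf w) ≤ ∑ t, (q t * (-Real.log (v t (w t))) + v t (w t) - q t) :=
      Finset.sum_le_sum (fun t _ => gibbs_point _ _ (hq0 t) (hv0 t) (hqv t))
    have hq1 : ∑ t, q t = 1 := by
      have := hqsum (fun _ => 1)
      simpa [hA1] using this
    rw [Finset.sum_sub_distrib, Finset.sum_add_distrib, hq1,
      hqsum (fun t => -Real.log (v t (w t)))] at h1
    refine h1.trans ?_
    simp only [U]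
    gcongr with a _
    · exact hpA a
    · have := hrk a _ (hGpos a w)
      simp only [v, if_neg this]
      exact neglog_wt b s _ _ hb hs (hw _) (hGpos a w)
  -- integrals
  have hΘm : ∀ a, Measurable (fun w : τ → ℝ => w (G a w) / r a (G a w)) := by
    intro a
    have h1 : Measurable (fun w : τ → ℝ => ∑ t, if G a w = t then w t / r a t else 0) := by
      refine Finset.measurable_sum _ (fun t _ => Measurable.ite ?_ (by fun_prop) (by fun_prop))
      exact hGm a (measurableSet_singleton t)
    convert h1 using 2 with w
    simp
  have hΘnn : ∀ a, 0 ≤ᵐ[P] (fun w : τ → ℝ => w (G a w) / r a (G a w)) := by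
    intro a
    filter_upwards [haepos] with w hw
    exact (div_pos (hw _) (hGpos a w)).le
  have hΘi : ∀ a, Integrable (fun w : τ → ℝ => w (G a w) / r a (G a w)) P := by
    intro a
    refine ⟨(hΘm a).aestronglyMeasurable, ?_⟩
    rw [hasFiniteIntegral_iff_ofReal (hΘnn a)]
    exact (hGl a).trans_lt ENNReal.one_lt_top
  have hΘ : ∀ a, ∫ w, w (G a w) / r a (G a w) ∂P ≤ 1 := by
    intro a
    rw [integral_eq_lintegral_of_nonneg_ae (hΘnn a) (hΘm a).aestronglyMeasurable]
    exact ENNReal.toReal_le_of_le_ofReal zero_le_one (by simpa using hGl a)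
  have hvm : ∀ t, Measurable (fun w : τ → ℝ => v t (w t)) := by
    intro t
    simp only [v]
    split_ifs
    · exact measurable_const
    · unfold wt; fun_prop
  have hvnn : ∀ t, 0 ≤ᵐ[P] (fun w : τ → ℝ => v t (w t)) := by
    intro t
    filter_upwards [haepos] with w hw
    have := hw t
    simp only [v, wt, Pi.zero_apply]
    split_ifs
    · exact le_rfl
    · positivity
  have hvl : ∀ t, ∫⁻ w, ENNReal.ofReal (v t (w t)) ∂P ≤ ENNReal.ofReal (pT t) := by
    intro t
    by_cases h : pT t = 0
    · simp [v, h]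
    · simp only [v, if_neg h]
      have hm : Measurable (fun x => ENNReal.ofReal (wt b s x)) := by unfold wt; fun_prop
      have h1 := (measurePreserving_eval (fun t => mexp (ρ t)) t).lintegral_comp hm
      have h2 := mexp_lintegral_le (ρ t) (hρ t) _ hm
      rw [wt_lintegral b s hb hs, mul_one, ← h1] at h2
      have h3 : ρ t = pT t := if_neg h
      rw [h3] at h2
      exact h2
  have hvi : ∀ t, Integrable (fun w : τ → ℝ => v t (w t)) P := by
    intro t
    refine ⟨(hvm t).aestronglyMeasurable, ?_⟩
    rw [hasFiniteIntegral_iff_ofReal (hvnn t)]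
    exact (hvl t).trans_lt ENNReal.ofReal_lt_top
  have hvI : ∀ t, ∫ w, v t (w t) ∂P ≤ pT t := by
    intro t
    rw [integral_eq_lintegral_of_nonneg_ae (hvnn t) (hvm t).aestronglyMeasurable]
    exact ENNReal.toReal_le_of_le_ofReal (hpT t) (hvl t)
  have hlogi := fun a => (int_fin P (G a) (hGm a) (fun t => Real.log (r a t))).1
  have hlogI := fun a => (int_fin P (G a) (hGm a) (fun t => Real.log (r a t))).2
  have hbi := fun a => (int_fin P (G a) (hGm a) (fun t => b / r a t)).1
  have hbI := fun a => (int_fin P (G a) (hGm a) (fun t => b / r a t)).2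
  simp_rw [hGk] at hlogI hbI
  have hbI' : ∀ a, ∫ w, b / r a (G a w) ∂P ≤ b := by
    intro a
    rw [hbI a]
    calc ∑ t, k a t * (b / r a t) ≤ ∑ t, b * pT t := by
          refine Finset.sum_le_sum (fun t _ => ?_)
          rcases (hr a t).eq_or_lt with h | h
          · rw [← h, div_zero, mul_zero]; exact mul_nonneg hb.le (hpT t)
          · have h3 : ρ t = pT t := if_neg (hrk a t h)
            rw [← h3, ← hρr a t]
            apply le_of_eq
            field_simp
      _ = b := by rw [← Finset.mul_sum, hT1, mul_one]
  have hin : ∀ a, Integrable (fun w => Real.log (r a (G a w)) +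
      (w (G a w) / r a (G a w) + b / r a (G a w)) / (1 + b)) P := fun a =>
    (hlogi a).add (((hΘi a).add (hbi a)).div_const _)
  have hin2 : ∀ a, Integrable (fun w => pA a * (C + (1 + s) * (Real.log (r a (G a w)) +
      (w (G a w) / r a (G a w) + b / r a (G a w)) / (1 + b)))) P := fun a =>
    ((integrable_const C).add ((hin a).const_mul _)).const_mul _
  have hins : Integrable (fun w => ∑ a, pA a * (C + (1 + s) * (Real.log (r a (G a w)) +
      (w (G a w) / r a (G a w) + b / r a (G a w)) / (1 + b)))) P :=
    integrable_finsetSum _ (fun a _ => hin2 a)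
  have hvs : Integrable (fun w : τ → ℝ => ∑ t, v t (w t)) P :=
    integrable_finsetSum _ (fun t _ => hvi t)
  have hinv : Integrable (fun w => (∑ a, pA a * (C + (1 + s) * (Real.log (r a (G a w)) +
      (w (G a w) / r a (G a w) + b / r a (G a w)) / (1 + b)))) + ∑ t, v t (w t)) P :=
    hins.add hvs
  have hbb : ∀ a, Integrable (fun w => (w (G a w) / r a (G a w) + b / r a (G a w)) / (1 + b)) P :=
    fun a => ((hΘi a).add (hbi a)).div_const _
  have hUi : Integrable U P := hinv.sub (integrable_const 1)
  have hJ : ∀ a, ∑ t, k a t * Real.log (r a t) = ∑ t, k a t * Real.log (k a t / pT t) := by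
    intro a
    refine Finset.sum_congr rfl (fun t _ => ?_)
    by_cases h : pT t = 0
    · rw [hk0 a t h]; simp
    · have h3 : ρ t = pT t := if_neg h
      simp only [r, h3]
  have hUI : ∫ w, U w ∂P ≤ C + (1 + s) *
      ((∑ a, pA a * ∑ t, k a t * Real.log (k a t / pT t)) + 1) := by
    simp only [U]
    rw [integral_sub hinv (integrable_const 1), integral_add hins hvs,
      integral_finsetSum _ (fun a _ => hin2 a), integral_finsetSum _ (fun t _ => hvi t)]
    have e1 : ∑ t, ∫ w, v t (w t) ∂P ≤ 1 := by
      rw [← hT1]; exact Finset.sum_le_sum (fun t _ => hvI t)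
    have e2 : ∑ a, ∫ w, pA a * (C + (1 + s) * (Real.log (r a (G a w)) +
        (w (G a w) / r a (G a w) + b / r a (G a w)) / (1 + b))) ∂P
        ≤ ∑ a, pA a * (C + (1 + s) * (∑ t, k a t * Real.log (k a t / pT t) + 1)) := by
      refine Finset.sum_le_sum (fun a _ => ?_)
      rw [integral_const_mul, integral_add (integrable_const C) ((hin a).const_mul _),
        integral_const_mul, integral_add (hlogi a) (hbb a),
        integral_div, integral_add (hΘi a) (hbi a), hlogI a, hJ a]
      simp only [integral_const, probReal_univ, smul_eq_mul, one_mul]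
      refine mul_le_mul_of_nonneg_left ?_ (hpA a)
      gcongr
      rw [div_le_one (by linarith)]
      exact add_le_add (hΘ a) (hbI' a)
    have e3 : ∑ a, pA a * (C + (1 + s) * (∑ t, k a t * Real.log (k a t / pT t) + 1))
        = C + (1 + s) * ((∑ a, pA a * ∑ t, k a t * Real.log (k a t / pT t)) + 1) := by
      have : ∀ a, pA a * (C + (1 + s) * (∑ t, k a t * Real.log (k a t / pT t) + 1))
          = pA a * (C + (1 + s)) + (1 + s) * (pA a * ∑ t, k a t * Real.log (k a t / pT t)) := by
        intro a; ring
      simp_rw [this]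
      rw [Finset.sum_add_distrib, ← Finset.sum_mul, hA1, ← Finset.mul_sum]
      ring
    simp only [integral_const, probReal_univ, smul_eq_mul, one_mul]
    linarith
  have hHint := int_fin P Gf hGf H
  have hHle : ∫ w, H (Gf w) ∂P ≤ ∫ w, U w ∂P := by
    refine integral_mono_ae hHint.1 hUi ?_
    filter_upwards [haepos] with w hw using hpt w hw
  refine ⟨P.map Gf, Measure.isProbabilityMeasure_map hGf.aemeasurable, ?_, ?_⟩
  · intro a t
    have hms : MeasurableSet {g : α → τ | g a = t} :=
      (measurable_pi_apply (X := fun _ : α => τ) a) (measurableSet_singleton t)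
    rw [Measure.map_apply hGf hms, ← hρr a t, ← hGp a t]
    rfl
  · simp_rw [Measure.map_apply hGf (measurableSet_singleton _)]
    rw [hHint.2] at hHle
    refine (hHle.trans hUI).trans (le_of_eq ?_)
    simp only [C]
    ring

lemma ent_mul_log {Ω α : Type*} [MeasurableSpace Ω] [Fintype α] (μ : Measure Ω) (X : Ω → α) :
    ent μ X * Real.log 2 = ∑ a, Real.negMulLog ((μ (X ⁻¹' {a})).toReal) := by
  have h2 : Real.log 2 ≠ 0 := (Real.log_pos one_lt_two).ne'
  unfold ent
  rw [Finset.sum_mul]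
  refine Finset.sum_congr rfl (fun a _ => ?_)
  unfold Real.logb Real.negMulLog
  field_simp

lemma marg_left {Ω α β : Type*} [MeasurableSpace Ω] (μ : Measure Ω) [IsProbabilityMeasure μ]
    [Fintype β] [MeasurableSpace α] [MeasurableSingletonClass α] [MeasurableSpace β]
    [MeasurableSingletonClass β] (X : Ω → α) (Y : Ω → β) (hX : Measurable X) (hY : Measurable Y)
    (a : α) : ∑ b, (μ ((fun ω => (X ω, Y ω)) ⁻¹' {(a, b)})).toReal = (μ (X ⁻¹' {a})).toReal := by
  classical
  rw [← ENNReal.toReal_sum (fun b _ => measure_ne_top _ _)]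
  congr 1
  rw [← measure_biUnion_finset]
  · congr 1
    ext ω
    simp
  · intro b _ b' _ hbb
    refine Set.disjoint_left.mpr (fun ω h h' => hbb ?_)
    simp only [Set.mem_preimage, Set.mem_singleton_iff, Prod.mk.injEq] at h h'
    rw [← h.2, ← h'.2]
  · intro b _
    exact (hX.prodMk hY) (measurableSet_singleton _)

lemma marg_right {Ω α β : Type*} [MeasurableSpace Ω] (μ : Measure Ω) [IsProbabilityMeasure μ]
    [Fintype α] [MeasurableSpace α] [MeasurableSingletonClass α] [MeasurableSpace β]
    [MeasurableSingletonClass β] (X : Ω → α) (Y : Ω → β) (hX : Measurable X) (hY : Measurable Y)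
    (b : β) : ∑ a, (μ ((fun ω => (X ω, Y ω)) ⁻¹' {(a, b)})).toReal = (μ (Y ⁻¹' {b})).toReal := by
  rw [← marg_left μ Y X hY hX b]
  refine Finset.sum_congr rfl (fun a _ => ?_)
  congr 2
  ext ω
  simp [and_comm]

lemma sum_one {Ω α : Type*} [MeasurableSpace Ω] (μ : Measure Ω) [IsProbabilityMeasure μ]
    [Fintype α] [MeasurableSpace α] [MeasurableSingletonClass α] (X : Ω → α) (hX : Measurable X) :
    ∑ a, (μ (X ⁻¹' {a})).toReal = 1 := by
  have := marg_right μ X (fun _ => ()) hX measurable_const ()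
  rw [show ((fun _ => () : Ω → Unit) ⁻¹' {()}) = Set.univ by ext; simp] at this
  simp only [measure_univ, ENNReal.toReal_one] at this
  rw [← this]
  refine Finset.sum_congr rfl (fun a _ => ?_)
  congr 2
  ext ω
  simp

lemma ent_swap {Ω α β : Type*} [MeasurableSpace Ω] [Fintype α] [Fintype β]
    (μ : Measure Ω) (X : Ω → α) (Y : Ω → β) :
    ent μ (fun ω => (X ω, Y ω)) = ent μ (fun ω => (Y ω, X ω)) := by
  unfold ent
  rw [← (Equiv.prodComm α β).sum_comp]
  refine Finset.sum_congr rfl (fun p _ => ?_)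
  have : (fun ω => (Y ω, X ω)) ⁻¹' {(Equiv.prodComm α β) p} = (fun ω => (X ω, Y ω)) ⁻¹' {p} := by
    ext ω
    obtain ⟨a, b⟩ := p
    simp [and_comm]
  rw [this]

/-- chain rule when the joint law factors through conditional weights -/
lemma ent_chain {Ω α β : Type*} [MeasurableSpace Ω] [Fintype α] [Fintype β]
    (μ : Measure Ω) (X : Ω → α) (Y : Ω → β) (q : α → β → ℝ)
    (hq : ∀ a, ∑ b, q a b = 1)
    (h : ∀ a b, (μ ((fun ω => (X ω, Y ω)) ⁻¹' {(a, b)})).toReal = (μ (X ⁻¹' {a})).toReal * q a b) :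
    ent μ (fun ω => (X ω, Y ω)) * Real.log 2 = ent μ X * Real.log 2 +
      ∑ a, (μ (X ⁻¹' {a})).toReal * ∑ b, Real.negMulLog (q a b) := by
  rw [ent_mul_log, ent_mul_log, Fintype.sum_prod_type, ← Finset.sum_add_distrib]
  refine Finset.sum_congr rfl (fun a _ => ?_)
  simp_rw [h, Real.negMulLog_mul]
  rw [Finset.sum_add_distrib, ← Finset.sum_mul, hq, one_mul, Finset.mul_sum]

lemma mutInf_indep {Ω α β : Type*} [MeasurableSpace Ω] (μ : Measure Ω) [IsProbabilityMeasure μ]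
    [Fintype α] [Fintype β] [MeasurableSpace α] [MeasurableSingletonClass α] [MeasurableSpace β]
    [MeasurableSingletonClass β] (X : Ω → α) (Y : Ω → β) (hX : Measurable X) (hY : Measurable Y)
    (h : IndepFun X Y μ) : mutInf μ X Y = 0 := by
  have h2 : Real.log 2 ≠ 0 := (Real.log_pos one_lt_two).ne'
  have h1 := ent_chain μ X Y (fun _ b => (μ (Y ⁻¹' {b})).toReal) (fun _ => sum_one μ Y hY) (by
    intro a b
    rw [← ENNReal.toReal_mul, ← h.measure_inter_preimage_eq_mul _ _ (measurableSet_singleton a)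
      (measurableSet_singleton b)]
    congr 2
    ext ω; simp)
  rw [← Finset.sum_mul, sum_one μ X hX, one_mul, ← ent_mul_log, ← add_mul] at h1
  have h3 := mul_right_cancel₀ h2 h1
  unfold mutInf
  linarith

lemma numeric1 : Real.log (11 / 10) + 1 + Real.log (Real.log 2) ≤ 1.06 * Real.log 2 := by
  have l1 := Real.log_two_lt_d9
  have l2 := Real.log_two_gt_d9
  have l3 := Real.exp_one_lt_d9
  have he := Real.exp_pos 1
  have hl : 0 < Real.log 2 := Real.log_pos one_lt_two
  have h1 := Real.log_le_sub_one_of_pos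
    (show 0 < 11 / 10 * Real.exp 1 * Real.log 2 / 2 by positivity)
  rw [Real.log_div (by positivity) (by norm_num), Real.log_mul (by positivity) hl.ne',
    Real.log_mul (by norm_num) he.ne', Real.log_exp] at h1
  have h2 : Real.exp 1 * Real.log 2 ≤ 2.7182818286 * 0.6931471808 :=
    mul_le_mul l3.le l1.le hl.le (by norm_num)
  linarith

lemma numeric2 (J : ℝ) (hJ : 0 ≤ J) :
    ∃ s : ℝ, 0 < s ∧ (1 + s) * (J + Real.log (1 + 1 / 10)) - s * Real.log (1 / 10) - Real.log s
      ≤ J + (Real.logb 2 (J / Real.log 2 + 5.51) + 1.06) * Real.log 2 := by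
  have hl : 0 < Real.log 2 := Real.log_pos one_lt_two
  have hM : 0 < J + 5.51 * Real.log 2 := by positivity
  refine ⟨1 / (J + 5.51 * Real.log 2), by positivity, ?_⟩
  have e1 : Real.log (1 / (J + 5.51 * Real.log 2))
      = - (Real.log (J / Real.log 2 + 5.51) + Real.log (Real.log 2)) := by
    rw [← Real.log_mul (by positivity) hl.ne', one_div, Real.log_inv]
    congr 2
    field_simp
  have e2 : (Real.logb 2 (J / Real.log 2 + 5.51) + 1.06) * Real.log 2
      = Real.log (J / Real.log 2 + 5.51) + 1.06 * Real.log 2 := by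
    unfold Real.logb
    field_simp
  have e3 : Real.log (1 / 10 : ℝ) = Real.log (11 / 10) - Real.log 11 := by
    rw [← Real.log_div (by norm_num) (by norm_num)]; norm_num
  have e4 : Real.log 11 ≤ 5 * Real.log 2 := by
    rw [← Real.log_rpow (by norm_num)]
    exact Real.log_le_log (by norm_num) (by norm_num)
  have e5 : 1 / (J + 5.51 * Real.log 2) * (J + Real.log 11) ≤ 1 := by
    rw [one_div, inv_mul_le_iff₀ hM]
    linarith
  have e6 := numeric1
  rw [e1, e2, e3, show (1 + 1 / 10 : ℝ) = 11 / 10 by norm_num]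
  set s := 1 / (J + 5.51 * Real.log 2)
  linarith

/-- **Lower bound `L₂` of Theorem 1 (perfect parity, via the tighter SFRL).** There is a representation `Y` independent of the pair `(X', S')` (so `I(Y;S') = 0` and `I(X';Y) = 0`) with `I(Y;T') ≥ H(T|(X,S)) − (log₂(I((X,S);T) + 5.51) + 1.06)`. -/
theorem lower_bound_L2_perfect_parity
    {Ω 𝒮 𝒳 𝒯 : Type} [MeasurableSpace Ω] (μ : Measure Ω) [IsProbabilityMeasure μ]
    [Fintype 𝒮] [MeasurableSpace 𝒮] [MeasurableSingletonClass 𝒮]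
    [Fintype 𝒳] [MeasurableSpace 𝒳] [MeasurableSingletonClass 𝒳]
    [Fintype 𝒯] [MeasurableSpace 𝒯] [MeasurableSingletonClass 𝒯]
    (S : Ω → 𝒮) (X : Ω → 𝒳) (T : Ω → 𝒯)
    (hS : Measurable S) (hX : Measurable X) (hT : Measurable T) :
    ∃ (Ω' : Type) (_ : MeasurableSpace Ω') (μ' : Measure Ω')
      (𝒴 : Type) (_ : Fintype 𝒴) (_ : MeasurableSpace 𝒴)
      (S' : Ω' → 𝒮) (X' : Ω' → 𝒳) (T' : Ω' → 𝒯) (Y : Ω' → 𝒴),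
      IsProbabilityMeasure μ' ∧
      Measurable S' ∧ Measurable X' ∧ Measurable T' ∧ Measurable Y ∧
      IdentDistrib (fun ω => (S ω, X ω, T ω)) (fun ω => (S' ω, X' ω, T' ω)) μ μ' ∧
      IndepFun Y (fun ω => (X' ω, S' ω)) μ' ∧
      mutInf μ' Y S' = 0 ∧ mutInf μ' X' Y = 0 ∧
      mutInf μ' Y T' ≥ condEnt μ T (fun ω => (X ω, S ω))
        - (Real.logb 2 (mutInf μ (fun ω => (X ω, S ω)) T + 5.51) + 1.06) := by
  classical
  have hl : 0 < Real.log 2 := Real.log_pos one_lt_two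
  let A : Ω → 𝒳 × 𝒮 := fun ω => (X ω, S ω)
  have hA : Measurable A := hX.prodMk hS
  let pA : 𝒳 × 𝒮 → ℝ := fun a => (μ (A ⁻¹' {a})).toReal
  let pT : 𝒯 → ℝ := fun t => (μ (T ⁻¹' {t})).toReal
  let pJ : 𝒳 × 𝒮 → 𝒯 → ℝ := fun a t => (μ ((fun ω => (A ω, T ω)) ⁻¹' {(a, t)})).toReal
  have hpA : ∀ a, 0 ≤ pA a := fun a => ENNReal.toReal_nonneg
  have hpT : ∀ t, 0 ≤ pT t := fun t => ENNReal.toReal_nonneg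
  have hpJ : ∀ a t, 0 ≤ pJ a t := fun a t => ENNReal.toReal_nonneg
  have hA1 : ∑ a, pA a = 1 := sum_one μ A hA
  have hT1 : ∑ t, pT t = 1 := sum_one μ T hT
  have hJA : ∀ a, ∑ t, pJ a t = pA a := marg_left μ A T hA hT
  have hJT : ∀ t, ∑ a, pJ a t = pT t := marg_right μ A T hA hT
  let k : 𝒳 × 𝒮 → 𝒯 → ℝ := fun a t => if pA a = 0 then pT t else pJ a t / pA a
  have hk : ∀ a t, 0 ≤ k a t := by
    intro a t
    simp only [k]
    split_ifs
    · exact hpT t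
    · exact div_nonneg (hpJ a t) (hpA a)
  have hk1 : ∀ a, ∑ t, k a t = 1 := by
    intro a
    simp only [k]
    split_ifs with h
    · exact hT1
    · rw [← Finset.sum_div, hJA, div_self h]
  have hk0 : ∀ a t, pT t = 0 → k a t = 0 := by
    intro a t h
    have h1 : pJ a t = 0 :=
      (Finset.sum_eq_zero_iff_of_nonneg (fun a _ => hpJ a t)).mp ((hJT t).trans h) a
        (Finset.mem_univ a)
    simp only [k, h, h1, zero_div, ite_self]
  have hpk : ∀ a t, pJ a t = pA a * k a t := by
    intro a t
    by_cases h : pA a = 0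
    · rw [h, zero_mul]
      exact (Finset.sum_eq_zero_iff_of_nonneg (fun t _ => hpJ a t)).mp ((hJA a).trans h) t
        (Finset.mem_univ t)
    · simp only [k, if_neg h]
      field_simp
  -- mutual information
  let J : ℝ := ∑ a, pA a * ∑ t, k a t * Real.log (k a t / pT t)
  have hlogk : ∀ a t, k a t * Real.log (k a t / pT t)
      = - Real.negMulLog (k a t) - k a t * Real.log (pT t) := by
    intro a t
    unfold Real.negMulLog
    by_cases h : k a t = 0
    · rw [h]; simp
    · have : pT t ≠ 0 := fun h0 => h (hk0 a t h0)
      rw [Real.log_div h this]; ring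
  have hJ0 : 0 ≤ J := by
    refine Finset.sum_nonneg (fun a _ => mul_nonneg (hpA a) ?_)
    have h1 : ∑ t, (k a t - pT t) ≤ ∑ t, k a t * Real.log (k a t / pT t) := by
      refine Finset.sum_le_sum (fun t _ => ?_)
      have := gibbs_point (k a t) (pT t) (hk a t) (hpT t) (fun h =>
        lt_of_le_of_ne (hpT t) (fun h0 => h.ne' (hk0 a t h0.symm)))
      rw [hlogk]
      linarith
    rw [Finset.sum_sub_distrib, hk1, hT1] at h1
    linarith
  have hchain := ent_chain μ A T k hk1 hpk
  have hIJ : mutInf μ A T * Real.log 2 = J := by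
    have e1 : J = - ∑ a, pA a * ∑ t, Real.negMulLog (k a t) - ∑ t, pT t * Real.log (pT t) := by
      simp only [J, hlogk, Finset.sum_sub_distrib, mul_sub, Finset.sum_neg_distrib, mul_neg]
      congr 1
      simp_rw [Finset.mul_sum]
      rw [Finset.sum_comm]
      refine Finset.sum_congr rfl (fun t _ => ?_)
      rw [← hJT t, Finset.sum_mul]
      refine Finset.sum_congr rfl (fun a _ => ?_)
      rw [hpk]; ring
    have e2 : ent μ T * Real.log 2 = - ∑ t, pT t * Real.log (pT t) := by
      rw [ent_mul_log, ← Finset.sum_neg_distrib]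
      refine Finset.sum_congr rfl (fun t _ => ?_)
      simp [Real.negMulLog, pT]
    unfold mutInf
    rw [sub_mul, add_mul, hchain, e1, e2]
    simp only [pA]
    ring
  obtain ⟨s, hs, hsb⟩ := numeric2 J hJ0
  obtain ⟨ν, hν, hνk, hνH⟩ := core pA k pT hpA hA1 hk hk1 hpT hT1 hk0 (1 / 10) s (by norm_num) hs
  have hνH' := hνH.trans hsb
  have hμA : IsProbabilityMeasure (μ.map A) := Measure.isProbabilityMeasure_map hA.aemeasurable
  let μ' : Measure ((𝒳 × 𝒮) × (𝒳 × 𝒮 → 𝒯)) := (μ.map A).prod ν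
  have hpos : ∀ a, μ.map A {a} = ENNReal.ofReal (pA a) := by
    intro a
    rw [Measure.map_apply hA (measurableSet_singleton a)]
    exact (ENNReal.ofReal_toReal (measure_ne_top _ _)).symm
  let S' : (𝒳 × 𝒮) × (𝒳 × 𝒮 → 𝒯) → 𝒮 := fun ω => ω.1.2
  let X' : (𝒳 × 𝒮) × (𝒳 × 𝒮 → 𝒯) → 𝒳 := fun ω => ω.1.1
  let T' : (𝒳 × 𝒮) × (𝒳 × 𝒮 → 𝒯) → 𝒯 := fun ω => ω.2 ω.1
  let Y : (𝒳 × 𝒮) × (𝒳 × 𝒮 → 𝒯) → (𝒳 × 𝒮 → 𝒯) := fun ω => ω.2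
  have hS' : Measurable S' := measurable_of_countable _
  have hX' : Measurable X' := measurable_of_countable _
  have hT' : Measurable T' := measurable_of_countable _
  have hY : Measurable Y := measurable_of_countable _
  have hprob : IsProbabilityMeasure μ' := by
    simp only [μ']; infer_instance
  have hid : IdentDistrib (fun ω => (S ω, X ω, T ω)) (fun ω => (S' ω, X' ω, T' ω)) μ μ' := by
    refine ⟨(hS.prodMk (hX.prodMk hT)).aemeasurable, (hS'.prodMk (hX'.prodMk hT')).aemeasurable, ?_⟩
    refine Measure.ext_of_singleton (fun p => ?_)
    obtain ⟨s, x, t⟩ := p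
    rw [Measure.map_apply (hS.prodMk (hX.prodMk hT)) (measurableSet_singleton _),
      Measure.map_apply (hS'.prodMk (hX'.prodMk hT')) (measurableSet_singleton _)]
    have e1 : (fun ω => (S' ω, X' ω, T' ω)) ⁻¹' {(s, x, t)}
        = {(x, s)} ×ˢ {g : 𝒳 × 𝒮 → 𝒯 | g (x, s) = t} := by
      ext ⟨⟨x', s'⟩, g⟩
      simp only [S', X', T', Set.mem_preimage, Set.mem_singleton_iff, Prod.mk.injEq,
        Set.mem_prod, Set.mem_ofPred_eq]
      constructor
      · rintro ⟨rfl, rfl, rfl⟩; exact ⟨⟨rfl, rfl⟩, rfl⟩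
      · rintro ⟨⟨rfl, rfl⟩, rfl⟩; exact ⟨rfl, rfl, rfl⟩
    have e2 : (fun ω => (S ω, X ω, T ω)) ⁻¹' {(s, x, t)}
        = (fun ω => (A ω, T ω)) ⁻¹' {((x, s), t)} := by
      ext ω
      simp only [A, Set.mem_preimage, Set.mem_singleton_iff, Prod.mk.injEq]
      tauto
    rw [e1, e2]
    simp only [μ']
    rw [Measure.prod_prod, hνk, hpos, ← ENNReal.ofReal_mul (hpA _), ← hpk]
    exact (ENNReal.ofReal_toReal (measure_ne_top _ _)).symm
  have hind : IndepFun Y (fun ω => (X' ω, S' ω)) μ' :=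
    (indepFun_prod (μ := μ.map A) (ν := ν) (X := fun a => a) (Y := fun g => g)
      measurable_id measurable_id).symm
  have hindS : IndepFun Y S' μ' := hind.comp measurable_id measurable_snd
  have hindX : IndepFun Y X' μ' := hind.comp measurable_id measurable_fst
  refine ⟨_, inferInstance, μ', 𝒳 × 𝒮 → 𝒯, inferInstance, inferInstance, S', X', T', Y, hprob,
    hS', hX', hT', hY, hid, hind, mutInf_indep μ' Y S' hY hS' hindS,
    mutInf_indep μ' X' Y hX' hY hindX.symm, ?_⟩
  have hentT : ent μ' T' = ent μ T := by
    unfold ent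
    refine Finset.sum_congr rfl (fun t _ => ?_)
    have h1 : IdentDistrib T T' μ μ' := hid.comp (u := fun p : 𝒮 × 𝒳 × 𝒯 => p.2.2) (by fun_prop)
    rw [h1.measure_mem_eq (measurableSet_singleton t)]
  have hYν : ∀ g, μ' (Y ⁻¹' {g}) = ν {g} := by
    intro g
    have : Y ⁻¹' {g} = Set.univ ×ˢ {g} := by
      ext ω; simp [Y]
    rw [this]
    simp only [μ']
    rw [Measure.prod_prod, measure_univ, one_mul]
  have hch := ent_chain μ' Y T' (fun g t => ∑ a, if g a = t then pA a else 0)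
    (by
      intro g
      rw [Finset.sum_comm]
      simpa using hA1)
    (by
      intro g t
      have : (fun ω => (Y ω, T' ω)) ⁻¹' {(g, t)} = {a | g a = t} ×ˢ {g} := by
        ext ⟨a, g'⟩
        simp only [Y, T', Set.mem_preimage, Set.mem_singleton_iff, Prod.mk.injEq,
          Set.mem_prod, Set.mem_ofPred_eq]
        constructor
        · rintro ⟨rfl, h⟩; exact ⟨h, rfl⟩
        · rintro ⟨h, rfl⟩; exact ⟨rfl, h⟩
      rw [this, hYν]
      simp only [μ']
      rw [Measure.prod_prod, ENNReal.toReal_mul, mul_comm]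
      congr 1
      have h3 : {a | g a = t} = ((Finset.univ.filter (fun a => g a = t) : Finset (𝒳 × 𝒮)) :
          Set (𝒳 × 𝒮)) := by
        ext a; simp
      rw [h3, ← sum_measure_singleton, ENNReal.toReal_sum (fun a _ => measure_ne_top _ _),
        Finset.sum_filter]
      refine Finset.sum_congr rfl (fun a _ => ?_)
      rw [hpos, ENNReal.toReal_ofReal (hpA a)])
  simp_rw [hYν] at hch
  have hIdiv : J / Real.log 2 = mutInf μ A T := by
    rw [← hIJ]; field_simp
  rw [hIdiv] at hνH'
  have hce : condEnt μ T A = ent μ T - mutInf μ A T := by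
    unfold condEnt mutInf
    rw [ent_swap μ T A]
    ring
  change mutInf μ' Y T' ≥ condEnt μ T A - (Real.logb 2 (mutInf μ A T + 5.51) + 1.06)
  rw [hce]
  refine le_of_mul_le_mul_right ?_ hl
  have hfin : mutInf μ' Y T' * Real.log 2 = ent μ T * Real.log 2 - ∑ g : 𝒳 × 𝒮 → 𝒯, (ν {g}).toReal *
          ∑ t, Real.negMulLog (∑ a, if g a = t then pA a else 0) := by
    unfold mutInf
    rw [sub_mul, add_mul, hch, hentT]
    ring
  rw [hfin, sub_mul, sub_mul, hIJ]
  linarith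
end

section
/- Lower bound L₃^r of Theorem 1 (perfect parity): Let (S,X,T) be jointly distributed random variables with values in finite sets with H(X|S) > 0, let r satisfy 0 ≤ r ≤ H(X|S), and set α = r/H(X|S). Then there exists a probability space carrying random variables (S',X',T',Y) such that (S',X',T') has the same joint distribution as (S,X,T), Y takes values in a finite set, I(Y;S') = 0, I(X';Y) ≤ r, and I(Y;T') ≥ H(T|(X,S)) + r − α·H((X,S)|T) − 1.06 − log₂((1−α)·I((X,S);T) + α·min{H(T), H(X,S)} + 5.51). -/
open MeasureTheory ProbabilityTheory

namespace Race
open Real Set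

/-- The standard exponential law on the reals. -/
noncomputable def expm : Measure ℝ :=
  (volume.restrict (Ioi 0)).withDensity (fun x => ENNReal.ofReal (exp (-x)))

lemma meas_dens : Measurable (fun x : ℝ => ENNReal.ofReal (exp (-x))) := by fun_prop

lemma lintegral_expm (g : ℝ → ENNReal) (hg : Measurable g) :
    ∫⁻ x, g x ∂expm = ∫⁻ x in Ioi 0, ENNReal.ofReal (exp (-x)) * g x := by
  unfold expm
  rw [lintegral_withDensity_eq_lintegral_mul _ meas_dens hg]
  rfl

lemma expm_Ioi {c : ℝ} (hc : 0 ≤ c) : expm (Ioi c) = ENNReal.ofReal (exp (-c)) := by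
  unfold expm
  rw [withDensity_apply _ measurableSet_Ioi, Measure.restrict_restrict measurableSet_Ioi,
    inter_eq_left.2 (Ioi_subset_Ioi hc), ← integral_exp_neg_Ioi c,
    ofReal_integral_eq_lintegral_ofReal]
  · exact integrableOn_exp_neg_Ioi c
  · exact Filter.Eventually.of_forall fun x => (exp_pos _).le

lemma expm_ae_pos : ∀ᵐ x ∂expm, 0 < x := by
  unfold expm
  exact (withDensity_absolutelyContinuous _ _) (ae_restrict_mem measurableSet_Ioi)

instance : IsProbabilityMeasure expm := by
  constructor
  have h : expm (Ioi 0) = expm univ := by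
    apply measure_congr
    filter_upwards [expm_ae_pos] with x hx
    exact propext ⟨fun _ => trivial, fun _ => hx⟩
  rw [← h, expm_Ioi le_rfl]; simp

/-- `t` wins the exponential race with weights `p`. -/
def win {ι : Type*} (p : ι → ℝ) (t : ι) : Set (ι → ℝ) :=
  {e | ∀ u, u ≠ t → e t * p u < e u * p t}

lemma measurableSet_win {ι : Type*} [Fintype ι] (p : ι → ℝ) (t : ι) :
    MeasurableSet (win p t) := by
  unfold win
  have : {e : ι → ℝ | ∀ u, u ≠ t → e t * p u < e u * p t}
      = ⋂ u, ⋂ (_ : u ≠ t), {e : ι → ℝ | e t * p u < e u * p t} := by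
    ext e; simp
  rw [this]
  refine MeasurableSet.iInter fun u => MeasurableSet.iInter fun _ => ?_
  apply measurableSet_lt <;> fun_prop

/-- Product law. -/
noncomputable def pim (ι : Type*) [Fintype ι] : Measure (ι → ℝ) := Measure.pi (fun _ => expm)

instance (ι : Type*) [Fintype ι] : IsProbabilityMeasure (pim ι) := by
  unfold pim; infer_instance

lemma race {ι : Type*} [Fintype ι] [DecidableEq ι] (p : ι → ℝ) (hp : ∀ i, 0 ≤ p i)
    (hs : ∑ i, p i = 1) (t : ι) (ht : 0 < p t) (φ : ℝ → ENNReal) (hφ : Measurable φ) :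
    ∫⁻ e, (win p t).indicator (fun e => φ (e t)) e ∂(pim ι)
      = ∫⁻ x in Ioi 0, ENNReal.ofReal (exp (-((1 / p t) * x))) * φ x := by
  have hf : Measurable ((win p t).indicator (fun e : ι → ℝ => φ (e t))) :=
    Measurable.indicator (hφ.comp (measurable_pi_apply t)) (measurableSet_win p t)
  unfold pim
  rw [lintegral_eq_lmarginal_univ (fun _ => (0:ℝ)), lmarginal_erase _ hf (Finset.mem_univ t)]
  have key : ∀ y : ℝ, 0 < y →
      lmarginal (fun _ => expm) (Finset.univ.erase t)
        ((win p t).indicator (fun e : ι → ℝ => φ (e t)))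
        (Function.update (fun _ => (0:ℝ)) t y)
      = φ y * ENNReal.ofReal (exp (-(y * (1 / p t - 1)))) := by
    intro y hy
    unfold lmarginal
    have h1 : ∀ z : ((i : (Finset.univ.erase t : Finset ι)) → ℝ),
        (win p t).indicator (fun e : ι → ℝ => φ (e t))
          (Function.updateFinset (Function.update (fun _ => (0:ℝ)) t y) (Finset.univ.erase t) z)
        = (Set.pi univ (fun i : (Finset.univ.erase t : Finset ι) => Ioi (y * p i / p t))).indicator
            (fun _ => φ y) z := by
      intro z
      have ht' : Function.updateFinset (Function.update (fun _ => (0:ℝ)) t y)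
          (Finset.univ.erase t) z t = y := by
        simp [Function.updateFinset]
      have hu : ∀ u (hu : u ≠ t), Function.updateFinset (Function.update (fun _ => (0:ℝ)) t y)
          (Finset.univ.erase t) z u = z ⟨u, by simp [hu]⟩ := by
        intro u hu
        simp [Function.updateFinset, hu]
      simp only [indicator, ht']
      congr 1
      apply propext
      simp only [win, mem_setOf_eq, ht', mem_pi, mem_univ, true_implies, mem_Ioi]
      constructor
      · rintro h ⟨u, hu'⟩
        have hut : u ≠ t := by simpa using hu'
        have := h u hut
        rw [hu u hut] at this
        rw [div_lt_iff₀ ht]; exact this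
      · intro h u hut
        have := h ⟨u, by simp [hut]⟩
        rw [div_lt_iff₀ ht] at this
        rw [hu u hut]; exact this
    simp_rw [h1]
    rw [lintegral_indicator (MeasurableSet.univ_pi fun i => measurableSet_Ioi), lintegral_const,
      Measure.restrict_apply_univ, Measure.pi_pi]
    congr 1
    have h2 : ∀ i : (Finset.univ.erase t : Finset ι), expm (Ioi (y * p i / p t))
        = ENNReal.ofReal (exp (-(y * p i / p t))) := fun i =>
      expm_Ioi (by have := hp i; positivity)
    simp_rw [h2]
    rw [← ENNReal.ofReal_prod_of_nonneg (fun i _ => (exp_pos _).le), ← exp_sum]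
    congr 2
    rw [Finset.sum_coe_sort (Finset.univ.erase t) (fun i => -(y * p i / p t))]
    have h3 : ∑ i ∈ Finset.univ.erase t, p i = 1 - p t := by
      rw [← hs, ← Finset.add_sum_erase _ _ (Finset.mem_univ t)]; ring
    rw [Finset.sum_neg_distrib, ← Finset.sum_div, ← Finset.mul_sum, h3]
    field_simp
  have hm : Measurable fun y : ℝ => φ y * ENNReal.ofReal (exp (-(y * (1 / p t - 1)))) := by
    fun_prop
  calc _ = ∫⁻ y, φ y * ENNReal.ofReal (exp (-(y * (1 / p t - 1)))) ∂expm := by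
        apply lintegral_congr_ae
        filter_upwards [expm_ae_pos] with y hy
        exact key y hy
    _ = _ := by
        rw [lintegral_expm _ hm]
        apply lintegral_congr
        intro x
        rw [mul_comm (φ x), ← mul_assoc, ← ENNReal.ofReal_mul (exp_pos _).le, ← exp_add]
        congr 3
        ring

lemma int_one {c : ℝ} (hc : 0 < c) :
    ∫⁻ x in Ioi 0, ENNReal.ofReal (exp (-((1 / c) * x))) = ENNReal.ofReal c := by
  have h := integral_rpow_mul_exp_neg_mul_Ioi (a := 1) (r := 1 / c) one_pos (by positivity)
  simp only [sub_self, rpow_zero, one_mul, one_div_one_div, rpow_one, Gamma_one, mul_one] at h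
  rw [← ofReal_integral_eq_lintegral_ofReal, h]
  · by_contra hn
    rw [integral_undef hn] at h
    exact hc.ne h
  · exact Filter.Eventually.of_forall fun x => (exp_pos _).le

lemma int_x {c : ℝ} (hc : 0 < c) :
    ∫⁻ x in Ioi 0, ENNReal.ofReal (exp (-((1 / c) * x))) * ENNReal.ofReal x
      = ENNReal.ofReal (c ^ 2) := by
  have h := integral_rpow_mul_exp_neg_mul_Ioi (a := 2) (r := 1 / c) two_pos (by positivity)
  have h21 : (2:ℝ) - 1 = 1 := by norm_num
  simp only [h21, rpow_one, one_div_one_div, Gamma_two, mul_one, rpow_two] at h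
  have h' : ∫⁻ x in Ioi 0, ENNReal.ofReal (exp (-((1 / c) * x))) * ENNReal.ofReal x
      = ∫⁻ x in Ioi 0, ENNReal.ofReal (x * exp (-((1 / c) * x))) := by
    apply lintegral_congr
    intro x
    rw [← ENNReal.ofReal_mul (exp_pos _).le, mul_comm]
  rw [h', ← ofReal_integral_eq_lintegral_ofReal, h]
  · by_contra hn
    rw [integral_undef hn] at h
    exact (by positivity : (0:ℝ) < c ^ 2).ne h
  · filter_upwards [ae_restrict_mem measurableSet_Ioi] with x hx
    have : (0:ℝ) < x := hx
    positivity

lemma pim_ae_pos (ι : Type*) [Fintype ι] : ∀ᵐ e ∂(pim ι), ∀ i, 0 < e i := by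
  rw [ae_all_iff]
  intro i
  exact (measurePreserving_eval (fun _ : ι => expm) i).quasiMeasurePreserving.ae expm_ae_pos

lemma win_null {ι : Type*} [Fintype ι] (p : ι → ℝ) (hs : ∑ i, p i = 1) (t : ι) (ht : p t = 0) : ∀ᵐ e ∂(pim ι), e ∉ win p t := by
  filter_upwards [pim_ae_pos ι] with e he hw
  have : ∃ u, 0 < p u := by
    by_contra h
    push Not at h
    have : ∑ i, p i ≤ 0 := Finset.sum_nonpos fun i _ => h i
    linarith
  obtain ⟨u, hu⟩ := this
  have hut : u ≠ t := by rintro rfl; linarith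
  have := hw u hut
  rw [ht, mul_zero] at this
  have := mul_pos (he t) hu
  linarith

lemma win_prob {ι : Type*} [Fintype ι] (p : ι → ℝ) (hp : ∀ i, 0 ≤ p i)
    (hs : ∑ i, p i = 1) (t : ι) : (pim ι).real (win p t) = p t := by
  classical
  rcases (hp t).eq_or_lt with h | h
  · have := win_null p hs t h.symm
    rw [← h, measureReal_def]
    have h0 : pim ι (win p t) = 0 := by
      rw [measure_eq_zero_iff_ae_notMem]; exact this
    simp [h0]
  · have := race p hp hs t h (fun _ => 1) measurable_const
    simp only [mul_one] at this
    rw [int_one h, lintegral_indicator (measurableSet_win p t)] at this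
    simp only [lintegral_const, one_mul, Measure.restrict_apply_univ] at this
    rw [measureReal_def, this, ENNReal.toReal_ofReal h.le]

lemma win_mean {ι : Type*} [Fintype ι] (p : ι → ℝ) (hp : ∀ i, 0 ≤ p i)
    (hs : ∑ i, p i = 1) (t : ι) :
    Integrable ((win p t).indicator (fun e : ι → ℝ => e t)) (pim ι) ∧
    ∫ e, (win p t).indicator (fun e : ι → ℝ => e t) e ∂(pim ι) = p t ^ 2 := by
  classical
  have hmeas : Measurable ((win p t).indicator (fun e : ι → ℝ => e t)) :=
    Measurable.indicator (measurable_pi_apply t) (measurableSet_win p t)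
  have hnn : 0 ≤ᵐ[pim ι] (win p t).indicator (fun e : ι → ℝ => e t) := by
    filter_upwards [pim_ae_pos ι] with e he
    by_cases hw : e ∈ win p t
    · simp [hw, (he t).le]
    · simp [hw]
  have hl : ∫⁻ e, ENNReal.ofReal ((win p t).indicator (fun e : ι → ℝ => e t) e) ∂(pim ι)
      = ENNReal.ofReal (p t ^ 2) := by
    rcases (hp t).eq_or_lt with h | h
    · rw [← h]
      simp only [ne_eq, OfNat.ofNat_ne_zero, not_false_eq_true, zero_pow, ENNReal.ofReal_zero]
      rw [← lintegral_zero (μ := pim ι)]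
      apply lintegral_congr_ae
      filter_upwards [win_null p hs t h.symm] with e he
      simp [he]
    · have := race p hp hs t h (fun x => ENNReal.ofReal x) ENNReal.measurable_ofReal
      rw [int_x h] at this
      rw [← this]
      apply lintegral_congr
      intro e
      by_cases he : e ∈ win p t <;> simp [he]
  constructor
  · refine ⟨hmeas.aestronglyMeasurable, ?_⟩
    rw [hasFiniteIntegral_iff_ofReal hnn, hl]
    exact ENNReal.ofReal_lt_top
  · rw [integral_eq_lintegral_of_nonneg_ae hnn hmeas.aestronglyMeasurable, hl,
      ENNReal.toReal_ofReal (by positivity)]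

lemma weight_int {ι : Type*} [Fintype ι] (t : ι) {P s ε : ℝ} (hP : 0 < P) (hs : 0 < s)
    (hε : 0 < ε) :
    Integrable (fun e : ι → ℝ => (e t / P + s) ^ (-(1 + ε))) (pim ι) ∧
    ∫ e, (e t / P + s) ^ (-(1 + ε)) ∂(pim ι) ≤ P * (s ^ (-ε) / ε) := by
  have hd : ∀ x ∈ Ici (0:ℝ), HasDerivAt (fun x : ℝ => -(P / ε) * (x / P + s) ^ (-ε))
      ((x / P + s) ^ (-(1 + ε))) x := by
    intro x hx
    have hx0 : (0:ℝ) ≤ x := hx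
    have hpos : 0 < x / P + s := by positivity
    have h1 : HasDerivAt (fun x : ℝ => x / P + s) (1 / P) x :=
      ((hasDerivAt_id x).div_const P).add_const s
    have h2 := (h1.rpow_const (p := -ε) (Or.inl hpos.ne')).const_mul (-(P / ε))
    have h3 : -ε - 1 = -(1 + ε) := by ring
    rw [h3] at h2
    refine h2.congr_deriv ?_
    field_simp
  have hnn : ∀ x ∈ Ioi (0:ℝ), 0 ≤ (x / P + s) ^ (-(1 + ε)) := by
    intro x hx
    have hx0 : (0:ℝ) < x := hx
    positivity
  have hlim : Filter.Tendsto (fun x : ℝ => -(P / ε) * (x / P + s) ^ (-ε)) Filter.atTop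
      (nhds (-(P / ε) * 0)) := by
    apply Filter.Tendsto.const_mul
    apply (tendsto_rpow_neg_atTop hε).comp
    apply Filter.tendsto_atTop_add_const_right
    exact Filter.tendsto_id.atTop_div_const hP
  have hI := integral_Ioi_of_hasDerivAt_of_nonneg' hd hnn hlim
  have hint := integrableOn_Ioi_deriv_of_nonneg' hd hnn hlim
  have hI' : ∫ x in Ioi (0:ℝ), (x / P + s) ^ (-(1 + ε)) = P * (s ^ (-ε) / ε) := by
    rw [hI]; simp; ring
  have hmeas1 : Measurable (fun x : ℝ => (x / P + s) ^ (-(1 + ε))) := by fun_prop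
  have hmeas : Measurable (fun e : ι → ℝ => (e t / P + s) ^ (-(1 + ε))) :=
    hmeas1.comp (measurable_pi_apply t)
  have hnn' : 0 ≤ᵐ[pim ι] (fun e : ι → ℝ => (e t / P + s) ^ (-(1 + ε))) := by
    filter_upwards [pim_ae_pos ι] with e he
    exact hnn _ (he t)
  have hl : ∫⁻ e, ENNReal.ofReal ((e t / P + s) ^ (-(1 + ε))) ∂(pim ι)
      ≤ ENNReal.ofReal (P * (s ^ (-ε) / ε)) := by
    have h1 := (measurePreserving_eval (fun _ : ι => expm) t).lintegral_comp
      (f := fun x : ℝ => ENNReal.ofReal ((x / P + s) ^ (-(1 + ε)))) (by fun_prop)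
    have h2 : ∫⁻ e, ENNReal.ofReal ((e t / P + s) ^ (-(1 + ε))) ∂(pim ι)
      = ∫⁻ x, ENNReal.ofReal ((x / P + s) ^ (-(1 + ε))) ∂expm := h1
    rw [h2, lintegral_expm _ (by fun_prop), ← hI', ofReal_integral_eq_lintegral_ofReal hint
      ((ae_restrict_iff' measurableSet_Ioi).2 (Filter.Eventually.of_forall hnn))]
    apply lintegral_mono_ae
    filter_upwards [ae_restrict_mem measurableSet_Ioi] with x hx
    have hx0 : (0:ℝ) < x := hx
    calc _ ≤ 1 * ENNReal.ofReal ((x / P + s) ^ (-(1 + ε))) := by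
          gcongr
          rw [ENNReal.ofReal_le_one, exp_le_one_iff]
          linarith
      _ = _ := one_mul _
  constructor
  · refine ⟨hmeas.aestronglyMeasurable, ?_⟩
    rw [hasFiniteIntegral_iff_ofReal hnn']
    exact hl.trans_lt ENNReal.ofReal_lt_top
  · rw [integral_eq_lintegral_of_nonneg_ae hnn' hmeas.aestronglyMeasurable]
    exact ENNReal.toReal_le_of_le_ofReal (by positivity) hl

end Race

namespace Race
open Real Set

lemma win_pos {ι : Type*} [Fintype ι] (p : ι → ℝ)
    (hs : ∑ i, p i = 1) (t : ι) (e : ι → ℝ) (he : ∀ i, 0 < e i) (hw : e ∈ win p t) :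
    p t ≠ 0 := by
  intro ht
  have : ∃ u, 0 < p u := by
    by_contra h
    push Not at h
    have : ∑ i, p i ≤ 0 := Finset.sum_nonpos fun i _ => h i
    linarith
  obtain ⟨u, hu⟩ := this
  have hut : u ≠ t := by rintro rfl; linarith
  have := hw u hut
  rw [ht, mul_zero] at this
  have := mul_pos (he t) hu
  linarith

lemma win_unique {ι : Type*} (p : ι → ℝ) (t u : ι) (e : ι → ℝ)
    (h1 : e ∈ win p t) (h2 : e ∈ win p u) : t = u := by
  by_contra h
  have a := h1 u (Ne.symm h)
  have b := h2 t h
  linarith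

lemma win_ae {ι : Type*} [Fintype ι] (p : ι → ℝ) (hp : ∀ i, 0 ≤ p i)
    (hs : ∑ i, p i = 1) : ∀ᵐ e ∂(pim ι), ∃ t, e ∈ win p t := by
  have h1 : (pim ι).real (⋃ t, win p t) = 1 := by
    rw [measureReal_iUnion_fintype]
    · simp_rw [win_prob p hp hs, hs]
    · intro t u htu
      rw [Function.onFun, Set.disjoint_left]
      intro e h1 h2
      exact htu (win_unique p t u e h1 h2)
    · exact fun t => measurableSet_win p t
  have h2 : pim ι (⋃ t, win p t)ᶜ = 0 := by
    rw [prob_compl_eq_zero_iff (MeasurableSet.iUnion fun t => measurableSet_win p t)]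
    rw [measureReal_def] at h1
    rw [← ENNReal.toReal_eq_one_iff]; exact h1
  rw [measure_eq_zero_iff_ae_notMem] at h2
  filter_upwards [h2] with e he
  simpa using he

lemma gibbs_term {q v a : ℝ} (hq : 0 ≤ q) (hv : 0 < v) (ha : 0 < a) :
    negMulLog q ≤ q * (-log v) + v / a - q + q * log a := by
  rcases hq.eq_or_lt with rfl | hq
  · simp; positivity
  · have h : log (v / (a * q)) ≤ v / (a * q) - 1 := log_le_sub_one_of_pos (by positivity)
    rw [log_div hv.ne' (by positivity), log_mul ha.ne' hq.ne'] at h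
    have h2 := mul_le_mul_of_nonneg_left h hq.le
    have h3 : q * (v / (a * q) - 1) = v / a - q := by field_simp
    rw [h3] at h2
    unfold negMulLog
    linarith

lemma pointwise {𝒲 𝒯 : Type*} [Fintype 𝒲] [Fintype 𝒯] [DecidableEq 𝒯]
    (jW : 𝒲 → ℝ) (hj : ∀ w, 0 ≤ jW w) (hj1 : ∑ w, jW w = 1)
    (p : 𝒲 → 𝒯 → ℝ) (hp : ∀ w t, 0 ≤ p w t) (hp1 : ∀ w, ∑ t, p w t = 1)
    (P : 𝒯 → ℝ) (hP0 : ∀ t, 0 ≤ P t) (hsupp : ∀ w t, P t = 0 → p w t = 0)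
    {s ε a : ℝ} (hs : 0 < s) (hε : 0 < ε) (ha : 0 < a)
    (e : 𝒯 → ℝ) (he : ∀ t, 0 < e t) (f : 𝒲 → 𝒯) (hf : ∀ w, e ∈ win (p w) (f w)) :
    ∑ t, negMulLog (∑ w, if f w = t then jW w else 0) ≤
      ∑ w, ∑ t, jW w * (1 + ε) *
        ((win (p w) t).indicator (fun _ => (1:ℝ)) e
            * (log (p w t / P t + s) - (p w t / P t) / (p w t / P t + s))
          + (win (p w) t).indicator (fun e => e t) e * (1 / (P t * (p w t / P t + s))))
      + ((∑ t, if P t = 0 then 0 else (e t / P t + s) ^ (-(1 + ε))) / a - 1 + log a) := by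
  have hPf : ∀ w, P (f w) ≠ 0 := fun w h =>
    win_pos (p w) (hp1 w) (f w) e he (hf w) (hsupp w _ h)
  set q : 𝒯 → ℝ := fun t => ∑ w, if f w = t then jW w else 0 with hq
  have hq0 : ∀ t, 0 ≤ q t := fun t =>
    Finset.sum_nonneg fun w _ => by split_ifs; exacts [hj w, le_rfl]
  have hq1 : ∑ t, q t = 1 := by
    rw [hq]; simp only
    rw [Finset.sum_comm, ← hj1]
    exact Finset.sum_congr rfl fun w _ => by simp
  have hqP : ∀ t, P t = 0 → q t = 0 := by
    intro t ht
    refine Finset.sum_eq_zero fun w _ => ?_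
    rw [if_neg]
    rintro rfl
    exact hPf w ht
  have hX : ∀ t, 0 ≤ e t / P t := fun t => div_nonneg (he t).le (hP0 t)
  have step1 : ∀ t, negMulLog (q t) ≤ q t * ((1 + ε) * log (e t / P t + s))
      + (if P t = 0 then 0 else (e t / P t + s) ^ (-(1 + ε))) / a - q t + q t * log a := by
    intro t
    by_cases ht : P t = 0
    · simp [hqP t ht, ht]
    · rw [if_neg ht]
      have hpos : 0 < e t / P t + s := by have := hX t; linarith
      have := gibbs_term (hq0 t) (rpow_pos_of_pos hpos (-(1 + ε))) ha
      rw [log_rpow hpos] at this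
      linarith
  have step2 : ∑ t, negMulLog (q t) ≤ ∑ t, q t * ((1 + ε) * log (e t / P t + s))
      + ((∑ t, if P t = 0 then 0 else (e t / P t + s) ^ (-(1 + ε))) / a - 1 + log a) := by
    refine (Finset.sum_le_sum fun t _ => step1 t).trans (le_of_eq ?_)
    rw [Finset.sum_add_distrib, Finset.sum_sub_distrib, Finset.sum_add_distrib, ← Finset.sum_div,
      ← Finset.sum_mul, hq1]
    ring
  refine step2.trans (add_le_add_left ?_ _)
  have step3 : ∑ t, q t * ((1 + ε) * log (e t / P t + s))
      = ∑ w, jW w * ((1 + ε) * log (e (f w) / P (f w) + s)) := by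
    rw [hq]; simp only
    simp_rw [Finset.sum_mul]
    rw [Finset.sum_comm]
    refine Finset.sum_congr rfl fun w _ => ?_
    simp [ite_mul]
  rw [step3]
  refine Finset.sum_le_sum fun w _ => ?_
  rw [Finset.sum_eq_single (f w)]
  · rw [indicator_of_mem (hf w), indicator_of_mem (hf w), mul_assoc]
    refine mul_le_mul_of_nonneg_left ?_ (hj w)
    refine mul_le_mul_of_nonneg_left ?_ (by linarith)
    set X := e (f w) / P (f w) with hXd
    set ρ := p w (f w) / P (f w)
    have hρ : 0 ≤ ρ := div_nonneg (hp _ _) (hP0 _)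
    have hX0 : 0 ≤ X := hX _
    have h1 : log ((X + s) / (ρ + s)) ≤ (X + s) / (ρ + s) - 1 :=
      log_le_sub_one_of_pos (by positivity)
    rw [log_div (by positivity) (by positivity)] at h1
    have h2 : e (f w) * (1 / (P (f w) * (ρ + s))) = X / (ρ + s) := by
      rw [hXd, div_div]; ring
    rw [h2, one_mul]
    have h3 : (X + s) / (ρ + s) - 1 = X / (ρ + s) - ρ / (ρ + s) := by
      field_simp; ring
    linarith
  · intro t _ ht
    have : e ∉ win (p w) t := fun h => ht (win_unique _ _ _ e h (hf w))
    simp [this]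
  · simp

theorem sfrl_core {𝒲 𝒯 : Type*} [Fintype 𝒲] [Fintype 𝒯] [DecidableEq 𝒲] [DecidableEq 𝒯]
    (jW : 𝒲 → ℝ) (hj : ∀ w, 0 ≤ jW w) (hj1 : ∑ w, jW w = 1)
    (p : 𝒲 → 𝒯 → ℝ) (hp : ∀ w t, 0 ≤ p w t) (hp1 : ∀ w, ∑ t, p w t = 1)
    (P : 𝒯 → ℝ) (hP0 : ∀ t, 0 ≤ P t) (hPs : ∑ t, P t = 1) (hsupp : ∀ w t, P t = 0 → p w t = 0)
    {s ε : ℝ} (hs : 0 < s) (hε : 0 < ε) :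
    ∃ ν : (𝒲 → 𝒯) → ℝ, (∀ f, 0 ≤ ν f) ∧ (∑ f, ν f = 1) ∧
      (∀ w t, (∑ f, if f w = t then ν f else 0) = p w t) ∧
      ∑ f, ν f * ∑ t, negMulLog (∑ w, if f w = t then jW w else 0) ≤
        (1 + ε) * (∑ w, ∑ t, jW w * p w t * log (p w t / P t + s)) + log (s ^ (-ε) / ε) := by
  have hneW : Nonempty 𝒲 := by
    by_contra h
    rw [not_nonempty_iff] at h
    simp at hj1
  have hneT : Nonempty 𝒯 := by
    by_contra h
    rw [not_nonempty_iff] at h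
    simp at hPs
  obtain ⟨t0⟩ := hneT
  classical
  set a := s ^ (-ε) / ε with ha_def
  have ha : 0 < a := by positivity
  let F : (𝒯 → ℝ) → 𝒲 → 𝒯 := fun e w =>
    if h : ∃ t, e ∈ win (p w) t then h.choose else t0
  have hF : ∀ e w, (∃ t, e ∈ win (p w) t) → e ∈ win (p w) (F e w) := by
    intro e w h
    simp only [F, h, dif_pos]
    exact h.choose_spec
  have hF1 : ∀ w t, MeasurableSet {e | F e w = t} := by
    intro w t
    have : {e | F e w = t} = win (p w) t ∪ ((⋃ u, win (p w) u)ᶜ ∩ {_e | t0 = t}) := by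
      ext e
      simp only [mem_setOf_eq, mem_union, mem_inter_iff, mem_compl_iff, mem_iUnion]
      by_cases h : ∃ u, e ∈ win (p w) u
      · have h1 := hF e w h
        constructor
        · rintro rfl; exact Or.inl h1
        · rintro (h2 | h2)
          · exact win_unique _ _ _ e h1 h2
          · exact absurd h h2.1
      · have h1 : F e w = t0 := by simp only [F, h, dif_neg, not_false_eq_true]
        rw [h1]
        constructor
        · intro h2; exact Or.inr ⟨h, h2⟩
        · rintro (h2 | h2)
          · exact absurd ⟨_, h2⟩ h
          · exact h2.2
    rw [this]
    exact (measurableSet_win _ _).union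
      ((MeasurableSet.iUnion fun u => measurableSet_win _ _).compl.inter (MeasurableSet.const _))
  have hF2 : ∀ f, MeasurableSet (F ⁻¹' {f}) := by
    intro f
    have : F ⁻¹' {f} = ⋂ w, {e | F e w = f w} := by
      ext e; simp [funext_iff]
    rw [this]
    exact MeasurableSet.iInter fun w => hF1 w _
  have hG : ∀ G : (𝒲 → 𝒯) → ℝ, Integrable (fun e => G (F e)) (pim 𝒯) ∧
      ∫ e, G (F e) ∂(pim 𝒯) = ∑ f, (pim 𝒯).real (F ⁻¹' {f}) * G f := by
    intro G
    have h1 : (fun e => G (F e)) = fun e => ∑ f, (F ⁻¹' {f}).indicator (fun _ => G f) e := by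
      funext e
      rw [Finset.sum_eq_single (F e)]
      · simp
      · intro f _ hf
        rw [indicator_of_notMem]
        simpa using hf.symm
      · simp
    have h2 : ∀ f, Integrable ((F ⁻¹' {f}).indicator (fun _ => G f)) (pim 𝒯) := fun f =>
      (integrable_const _).indicator (hF2 f)
    rw [h1]
    constructor
    · exact integrable_finsetSum _ fun f _ => h2 f
    · rw [integral_finsetSum _ fun f _ => h2 f]
      refine Finset.sum_congr rfl fun f _ => ?_
      rw [integral_indicator_const _ (hF2 f), smul_eq_mul]
  have hae : ∀ᵐ e ∂(pim 𝒯), (∀ t, 0 < e t) ∧ ∀ w, e ∈ win (p w) (F e w) := by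
    have h1 : ∀ᵐ e ∂(pim 𝒯), ∀ w, ∃ t, e ∈ win (p w) t := by
      rw [ae_all_iff]
      exact fun w => win_ae (p w) (hp w) (hp1 w)
    filter_upwards [pim_ae_pos 𝒯, h1] with e h2 h3
    exact ⟨h2, fun w => hF e w (h3 w)⟩
  have hI1 : ∀ w t, Integrable ((win (p w) t).indicator (fun _ => (1:ℝ))) (pim 𝒯) := fun w t =>
    (integrable_const _).indicator (measurableSet_win _ _)
  have hI1' : ∀ w t, ∫ e, (win (p w) t).indicator (fun _ => (1:ℝ)) e ∂(pim 𝒯) = p w t := by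
    intro w t
    rw [integral_indicator_const _ (measurableSet_win _ _), win_prob _ (hp w) (hp1 w), smul_eq_mul,
      mul_one]
  refine ⟨fun f => (pim 𝒯).real (F ⁻¹' {f}), fun f => measureReal_nonneg, ?_, ?_, ?_⟩
  · have := (hG fun _ => 1).2
    simpa using this.symm
  · intro w t
    have := (hG fun f => if f w = t then 1 else 0).2
    rw [← hI1' w t]
    simp only [mul_ite, mul_one, mul_zero] at this
    rw [← this]
    apply integral_congr_ae
    filter_upwards [hae] with e he
    by_cases h : F e w = t
    · have := he.2 w
      rw [h] at this
      simp [h, this]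
    · have : e ∉ win (p w) t := fun h2 => h (win_unique _ _ _ e (he.2 w) h2)
      simp [h, this]
  · obtain ⟨hGi, hGe⟩ := hG fun f => ∑ t, negMulLog (∑ w, if f w = t then jW w else 0)
    rw [← hGe]
    have hA : ∀ w t, Integrable (fun e => jW w * (1 + ε) *
        ((win (p w) t).indicator (fun _ => (1:ℝ)) e
            * (log (p w t / P t + s) - (p w t / P t) / (p w t / P t + s))
          + (win (p w) t).indicator (fun e => e t) e * (1 / (P t * (p w t / P t + s)))))
          (pim 𝒯) := by
      intro w t
      apply Integrable.const_mul
      apply Integrable.add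
      · exact (hI1 w t).mul_const _
      · exact (win_mean _ (hp w) (hp1 w) t).1.mul_const _
    have hA' : ∀ w t, ∫ e, jW w * (1 + ε) *
        ((win (p w) t).indicator (fun _ => (1:ℝ)) e
            * (log (p w t / P t + s) - (p w t / P t) / (p w t / P t + s))
          + (win (p w) t).indicator (fun e => e t) e * (1 / (P t * (p w t / P t + s))))
          ∂(pim 𝒯) = (1 + ε) * (jW w * p w t * log (p w t / P t + s)) := by
      intro w t
      rw [integral_const_mul, integral_add ((hI1 w t).mul_const _)
        ((win_mean _ (hp w) (hp1 w) t).1.mul_const _), integral_mul_const, integral_mul_const,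
        hI1', (win_mean _ (hp w) (hp1 w) t).2]
      by_cases hPt : P t = 0
      · rw [hsupp w t hPt]; simp
      · have hρ : 0 ≤ p w t / P t := div_nonneg (hp _ _) (hP0 _)
        have : p w t ^ 2 * (1 / (P t * (p w t / P t + s)))
            = p w t * ((p w t / P t) / (p w t / P t + s)) := by
          rw [div_eq_mul_inv (p w t) (P t)]
          have h5 : p w t * (P t)⁻¹ + s ≠ 0 := by
            rw [← div_eq_mul_inv]; positivity
          field_simp
        rw [this]; ring
    have hB : ∀ t, Integrable (fun e : 𝒯 → ℝ =>
        if P t = 0 then 0 else (e t / P t + s) ^ (-(1 + ε))) (pim 𝒯) ∧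
        ∫ e : 𝒯 → ℝ, (if P t = 0 then 0 else (e t / P t + s) ^ (-(1 + ε))) ∂(pim 𝒯)
          ≤ P t * a := by
      intro t
      by_cases hPt : P t = 0
      · simp [hPt]
      · simp only [hPt, if_false]
        exact weight_int t (lt_of_le_of_ne (hP0 t) (Ne.symm hPt)) hs hε
    have hAI := integrable_finsetSum Finset.univ fun w _ =>
      integrable_finsetSum Finset.univ fun t _ => hA w t
    have hBI := integrable_finsetSum Finset.univ fun t _ => (hB t).1
    have hsub : Integrable (fun e : 𝒯 → ℝ =>
        (∑ t, if P t = 0 then 0 else (e t / P t + s) ^ (-(1 + ε))) / a - 1) (pim 𝒯) :=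
      (hBI.div_const a).sub (integrable_const (1:ℝ))
    have hBI2 : Integrable (fun e : 𝒯 → ℝ =>
        (∑ t, if P t = 0 then 0 else (e t / P t + s) ^ (-(1 + ε))) / a - 1 + log a) (pim 𝒯) :=
      hsub.add (integrable_const (log a))
    refine (integral_mono_ae hGi (hAI.add hBI2) ?_).trans ?_
    · filter_upwards [hae] with e he
      exact pointwise jW hj hj1 p hp hp1 P hP0 hsupp hs hε ha e he.1 (F e) he.2
    · have e1 : ∫ e, (∑ w, ∑ t, jW w * (1 + ε) *
        ((win (p w) t).indicator (fun _ => (1:ℝ)) e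
            * (log (p w t / P t + s) - (p w t / P t) / (p w t / P t + s))
          + (win (p w) t).indicator (fun e => e t) e * (1 / (P t * (p w t / P t + s)))))
          ∂(pim 𝒯) = (1 + ε) * (∑ w, ∑ t, jW w * p w t * log (p w t / P t + s)) := by
        rw [integral_finsetSum _ fun w _ => integrable_finsetSum Finset.univ fun t _ => hA w t]
        rw [Finset.mul_sum]
        refine Finset.sum_congr rfl fun w _ => ?_
        rw [integral_finsetSum _ fun t _ => hA w t, Finset.mul_sum]
        exact Finset.sum_congr rfl fun t _ => hA' w t
      have e2 : ∫ e : 𝒯 → ℝ, ((∑ t, if P t = 0 then 0 else (e t / P t + s) ^ (-(1 + ε))) / a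
          - 1 + log a) ∂(pim 𝒯) ≤ log a := by
        rw [integral_add hsub (integrable_const _),
          integral_sub (hBI.div_const a) (integrable_const _), integral_div,
          integral_finsetSum _ fun t _ => (hB t).1]
        simp only [integral_const, probReal_univ, smul_eq_mul, one_mul]
        have : ∑ t, ∫ e : 𝒯 → ℝ, (if P t = 0 then 0 else (e t / P t + s) ^ (-(1 + ε))) ∂(pim 𝒯)
            ≤ a := by
          refine (Finset.sum_le_sum fun t _ => (hB t).2).trans (le_of_eq ?_)
          rw [← Finset.sum_mul, hPs, one_mul]
        have h6 := (div_le_one ha).2 this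
        linarith
      have e3 := integral_add hAI hBI2
      refine (le_of_eq e3).trans ?_
      exact add_le_add (le_of_eq e1) e2

end Race

namespace Race
open Real Set

open Classical in
/-- Push-forward of a mass function. -/
noncomputable def push {A B : Type*} [Fintype A] (M : A → ℝ) (X : A → B) (b : B) : ℝ :=
  ∑ a, if X a = b then M a else 0

/-- Entropy (nats) of a function on a finite space with a mass function. -/
noncomputable def HH {A B : Type*} [Fintype A] [Fintype B] (M : A → ℝ) (X : A → B) : ℝ :=
  ∑ b, negMulLog (push M X b)

set_option linter.unusedSectionVars false
section toolkit
variable {A B C D : Type*} [Fintype A] [Fintype B] [Fintype C] [Fintype D]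

lemma push_nonneg {M : A → ℝ} (hM : ∀ a, 0 ≤ M a) (X : A → B) (b : B) : 0 ≤ push M X b :=
  Finset.sum_nonneg fun a _ => by split_ifs <;> simp [hM]

lemma push_mul_sum (M : A → ℝ) (X : A → B) (g : B → ℝ) :
    ∑ b, push M X b * g b = ∑ a, M a * g (X a) := by
  classical
  unfold push
  simp_rw [Finset.sum_mul]
  rw [Finset.sum_comm]
  refine Finset.sum_congr rfl fun a _ => ?_
  simp [ite_mul]

lemma push_sum (M : A → ℝ) (X : A → B) : ∑ b, push M X b = ∑ a, M a := by
  simpa using push_mul_sum M X (fun _ => 1)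

lemma push_push (M : A → ℝ) (X : A → B) (g : B → C) (c : C) :
    push (push M X) g c = push M (fun a => g (X a)) c := by
  classical
  have := push_mul_sum M X (fun b => if g b = c then 1 else 0)
  simp only [mul_ite, mul_one, mul_zero] at this
  unfold push at this ⊢
  convert this

lemma push_id (M : A → ℝ) (a : A) : push M (fun a => a) a = M a := by
  classical
  unfold push; simp

lemma push_inj (M : A → ℝ) (X : A → B) (g : B → C) (hg : Function.Injective g) (b : B) :
    push M (fun a => g (X a)) (g b) = push M X b := by
  unfold push
  refine Finset.sum_congr rfl fun a _ => ?_
  by_cases h : X a = b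
  · simp [h]
  · simp [h, hg.ne h]

lemma HH_eq (M : A → ℝ) (X : A → B) : HH M X = ∑ a, M a * (-log (push M X (X a))) := by
  rw [← push_mul_sum M X (fun b => -log (push M X b))]
  unfold HH negMulLog
  exact Finset.sum_congr rfl fun b _ => by ring

lemma HH_inj (M : A → ℝ) (X : A → B) (g : B → C) (hg : Function.Injective g) :
    HH M (fun a => g (X a)) = HH M X := by
  simp only [HH_eq, push_inj M X g hg]

lemma HH_push (M : A → ℝ) (X : A → B) (g : B → C) :
    HH (push M X) g = HH M (fun a => g (X a)) := by
  unfold HH; simp only [push_push]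

lemma le_push {M : A → ℝ} (hM : ∀ a, 0 ≤ M a) (X : A → B) (a : A) : M a ≤ push M X (X a) := by
  classical
  unfold push
  have := Finset.single_le_sum (f := fun a' => if X a' = X a then M a' else 0) (s := Finset.univ)
    (fun a' _ => by split_ifs <;> simp [hM]) (Finset.mem_univ a)
  simpa using this

lemma push_le_comp {M : A → ℝ} (hM : ∀ a, 0 ≤ M a) (X : A → B) (g : B → C) (b : B) :
    push M X b ≤ push M (fun a => g (X a)) (g b) := by
  rw [← push_push M X g]
  exact le_push (push_nonneg hM X) g b

lemma HH_mono {M : A → ℝ} (hM : ∀ a, 0 ≤ M a) (X : A → B) (g : B → C) :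
    HH M (fun a => g (X a)) ≤ HH M X := by
  rw [HH_eq, HH_eq]
  refine Finset.sum_le_sum fun a _ => ?_
  rcases (hM a).eq_or_lt with h | h
  · rw [← h]; simp
  · refine mul_le_mul_of_nonneg_left (neg_le_neg ?_) (hM a)
    exact log_le_log (h.trans_le (le_push hM X a)) (push_le_comp hM X g (X a))

lemma HH_nonneg {M : A → ℝ} (hM : ∀ a, 0 ≤ M a) (h1 : ∑ a, M a = 1) (X : A → B) :
    0 ≤ HH M X := by
  have := HH_mono hM X (fun _ => ())
  refine le_trans (le_of_eq ?_) this
  rw [HH_eq]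
  simp [push, h1]

lemma push_fst (M : A → ℝ) (X : A → B) (Y : A → C) (b : B) :
    ∑ c, push M (fun a => (X a, Y a)) (b, c) = push M X b := by
  classical
  unfold push
  rw [Finset.sum_comm]
  refine Finset.sum_congr rfl fun a _ => ?_
  by_cases h : X a = b <;> simp [h]

lemma push_snd (M : A → ℝ) (X : A → B) (Y : A → C) (c : C) :
    ∑ b, push M (fun a => (X a, Y a)) (b, c) = push M Y c := by
  classical
  unfold push
  rw [Finset.sum_comm]
  refine Finset.sum_congr rfl fun a _ => ?_
  by_cases h : Y a = c <;> simp [h]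

/-- Submodularity of entropy. -/
lemma HH_submod {M : A → ℝ} (hM : ∀ a, 0 ≤ M a) (X : A → B) (Y : A → C) (Z : A → D) :
    HH M (fun a => (X a, Y a, Z a)) + HH M Z
      ≤ HH M (fun a => (X a, Z a)) + HH M (fun a => (Y a, Z a)) := by
  rw [← sub_nonneg]
  simp only [HH_eq]
  rw [← Finset.sum_add_distrib, ← Finset.sum_add_distrib, ← Finset.sum_sub_distrib]
  set J := push M (fun a => (X a, Y a, Z a)) with hJ
  set JX := push M (fun a => (X a, Z a)) with hJX
  set JY := push M (fun a => (Y a, Z a)) with hJY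
  set JZ := push M Z with hJZ
  have hJ0 : ∀ b, 0 ≤ J b := push_nonneg hM _
  have hX0 : ∀ b, 0 ≤ JX b := push_nonneg hM _
  have hY0 : ∀ b, 0 ≤ JY b := push_nonneg hM _
  have hZ0 : ∀ b, 0 ≤ JZ b := push_nonneg hM _
  have key : ∀ a, M a - M a * (JX (X a, Z a) * JY (Y a, Z a) / (J (X a, Y a, Z a) * JZ (Z a)))
      ≤ M a * -log (JX (X a, Z a)) + M a * -log (JY (Y a, Z a))
        - (M a * -log (J (X a, Y a, Z a)) + M a * -log (JZ (Z a))) := by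
    intro a
    rcases (hM a).eq_or_lt with h | h
    · rw [← h]; simp
    · have h1 : 0 < J (X a, Y a, Z a) := h.trans_le (le_push hM (fun a => (X a, Y a, Z a)) a)
      have h2 : 0 < JX (X a, Z a) := h.trans_le (le_push hM (fun a => (X a, Z a)) a)
      have h3 : 0 < JY (Y a, Z a) := h.trans_le (le_push hM (fun a => (Y a, Z a)) a)
      have h4 : 0 < JZ (Z a) := h.trans_le (le_push hM Z a)
      have h5 := log_le_sub_one_of_pos (show 0 < JX (X a, Z a) * JY (Y a, Z a) /
        (J (X a, Y a, Z a) * JZ (Z a)) by positivity)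
      rw [log_div (by positivity) (by positivity), log_mul h2.ne' h3.ne',
        log_mul h1.ne' h4.ne'] at h5
      have := mul_le_mul_of_nonneg_left h5 h.le
      linarith
  refine le_trans ?_ (Finset.sum_le_sum fun a _ => key a)
  rw [Finset.sum_sub_distrib, sub_nonneg,
    ← push_mul_sum M (fun a => (X a, Y a, Z a))
      (fun b => JX (b.1, b.2.2) * JY (b.2.1, b.2.2) / (J b * JZ b.2.2))]
  calc ∑ b, J b * (JX (b.1, b.2.2) * JY (b.2.1, b.2.2) / (J b * JZ b.2.2))
      ≤ ∑ b : B × C × D, JX (b.1, b.2.2) * JY (b.2.1, b.2.2) / JZ b.2.2 := by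
        refine Finset.sum_le_sum fun b _ => ?_
        rcases (hJ0 b).eq_or_lt with h | h
        · rw [← h, zero_mul]
          have := hX0 (b.1, b.2.2); have := hY0 (b.2.1, b.2.2); have := hZ0 b.2.2
          positivity
        · apply le_of_eq
          rw [mul_div_assoc', mul_div_mul_left _ _ h.ne']
    _ = ∑ d, (∑ b, JX (b, d)) * (∑ c, JY (c, d)) / JZ d := by
        rw [Fintype.sum_prod_type]
        simp_rw [Fintype.sum_prod_type, Finset.sum_mul_sum, Finset.sum_div]
        rw [Finset.sum_congr rfl fun b _ => Finset.sum_comm, Finset.sum_comm]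
    _ = ∑ d, JZ d := by
        refine Finset.sum_congr rfl fun d _ => ?_
        rw [hJX, hJY, push_snd, push_snd]
        change JZ d * JZ d / JZ d = JZ d
        by_cases h : JZ d = 0
        · rw [h]; simp
        · field_simp
    _ ≤ ∑ a, M a := by rw [hJZ, push_sum]

lemma HH_subadd {M : A → ℝ} (hM : ∀ a, 0 ≤ M a) (h1 : ∑ a, M a = 1) (X : A → B) (Y : A → C) :
    HH M (fun a => (X a, Y a)) ≤ HH M X + HH M Y := by
  have h := HH_submod hM X Y (fun _ => ())
  have e1 : HH M (fun a => (X a, Y a, ())) = HH M (fun a => (X a, Y a)) :=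
    HH_inj M (fun a => (X a, Y a)) (fun b => (b.1, b.2, ())) (fun a b h => by
      simpa [Prod.ext_iff] using h)
  have e2 : HH M (fun a => (X a, ())) = HH M X :=
    HH_inj M X (fun b => (b, ())) (fun a b h => by simpa using h)
  have e3 : HH M (fun a => (Y a, ())) = HH M Y :=
    HH_inj M Y (fun b => (b, ())) (fun a b h => by simpa using h)
  have e4 := HH_nonneg hM h1 (fun _ => ())
  linarith

lemma HH_indep {M : A → ℝ} (hM : ∀ a, 0 ≤ M a) (X : A → B) (Y : A → C)
    (h : ∀ b c, push M (fun a => (X a, Y a)) (b, c) = push M X b * push M Y c) :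
    HH M (fun a => (X a, Y a)) = HH M X + HH M Y := by
  simp only [HH_eq]
  rw [← Finset.sum_add_distrib]
  refine Finset.sum_congr rfl fun a _ => ?_
  rw [h]
  rcases (hM a).eq_or_lt with h | h
  · rw [← h]; simp
  · rw [log_mul (h.trans_le (le_push hM X a)).ne' (h.trans_le (le_push hM Y a)).ne']
    ring

end toolkit

end Race

namespace Race
open Real Set

lemma num_c : (1:ℝ) + 1 / 32 ≤ 1.06 * log 2 - log (log 2) := by
  have h1 := log_two_gt_d9
  have h2 := log_le_sub_one_of_pos (show (0:ℝ) < log 2 by linarith)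
  norm_num at h1 h2 ⊢
  linarith

lemma num_bound {I : ℝ} (hI : 0 ≤ I) :
    (1 + 1 / (I + 5.51 * log 2)) * (I + 1 / 32)
      + log ((1 / 32 : ℝ) ^ (-(1 / (I + 5.51 * log 2))) / (1 / (I + 5.51 * log 2)))
      ≤ I + log (I + 5.51 * log 2) + (1.06 * log 2 - log (log 2)) := by
  have hl := log_two_gt_d9
  have hc := num_c
  have hk : 0 < I + 5.51 * log 2 := by norm_num at hl ⊢; linarith
  set u := I + 5.51 * log 2 with hu
  have h32 : log (1 / 32 : ℝ) = - (5 * log 2) := by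
    rw [one_div, log_inv, show (32:ℝ) = 2 ^ 5 by norm_num, log_pow]; norm_num
  rw [log_div (by positivity) (by positivity), log_rpow (by norm_num), h32, one_div, log_inv]
  have h1 : (1 + u⁻¹) * (I + 1 / 32) + (-u⁻¹ * -(5 * log 2) - -log u)
      = I + 1 / 32 + u⁻¹ * (I + 1 / 32 + 5 * log 2) + log u := by ring
  rw [h1]
  have h2 : u⁻¹ * (I + 1 / 32 + 5 * log 2) ≤ 1 := by
    rw [inv_mul_le_one₀ hk, hu]; norm_num at hl ⊢; linarith
  linarith

/-- The functional representation with an entropy bound, lifted to the ambient space. -/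
lemma branch {A 𝒲 𝒯 : Type*} [Fintype A] [Fintype 𝒲] [Fintype 𝒯] [DecidableEq 𝒲] [DecidableEq 𝒯]
    (j : A → ℝ) (hj : ∀ a, 0 ≤ j a) (hj1 : ∑ a, j a = 1) (pr : A → 𝒲) (τ : A → 𝒯)
    (I : ℝ) (hI : I = HH j pr + HH j τ - HH j (fun a => (pr a, τ a))) :
    ∃ M : A × (𝒲 → 𝒯) → ℝ, (∀ x, 0 ≤ M x) ∧ (∀ a, ∑ f, M (a, f) = j a) ∧
      (∀ w f, push M (fun x => (pr x.1, x.2)) (w, f) = push j pr w * push M (fun x => x.2) f) ∧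
      HH M (fun x => (τ x.1, x.2)) - HH M (fun x => x.2)
        ≤ I + log (I + 5.51 * log 2) + (1.06 * log 2 - log (log 2)) := by
  have hI0 : 0 ≤ I := by
    have := HH_subadd hj hj1 pr τ
    linarith
  set jW := push j pr with hjW
  set P := push j τ with hP
  set J := push j (fun a => (pr a, τ a)) with hJ
  have hjW0 : ∀ w, 0 ≤ jW w := push_nonneg hj _
  have hP0 : ∀ t, 0 ≤ P t := push_nonneg hj _
  have hJ0 : ∀ x, 0 ≤ J x := push_nonneg hj _
  have hJ1 : ∀ w, ∑ t, J (w, t) = jW w := push_fst j pr τ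
  have hJ2 : ∀ t, ∑ w, J (w, t) = P t := push_snd j pr τ
  have hJW : ∀ w t, jW w = 0 → J (w, t) = 0 := by
    intro w t h
    rw [← hJ1 w, Finset.sum_eq_zero_iff_of_nonneg fun t _ => hJ0 _] at h
    exact h t (Finset.mem_univ _)
  have hJP : ∀ w t, P t = 0 → J (w, t) = 0 := by
    intro w t h
    rw [← hJ2 t, Finset.sum_eq_zero_iff_of_nonneg fun w _ => hJ0 _] at h
    exact h w (Finset.mem_univ _)
  have hP1 : ∑ t, P t = 1 := by rw [hP, push_sum, hj1]
  have hW1 : ∑ w, jW w = 1 := by rw [hjW, push_sum, hj1]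
  let p : 𝒲 → 𝒯 → ℝ := fun w t => if jW w = 0 then P t else J (w, t) / jW w
  have hp0 : ∀ w t, 0 ≤ p w t := by
    intro w t
    simp only [p]; split_ifs
    · exact hP0 t
    · exact div_nonneg (hJ0 _) (hjW0 _)
  have hp1 : ∀ w, ∑ t, p w t = 1 := by
    intro w
    by_cases h : jW w = 0
    · simp only [p, h, if_true, hP1]
    · simp only [p, h, if_false]
      rw [← Finset.sum_div, hJ1, div_self h]
  have hpJ : ∀ w t, jW w * p w t = J (w, t) := by
    intro w t
    by_cases h : jW w = 0
    · rw [h, hJW w t h, zero_mul]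
    · simp only [p, h, if_false]; field_simp
  have hsupp : ∀ w t, P t = 0 → p w t = 0 := by
    intro w t h
    simp only [p]; split_ifs
    · exact h
    · rw [hJP w t h, zero_div]
  have hl : 0 < log 2 := log_pos (by norm_num)
  obtain ⟨ν, hν0, hν1, hνp, hνH⟩ := sfrl_core jW hjW0 hW1 p hp0 hp1 P hP0 hP1 hsupp
    (s := 1 / 32) (ε := 1 / (I + 5.51 * log 2)) (by norm_num) (by positivity)
  have hmain : ∑ w, ∑ t, jW w * p w t * log (p w t / P t + 1 / 32) ≤ I + 1 / 32 := by
    have e1 : ∑ w, ∑ t, jW w * p w t * log (p w t / P t + 1 / 32)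
        = ∑ a, j a * log (p (pr a) (τ a) / P (τ a) + 1 / 32) := by
      rw [← push_mul_sum j (fun a => (pr a, τ a)) (fun x => log (p x.1 x.2 / P x.2 + 1 / 32)),
        Fintype.sum_prod_type]
      simp_rw [hpJ, ← hJ]
    have e2 : I = ∑ a, j a * (log (J (pr a, τ a)) - log (jW (pr a)) - log (P (τ a))) := by
      rw [hI, HH_eq, HH_eq, HH_eq, ← Finset.sum_add_distrib, ← Finset.sum_sub_distrib]
      exact Finset.sum_congr rfl fun a _ => by ring
    have e3 : ∑ a, j a * (1 / 32 * (jW (pr a) * P (τ a) / J (pr a, τ a))) ≤ 1 / 32 := by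
      rw [← push_mul_sum j (fun a => (pr a, τ a))
        (fun x => 1 / 32 * (jW x.1 * P x.2 / J x))]
      calc ∑ x, J x * (1 / 32 * (jW x.1 * P x.2 / J x))
          ≤ ∑ x : 𝒲 × 𝒯, 1 / 32 * (jW x.1 * P x.2) := by
            refine Finset.sum_le_sum fun x _ => ?_
            have h1 := hjW0 x.1
            have h2 := hP0 x.2
            rcases (hJ0 x).eq_or_lt with h | h
            · rw [← h, zero_mul]; positivity
            · apply le_of_eq; field_simp
        _ = 1 / 32 := by
            rw [← Finset.mul_sum, Fintype.sum_prod_type]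
            simp_rw [← Finset.mul_sum, hP1, mul_one, hW1, mul_one]
    rw [e1, e2]
    refine le_trans ?_ (add_le_add le_rfl e3)
    rw [← Finset.sum_add_distrib]
    refine Finset.sum_le_sum fun a _ => ?_
    rcases (hj a).eq_or_lt with h | h
    · rw [← h]; simp
    · have h1 : 0 < J (pr a, τ a) := h.trans_le (le_push hj (fun a => (pr a, τ a)) a)
      have h2 : 0 < jW (pr a) := h.trans_le (le_push hj pr a)
      have h3 : 0 < P (τ a) := h.trans_le (le_push hj τ a)
      rw [← mul_add]
      refine mul_le_mul_of_nonneg_left ?_ h.le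
      have hp : p (pr a) (τ a) = J (pr a, τ a) / jW (pr a) := by
        simp only [p, h2.ne', if_false]
      rw [hp, ← log_div h1.ne' h2.ne', ← log_div (by positivity) h3.ne']
      set ρ := J (pr a, τ a) / jW (pr a) / P (τ a) with hρ
      have hρ0 : 0 < ρ := by positivity
      have h5 : jW (pr a) * P (τ a) / J (pr a, τ a) = ρ⁻¹ := by
        rw [hρ]; field_simp
      have h6 : ρ + 1 / 32 = ρ * (1 + 1 / 32 * ρ⁻¹) := by field_simp
      rw [h5, h6, log_mul hρ0.ne' (by positivity)]
      have := log_le_sub_one_of_pos (show 0 < 1 + 1 / 32 * ρ⁻¹ by positivity)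
      linarith
  have hbound := hνH.trans (add_le_add (mul_le_mul_of_nonneg_left hmain (by positivity)) le_rfl)
  have hbound2 := hbound.trans (num_bound hI0)
  have hν_zero : ∀ w f, p w (f w) = 0 → ν f = 0 := by
    intro w f h
    rw [← hνp w (f w), Finset.sum_eq_zero_iff_of_nonneg fun g _ => by
      split_ifs <;> simp [hν0]] at h
    simpa using h f (Finset.mem_univ _)
  let M : A × (𝒲 → 𝒯) → ℝ := fun x =>
    if x.2 (pr x.1) = τ x.1 then ν x.2 * (j x.1 / p (pr x.1) (τ x.1)) else 0
  -- joint law of everything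
  have hjoint : ∀ w t f, push M (fun x => (pr x.1, τ x.1, x.2)) (w, t, f)
      = if f w = t then ν f * jW w else 0 := by
    intro w t f
    have e1 : push M (fun x => (pr x.1, τ x.1, x.2)) (w, t, f)
        = (if f w = t then ν f / p w t else 0) * J (w, t) := by
      rw [hJ]
      unfold push
      rw [Fintype.sum_prod_type, Finset.mul_sum]
      refine Finset.sum_congr rfl fun a _ => ?_
      rw [Finset.sum_eq_single f]
      · by_cases h : pr a = w ∧ τ a = t
        · obtain ⟨rfl, rfl⟩ := h
          simp only [M, if_true]
          split_ifs
          · ring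
          · simp
        · have h' : ¬ ((pr a, τ a, f) = (w, t, f)) := by
            simpa [Prod.ext_iff] using h
          have h'' : ¬ ((pr a, τ a) = (w, t)) := by
            simpa [Prod.ext_iff] using h
          simp only [h', h'', if_false, mul_zero]
      · intro g _ hg
        rw [if_neg]
        simp [hg]
      · simp
    rw [e1]
    by_cases hf : f w = t
    · subst hf
      simp only [if_true]
      by_cases h : p w (f w) = 0
      · rw [hν_zero w f h]; simp
      · rw [← hpJ]; field_simp
    · simp [hf]
  have hWY : ∀ w f, push M (fun x => (pr x.1, x.2)) (w, f) = ν f * jW w := by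
    intro w f
    rw [← push_snd M (fun x => τ x.1) (fun x => (pr x.1, x.2))]
    have : ∀ t, push M (fun x => (τ x.1, (pr x.1, x.2))) (t, (w, f))
        = push M (fun x => (pr x.1, τ x.1, x.2)) (w, t, f) := by
      intro t
      exact push_inj M (fun x => (pr x.1, τ x.1, x.2)) (fun y => (y.2.1, y.1, y.2.2))
        (fun a b h => by simp [Prod.ext_iff] at h ⊢; tauto) (w, t, f)
    simp_rw [this, hjoint]
    simp
  have hY : ∀ f, push M (fun x => x.2) f = ν f := by
    intro f
    rw [← push_snd M (fun x => pr x.1) (fun x => x.2)]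
    simp_rw [hWY, ← Finset.mul_sum, hW1, mul_one]
  have hTY : ∀ t f, push M (fun x => (τ x.1, x.2)) (t, f)
      = ν f * ∑ w, if f w = t then jW w else 0 := by
    intro t f
    rw [← push_snd M (fun x => pr x.1) (fun x => (τ x.1, x.2))]
    simp_rw [hjoint, Finset.mul_sum, mul_ite, mul_zero]
  refine ⟨M, ?_, ?_, ?_, ?_⟩
  · intro x
    simp only [M]; split_ifs
    · exact mul_nonneg (hν0 _) (div_nonneg (hj _) (hp0 _ _))
    · exact le_rfl
  · intro a
    have : ∀ f, M (a, f) = (if f (pr a) = τ a then ν f else 0) * (j a / p (pr a) (τ a)) := by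
      intro f; simp only [M, ite_mul, zero_mul]
    simp_rw [this, ← Finset.sum_mul, hνp]
    by_cases h : p (pr a) (τ a) = 0
    · have h1 := hpJ (pr a) (τ a)
      rw [h, mul_zero] at h1
      have h2 : j a ≤ J (pr a, τ a) := le_push hj (fun a => (pr a, τ a)) a
      have h3 : j a = 0 := le_antisymm (by rw [← h1] at h2; exact h2) (hj a)
      rw [h, h3]; simp
    · field_simp
  · intro w f
    rw [hWY, hY, mul_comm]
  · refine le_trans (le_of_eq ?_) hbound2
    unfold HH
    rw [Fintype.sum_prod_type, Finset.sum_comm, ← Finset.sum_sub_distrib]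
    refine Finset.sum_congr rfl fun f _ => ?_
    simp_rw [hTY, hY, negMulLog_mul, Finset.sum_add_distrib, ← Finset.mul_sum, ← Finset.sum_mul]
    have : ∑ t, ∑ w, (if f w = t then jW w else 0) = 1 := by
      rw [Finset.sum_comm]; simp [hW1]
    rw [this]; ring

end Race

namespace Race
open Real Set

lemma push_marg {A Y : Type*} [Fintype A] [Fintype Y] {M : A × Y → ℝ} {j : A → ℝ}
    (h : ∀ a, ∑ y, M (a, y) = j a) : push M Prod.fst = j := by
  classical
  funext a
  rw [← h a]
  unfold push
  rw [Fintype.sum_prod_type, Finset.sum_eq_single a]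
  · simp
  · intro b _ hb; simp [hb]
  · simp

lemma HH_marg {A Y B : Type*} [Fintype A] [Fintype Y] [Fintype B] {M : A × Y → ℝ} {j : A → ℝ}
    (h : ∀ a, ∑ y, M (a, y) = j a) (g : A → B) : HH M (fun x => g x.1) = HH j g := by
  rw [← push_marg h, HH_push]

lemma sum_marg {A Y : Type*} [Fintype A] [Fintype Y] {M : A × Y → ℝ} {j : A → ℝ}
    (h : ∀ a, ∑ y, M (a, y) = j a) : ∑ x, M x = ∑ a, j a := by
  rw [Fintype.sum_prod_type]; simp_rw [h]

lemma HH_swap {A B C : Type*} [Fintype A] [Fintype B] [Fintype C] (M : A → ℝ) (X : A → B)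
    (Y : A → C) : HH M (fun a => (X a, Y a)) = HH M (fun a => (Y a, X a)) :=
  HH_inj M (fun a => (Y a, X a)) Prod.swap Prod.swap_injective

lemma HH_unit {A C : Type*} [Fintype A] [Fintype C] (M : A → ℝ)
    (Y : A → C) : HH M (fun a => ((), Y a)) = HH M Y :=
  HH_inj M Y (fun c => ((), c)) (fun a b h => by simpa using h)

/-- Independence from `pr` passes to functions of `pr`. -/
lemma HH_indep_comp {A Y W B : Type*} [Fintype A] [Fintype Y] [Fintype W] [Fintype B]
    {M : A × Y → ℝ} {j : A → ℝ} (hM : ∀ x, 0 ≤ M x)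
    (h : ∀ a, ∑ y, M (a, y) = j a) (pr : A → W)
    (hi : ∀ w f, push M (fun x => (pr x.1, x.2)) (w, f) = push j pr w * push M (fun x => x.2) f)
    (g : W → B) :
    HH M (fun x => (g (pr x.1), x.2)) = HH j (fun a => g (pr a)) + HH M (fun x => x.2) := by
  classical
  rw [← HH_marg h (fun a => g (pr a))]
  apply HH_indep hM
  intro b f
  have e1 : push M (fun x => g (pr x.1)) b = push (push j pr) g b := by
    rw [push_push, ← push_marg h, push_push]
  rw [e1, ← push_push M (fun x : A × Y => (pr x.1, x.2)) (fun z => (g z.1, z.2))]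
  unfold push at hi ⊢
  rw [Fintype.sum_prod_type, Finset.sum_mul]
  refine Finset.sum_congr rfl fun w _ => ?_
  rw [Finset.sum_eq_single f]
  · rw [hi]
    by_cases hg : g w = b <;> simp [hg]
  · intro f' _ hf; simp [hf]
  · simp

/-- Mixture of two mass functions on a disjoint union. -/
noncomputable def mix {A Y Z : Type*} (α : ℝ) (M : A × Y → ℝ) (N : A × Z → ℝ) :
    A × (Y ⊕ Z) → ℝ :=
  fun x => Sum.elim (fun y => (1 - α) * M (x.1, y)) (fun z => α * N (x.1, z)) x.2

lemma mix_HH {A Y Z B : Type*} [Fintype A] [Fintype Y] [Fintype Z] [Fintype B] (α : ℝ)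
    (M : A × Y → ℝ) (N : A × Z → ℝ) (hM : ∑ x, M x = 1) (hN : ∑ x, N x = 1) (V : A → B) :
    HH (mix α M N) (fun x => (V x.1, x.2)) =
      (1 - α) * HH M (fun x => (V x.1, x.2)) + α * HH N (fun x => (V x.1, x.2))
        + (negMulLog (1 - α) + negMulLog α) := by
  classical
  have e1 : ∀ b y, push (mix α M N) (fun x => (V x.1, x.2)) (b, Sum.inl y)
      = (1 - α) * push M (fun x => (V x.1, x.2)) (b, y) := by
    intro b y
    unfold push mix
    rw [Fintype.sum_prod_type, Fintype.sum_prod_type, Finset.mul_sum]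
    refine Finset.sum_congr rfl fun a _ => ?_
    rw [Fintype.sum_sum_type, Finset.mul_sum]
    simp [Prod.ext_iff]
  have e2 : ∀ b y, push (mix α M N) (fun x => (V x.1, x.2)) (b, Sum.inr y)
      = α * push N (fun x => (V x.1, x.2)) (b, y) := by
    intro b y
    unfold push mix
    rw [Fintype.sum_prod_type, Fintype.sum_prod_type, Finset.mul_sum]
    refine Finset.sum_congr rfl fun a _ => ?_
    rw [Fintype.sum_sum_type, Finset.mul_sum]
    simp [Prod.ext_iff]
  have f1 := push_sum M (fun x => (V x.1, x.2))
  have f2 := push_sum N (fun x => (V x.1, x.2))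
  rw [hM] at f1
  rw [hN] at f2
  unfold HH
  rw [Fintype.sum_prod_type] at f1 f2
  simp_rw [Fintype.sum_prod_type, Fintype.sum_sum_type, e1, e2, negMulLog_mul,
    Finset.sum_add_distrib, ← Finset.mul_sum, ← Finset.sum_mul]
  rw [f1, f2]
  ring

lemma mix_HH_snd {A Y Z : Type*} [Fintype A] [Fintype Y] [Fintype Z] (α : ℝ)
    (M : A × Y → ℝ) (N : A × Z → ℝ) (hM : ∑ x, M x = 1) (hN : ∑ x, N x = 1) :
    HH (mix α M N) (fun x => x.2) =
      (1 - α) * HH M (fun x => x.2) + α * HH N (fun x => x.2)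
        + (negMulLog (1 - α) + negMulLog α) := by
  have := mix_HH α M N hM hN (fun _ => ())
  rwa [HH_unit, HH_unit, HH_unit] at this

lemma final_pmf {𝒮 𝒳 𝒯 : Type} [Fintype 𝒮] [Fintype 𝒳] [Fintype 𝒯]
    (j : 𝒮 × 𝒳 × 𝒯 → ℝ) (hj : ∀ a, 0 ≤ j a) (hj1 : ∑ a, j a = 1)
    (α : ℝ) (h0 : 0 ≤ α) (h1 : α ≤ 1) (I0 I1 : ℝ)
    (hI0 : I0 = HH j (fun a => (a.2.1, a.1)) + HH j (fun a => a.2.2)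
      - HH j (fun a => ((a.2.1, a.1), a.2.2)))
    (hI1 : I1 = HH j (fun a => a.1) + HH j (fun a => a.2.2) - HH j (fun a => (a.1, a.2.2))) :
    ∃ (𝒴 : Type) (_ : Fintype 𝒴) (M : (𝒮 × 𝒳 × 𝒯) × 𝒴 → ℝ),
      (∀ x, 0 ≤ M x) ∧ (∀ a, ∑ y, M (a, y) = j a) ∧
      HH M (fun x => x.2) + HH M (fun x => x.1.1) - HH M (fun x => (x.2, x.1.1)) = 0 ∧
      HH M (fun x => x.1.2.1) + HH M (fun x => x.2) - HH M (fun x => (x.1.2.1, x.2))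
        ≤ α * (HH j (fun a => (a.2.1, a.1)) - HH j (fun a => a.1)) ∧
      HH j (fun a => a.2.2) - (1 - α) * (I0 + log (I0 + 5.51 * log 2))
          - α * (I1 + log (I1 + 5.51 * log 2)) - (1.06 * log 2 - log (log 2))
        ≤ HH M (fun x => x.2) + HH M (fun x => x.1.2.2) - HH M (fun x => (x.2, x.1.2.2)) := by
  classical
  obtain ⟨M0, m0, mm0, mi0, mb0⟩ := branch j hj hj1 (fun a => (a.2.1, a.1)) (fun a => a.2.2) I0 hI0
  obtain ⟨M1, m1, mm1, mi1, mb1⟩ := branch j hj hj1 (fun a => a.1) (fun a => a.2.2) I1 hI1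
  have s0 : ∑ x, M0 x = 1 := (sum_marg mm0).trans hj1
  have s1 : ∑ x, M1 x = 1 := (sum_marg mm1).trans hj1
  have hα : 0 ≤ 1 - α := by linarith
  have hmarg : ∀ a, ∑ y, mix α M0 M1 (a, y) = j a := by
    intro a
    rw [Fintype.sum_sum_type]
    simp only [mix, Sum.elim_inl, Sum.elim_inr]
    rw [← Finset.mul_sum, ← Finset.mul_sum, mm0, mm1]
    ring
  refine ⟨_, inferInstance, mix α M0 M1, ?_, hmarg, ?_, ?_, ?_⟩
  · rintro ⟨a, y | z⟩
    · exact mul_nonneg hα (m0 _)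
    · exact mul_nonneg h0 (m1 _)
  · rw [HH_swap, mix_HH α M0 M1 s0 s1 (fun a => a.1), mix_HH_snd α M0 M1 s0 s1,
      HH_marg hmarg (fun a => a.1)]
    have a1 := HH_indep_comp m0 mm0 (fun a => (a.2.1, a.1)) mi0 (fun w => w.2)
    have a2 := HH_indep_comp m1 mm1 (fun a => a.1) mi1 (fun w => w)
    simp only at a1 a2
    rw [a1, a2]
    ring
  · rw [mix_HH α M0 M1 s0 s1 (fun a => a.2.1), mix_HH_snd α M0 M1 s0 s1,
      HH_marg hmarg (fun a => a.2.1)]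
    have a1 := HH_indep_comp m0 mm0 (fun a => (a.2.1, a.1)) mi0 (fun w => w.1)
    have a2 := HH_indep_comp m1 mm1 (fun a => a.1) mi1 (fun w => w)
    simp only at a1 a2
    have a3 := HH_submod m1 (fun x => x.1.1) (fun x => x.2) (fun x => x.1.2.1)
    have a4 := HH_mono m1 (fun x => (x.1.1, x.2, x.1.2.1)) (fun z => (z.1, z.2.1))
    simp only at a4
    have a5 := HH_marg mm1 (fun a => (a.1, a.2.1))
    have a6 := HH_marg mm1 (fun a => a.2.1)
    rw [HH_swap M1 (fun x => x.2)] at a3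
    rw [HH_swap j] at a5
    have a7 : HH j (fun a => a.2.1) + HH M1 (fun x => x.2) - HH M1 (fun x => (x.1.2.1, x.2))
        ≤ HH j (fun a => (a.2.1, a.1)) - HH j (fun a => a.1) := by linarith
    have a8 := mul_le_mul_of_nonneg_left a7 h0
    rw [a1]
    linarith
  · rw [HH_swap, mix_HH α M0 M1 s0 s1 (fun a => a.2.2), mix_HH_snd α M0 M1 s0 s1,
      HH_marg hmarg (fun a => a.2.2)]
    have a1 := mul_le_mul_of_nonneg_left mb0 hα
    have a2 := mul_le_mul_of_nonneg_left mb1 h0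
    linarith

end Race

namespace Race
open Real Set

lemma real_push {Ω A B : Type*} [MeasurableSpace Ω] [Fintype A] (μ : Measure Ω)
    [IsProbabilityMeasure μ] (Z : Ω → A) (hZ : ∀ a, MeasurableSet (Z ⁻¹' {a})) (g : A → B)
    (b : B) :
    (μ ((fun ω => g (Z ω)) ⁻¹' {b})).toReal = push (fun a => (μ (Z ⁻¹' {a})).toReal) g b := by
  classical
  have h1 : (fun ω => g (Z ω)) ⁻¹' {b} = Z ⁻¹' ↑(Finset.univ.filter fun a => g a = b) := by
    ext ω; simp
  rw [h1, ← sum_measure_preimage_singleton _ fun a _ => hZ a,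
    ENNReal.toReal_sum fun a _ => measure_ne_top _ _, Finset.sum_filter]
  unfold push
  refine Finset.sum_congr rfl fun a _ => ?_
  by_cases h : g a = b <;> simp [h]

lemma ent_eq {Ω A B : Type*} [MeasurableSpace Ω] [Fintype A] [Fintype B] (μ : Measure Ω)
    [IsProbabilityMeasure μ] (Z : Ω → A) (hZ : ∀ a, MeasurableSet (Z ⁻¹' {a})) (g : A → B) :
    ent μ (fun ω => g (Z ω)) = HH (fun a => (μ (Z ⁻¹' {a})).toReal) g / log 2 := by
  unfold ent HH
  rw [Finset.sum_div]
  refine Finset.sum_congr rfl fun b _ => ?_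
  rw [real_push μ Z hZ g b]
  unfold negMulLog logb
  ring

lemma sum_law {Ω A : Type*} [MeasurableSpace Ω] [Fintype A] (μ : Measure Ω)
    [IsProbabilityMeasure μ] (Z : Ω → A) (hZ : ∀ a, MeasurableSet (Z ⁻¹' {a})) :
    ∑ a, (μ (Z ⁻¹' {a})).toReal = 1 := by
  have := real_push μ Z hZ (fun _ => ()) ()
  simpa [push] using this.symm

lemma log_bits {I : ℝ} (hI : 0 ≤ I) :
    log (I + 5.51 * log 2) = log (log 2) + log 2 * logb 2 (I / log 2 + 5.51) := by
  have hl : 0 < log 2 := log_pos (by norm_num)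
  have h1 : I + 5.51 * log 2 = log 2 * (I / log 2 + 5.51) := by field_simp
  rw [h1, log_mul hl.ne' (by positivity), logb]
  field_simp

lemma final_arith {α i0 i1 m hT hXS hS hXST hST : ℝ} (h0 : 0 ≤ α) (h1 : α ≤ 1)
    (e0 : i0 = hXS + hT - hXST) (e1 : i1 = hS + hT - hST) (p0 : 0 ≤ i0) (p1 : 0 ≤ i1)
    (hm : i1 ≤ m) (hmono : hT ≤ hST) :
    (hXST - hXS) + α * (hXS - hS) - α * (hXST - hT) - 1.06
        - logb 2 ((1 - α) * i0 + α * m + 5.51)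
      ≤ hT - (1 - α) * (i0 + logb 2 (i0 + 5.51)) - α * (i1 + logb 2 (i1 + 5.51)) - 1.06 := by
  have hα : 0 ≤ 1 - α := by linarith
  have hc : (1 - α) * log (i0 + 5.51) + α * log (i1 + 5.51)
      ≤ log ((1 - α) * (i0 + 5.51) + α * (i1 + 5.51)) := by
    have := strictConcaveOn_log_Ioi.concaveOn.2 (x := i0 + 5.51) (y := i1 + 5.51)
      (by simp only [mem_Ioi]; positivity) (by simp only [mem_Ioi]; positivity) hα h0 (by ring)
    simpa using this
  have hl : 0 < log 2 := log_pos (by norm_num)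
  have hc2 : (1 - α) * logb 2 (i0 + 5.51) + α * logb 2 (i1 + 5.51)
      ≤ logb 2 ((1 - α) * i0 + α * m + 5.51) := by
    unfold logb
    rw [mul_div_assoc', mul_div_assoc', ← add_div]
    refine div_le_div_of_nonneg_right (hc.trans ?_) hl.le
    have q1 : 0 ≤ (1 - α) * i0 := by positivity
    have q2 : 0 ≤ α * i1 := by positivity
    have q3 : α * i1 ≤ α * m := mul_le_mul_of_nonneg_left hm h0
    have q4 : (1 - α) * (i0 + 5.51) + α * (i1 + 5.51) = (1 - α) * i0 + α * i1 + 5.51 := by ring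
    rw [q4]
    exact log_le_log (by positivity) (by linarith)
  have := mul_le_mul_of_nonneg_left hmono h0
  subst e0 e1
  linarith

end Race

/-- **Lower bound `L₃^r` of Theorem 1 (perfect parity).** With `H(X|S) > 0`, `0 ≤ r ≤ H(X|S)` and `α = r / H(X|S)`, there is a representation `Y` with `I(Y;S') = 0`, `I(X';Y) ≤ r`, and `I(Y;T') ≥ H(T|(X,S)) + r − α H((X,S)|T) − 1.06 − log₂((1−α) I((X,S);T) + α min{H(T), H(X,S)} + 5.51)`. -/
theorem lower_bound_L3r_perfect_parity
    {Ω 𝒮 𝒳 𝒯 : Type} [MeasurableSpace Ω] (μ : Measure Ω) [IsProbabilityMeasure μ]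
    [Fintype 𝒮] [MeasurableSpace 𝒮] [MeasurableSingletonClass 𝒮]
    [Fintype 𝒳] [MeasurableSpace 𝒳] [MeasurableSingletonClass 𝒳]
    [Fintype 𝒯] [MeasurableSpace 𝒯] [MeasurableSingletonClass 𝒯]
    (S : Ω → 𝒮) (X : Ω → 𝒳) (T : Ω → 𝒯)
    (hS : Measurable S) (hX : Measurable X) (hT : Measurable T)
    (hXS : 0 < condEnt μ X S)
    (r : ℝ) (hr0 : 0 ≤ r) (hr1 : r ≤ condEnt μ X S) :
    ∃ (Ω' : Type) (_ : MeasurableSpace Ω') (μ' : Measure Ω')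
      (𝒴 : Type) (_ : Fintype 𝒴) (_ : MeasurableSpace 𝒴)
      (S' : Ω' → 𝒮) (X' : Ω' → 𝒳) (T' : Ω' → 𝒯) (Y : Ω' → 𝒴),
      IsProbabilityMeasure μ' ∧
      Measurable S' ∧ Measurable X' ∧ Measurable T' ∧ Measurable Y ∧
      IdentDistrib (fun ω => (S ω, X ω, T ω)) (fun ω => (S' ω, X' ω, T' ω)) μ μ' ∧
      mutInf μ' Y S' = 0 ∧ mutInf μ' X' Y ≤ r ∧
      mutInf μ' Y T' ≥
        condEnt μ T (fun ω => (X ω, S ω)) + r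
          - (r / condEnt μ X S) * condEnt μ (fun ω => (X ω, S ω)) T - 1.06
          - Real.logb 2 ((1 - r / condEnt μ X S) * mutInf μ (fun ω => (X ω, S ω)) T
              + (r / condEnt μ X S) * min (ent μ T) (ent μ (fun ω => (X ω, S ω))) + 5.51) := by
  
  classical
  have hl : 0 < Real.log 2 := Real.log_pos (by norm_num)
  set Z : Ω → 𝒮 × 𝒳 × 𝒯 := fun ω => (S ω, X ω, T ω) with hZdef
  have hZm : Measurable Z := hS.prodMk (hX.prodMk hT)
  have hZ : ∀ a, MeasurableSet (Z ⁻¹' {a}) := fun a => hZm (measurableSet_singleton a)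
  obtain ⟨j, hjdef⟩ : ∃ j : 𝒮 × 𝒳 × 𝒯 → ℝ, j = fun a => (μ (Z ⁻¹' {a})).toReal := ⟨_, rfl⟩
  have hj : ∀ a, 0 ≤ j a := fun a => by rw [hjdef]; exact ENNReal.toReal_nonneg
  have hj1 : ∑ a, j a = 1 := by rw [hjdef]; exact Race.sum_law μ Z hZ
  have eT : ent μ T = Race.HH j (fun a => a.2.2) / Real.log 2 := by
    rw [hjdef]; exact Race.ent_eq μ Z hZ (fun a => a.2.2)
  have eS : ent μ S = Race.HH j (fun a => a.1) / Real.log 2 := by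
    rw [hjdef]; exact Race.ent_eq μ Z hZ (fun a => a.1)
  have eXS : ent μ (fun ω => (X ω, S ω))
      = Race.HH j (fun a => (a.2.1, a.1)) / Real.log 2 := by
    rw [hjdef]; exact Race.ent_eq μ Z hZ (fun a => (a.2.1, a.1))
  have eTXS : ent μ (fun ω => (T ω, (X ω, S ω)))
      = Race.HH j (fun a => ((a.2.1, a.1), a.2.2)) / Real.log 2 := by
    rw [Race.HH_swap j (fun a => (a.2.1, a.1)), hjdef]
    exact Race.ent_eq μ Z hZ (fun a => (a.2.2, (a.2.1, a.1)))
  have eXST : ent μ (fun ω => ((X ω, S ω), T ω))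
      = Race.HH j (fun a => ((a.2.1, a.1), a.2.2)) / Real.log 2 := by
    rw [hjdef]; exact Race.ent_eq μ Z hZ (fun a => ((a.2.1, a.1), a.2.2))
  obtain ⟨α, hα⟩ : ∃ α, α = r / condEnt μ X S := ⟨_, rfl⟩
  have h0 : 0 ≤ α := by rw [hα]; exact div_nonneg hr0 hXS.le
  have h1 : α ≤ 1 := by rw [hα]; exact (div_le_one hXS).2 hr1
  have hr : r = α * condEnt μ X S := by rw [hα]; field_simp
  rw [← hα]
  obtain ⟨I0, hI0⟩ : ∃ I0, I0 = Race.HH j (fun a => (a.2.1, a.1)) + Race.HH j (fun a => a.2.2)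
      - Race.HH j (fun a => ((a.2.1, a.1), a.2.2)) := ⟨_, rfl⟩
  obtain ⟨I1, hI1⟩ : ∃ I1, I1 = Race.HH j (fun a => a.1) + Race.HH j (fun a => a.2.2)
      - Race.HH j (fun a => (a.1, a.2.2)) := ⟨_, rfl⟩
  have hI0n : 0 ≤ I0 := by
    have := Race.HH_subadd hj hj1 (fun a => (a.2.1, a.1)) (fun a => a.2.2)
    linarith
  have hI1n : 0 ≤ I1 := by
    have := Race.HH_subadd hj hj1 (fun a => a.1) (fun a => a.2.2)
    linarith
  have hmT : Race.HH j (fun a => a.2.2) ≤ Race.HH j (fun a => (a.1, a.2.2)) :=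
    Race.HH_mono hj (fun a => (a.1, a.2.2)) (fun z => z.2)
  have hmS : Race.HH j (fun a => a.1) ≤ Race.HH j (fun a => (a.1, a.2.2)) :=
    Race.HH_mono hj (fun a => (a.1, a.2.2)) (fun z => z.1)
  have hmS2 : Race.HH j (fun a => a.1) ≤ Race.HH j (fun a => (a.2.1, a.1)) :=
    Race.HH_mono hj (fun a => (a.2.1, a.1)) (fun z => z.2)
  obtain ⟨𝒴, hY, M, hM, hmarg, c1, c2, c3⟩ := Race.final_pmf j hj hj1 α h0 h1 I0 I1 hI0 hI1
  have hMs : ∑ x, ENNReal.ofReal (M x) = 1 := by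
    rw [← ENNReal.ofReal_sum_of_nonneg fun x _ => hM x, Race.sum_marg hmarg, hj1,
      ENNReal.ofReal_one]
  letI mΩ : MeasurableSpace ((𝒮 × 𝒳 × 𝒯) × 𝒴) := ⊤
  letI mY : MeasurableSpace 𝒴 := ⊤
  obtain ⟨μ', hμ'⟩ : ∃ μ' : Measure ((𝒮 × 𝒳 × 𝒯) × 𝒴),
    μ' = (PMF.ofFintype (fun x => ENNReal.ofReal (M x)) hMs).toMeasure := ⟨_, rfl⟩
  haveI hprob : IsProbabilityMeasure μ' := by rw [hμ']; infer_instance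
  have hid : ∀ a : (𝒮 × 𝒳 × 𝒯) × 𝒴, MeasurableSet ((fun x => x) ⁻¹' {a}) := fun _ => trivial
  have hlaw : (fun a => (μ' ((fun x => x) ⁻¹' {a})).toReal) = M := by
    funext a
    rw [Set.preimage_id', hμ', PMF.toMeasure_apply_singleton _ a (hid a), PMF.ofFintype_apply,
      ENNReal.toReal_ofReal (hM a)]
  have hent : ∀ {B : Type} [Fintype B] (g : (𝒮 × 𝒳 × 𝒯) × 𝒴 → B),
      ent μ' g = Race.HH M g / Real.log 2 := by
    intro B _ g
    have := Race.ent_eq μ' (fun x => x) hid g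
    rwa [hlaw] at this
  refine ⟨(𝒮 × 𝒳 × 𝒯) × 𝒴, mΩ, μ', 𝒴, hY, mY, fun x => x.1.1, fun x => x.1.2.1,
    fun x => x.1.2.2, fun x => x.2, hprob, measurable_from_top, measurable_from_top,
    measurable_from_top, measurable_from_top, ?_, ?_, ?_, ?_⟩
  · refine ⟨hZm.aemeasurable, measurable_from_top.aemeasurable, ?_⟩
    refine Measure.ext_of_singleton fun a => ?_
    rw [Measure.map_apply hZm (measurableSet_singleton a),
      Measure.map_apply measurable_from_top (measurableSet_singleton a)]
    rw [← ENNReal.toReal_eq_toReal_iff' (measure_ne_top _ _) (measure_ne_top _ _)]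
    have k1 := Race.real_push μ' (fun x => x) hid Prod.fst a
    rw [hlaw, Race.push_marg hmarg, hjdef] at k1
    exact k1.symm
  · unfold mutInf
    rw [hent, hent, hent, ← add_div, ← sub_div, c1, zero_div]
  · rw [hr]
    unfold mutInf condEnt
    rw [hent, hent, hent, ← add_div, ← sub_div, eXS, eS, ← sub_div, mul_div_assoc']
    exact div_le_div_of_nonneg_right c2 hl.le
  · have hIm : I1 / Real.log 2 ≤ min (ent μ T) (ent μ (fun ω => (X ω, S ω))) := by
      rw [eT, eXS]
      refine le_min (div_le_div_of_nonneg_right ?_ hl.le) (div_le_div_of_nonneg_right ?_ hl.le)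
      · linarith
      · linarith
    have key := Race.final_arith (α := α) (i0 := I0 / Real.log 2) (i1 := I1 / Real.log 2)
      (m := min (ent μ T) (ent μ (fun ω => (X ω, S ω))))
      (hT := Race.HH j (fun a => a.2.2) / Real.log 2)
      (hXS := Race.HH j (fun a => (a.2.1, a.1)) / Real.log 2)
      (hS := Race.HH j (fun a => a.1) / Real.log 2)
      (hXST := Race.HH j (fun a => ((a.2.1, a.1), a.2.2)) / Real.log 2)
      (hST := Race.HH j (fun a => (a.1, a.2.2)) / Real.log 2) h0 h1
      (by rw [hI0]; ring) (by rw [hI1]; ring) (by positivity) (by positivity) hIm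
      (div_le_div_of_nonneg_right hmT hl.le)
    rw [Race.log_bits hI0n, Race.log_bits hI1n] at c3
    have c4 := div_le_div_of_nonneg_right c3 hl.le
    have e5 : mutInf μ (fun ω => (X ω, S ω)) T = I0 / Real.log 2 := by
      unfold mutInf
      rw [eXS, eT, eXST, hI0]; ring
    rw [ge_iff_le, e5, hr]
    unfold condEnt mutInf
    rw [eTXS, eXST, hent, hent, hent, ← add_div, ← sub_div]
    refine le_trans ?_ c4
    rw [eT, eXS, eS] at *
    refine le_trans (le_of_eq ?_) (key.trans (le_of_eq ?_))
    · ring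
    · field_simp
      ring
end

section
/- Lower bound L′₁^r of Theorem 1 (perfect parity, high-rate regime): Let (S,X,T) be jointly distributed random variables with values in finite sets and let r satisfy H(X|S) ≤ r < H(X). Then there exists a probability space carrying random variables (S',X',T',Y) such that (S',X',T') has the same joint distribution as (S,X,T), Y takes values in a finite set, I(Y;S') = 0, I(X';Y) ≤ r, and I(Y;T') ≥ H(T|S) − H(S|T) (which equals H(T) − H(S)). -/
open MeasureTheory ProbabilityTheory

open Classical in
lemma pr_comp {Ω α β : Type*} [MeasurableSpace Ω] [Fintype α] (μ : Measure Ω)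
    [IsProbabilityMeasure μ] (Z : Ω → α) (hZ : ∀ a, MeasurableSet (Z ⁻¹' {a})) (f : α → β) (b : β) :
    (μ ((fun ω => f (Z ω)) ⁻¹' {b})).toReal
      = ∑ a : α, if f a = b then (μ (Z ⁻¹' {a})).toReal else 0 := by
  have h : (fun ω => f (Z ω)) ⁻¹' {b} = ⋃ a ∈ Finset.univ.filter (fun a => f a = b), Z ⁻¹' {a} := by
    ext ω
    simp
  rw [h, measure_biUnion_finset, ENNReal.toReal_sum, Finset.sum_filter]
  · intro a _
    exact measure_ne_top _ _
  · intro a _ a' _ haa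
    exact Disjoint.preimage _ (by simpa using haa)
  · intro a _
    exact hZ a

lemma ent_comp {Ω α β : Type*} [MeasurableSpace Ω] [Fintype α] [Fintype β] (μ : Measure Ω)
    [IsProbabilityMeasure μ] (Z : Ω → α) (hZ : ∀ a, MeasurableSet (Z ⁻¹' {a})) (f : α → β) :
    ent μ (fun ω => f (Z ω)) = ∑ a : α, -((μ (Z ⁻¹' {a})).toReal *
      Real.logb 2 ((μ ((fun ω => f (Z ω)) ⁻¹' {f a})).toReal)) := by
  classical
  unfold ent
  have h : ∀ b : β, -((μ ((fun ω => f (Z ω)) ⁻¹' {b})).toReal *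
      Real.logb 2 ((μ ((fun ω => f (Z ω)) ⁻¹' {b})).toReal)) =
      ∑ a : α, if f a = b then -((μ (Z ⁻¹' {a})).toReal *
      Real.logb 2 ((μ ((fun ω => f (Z ω)) ⁻¹' {b})).toReal)) else 0 := by
    intro b
    conv_lhs => rw [← neg_mul]; lhs; rw [pr_comp μ Z hZ f b]
    rw [← Finset.sum_neg_distrib, Finset.sum_mul]
    refine Finset.sum_congr rfl fun a _ => ?_
    split_ifs <;> simp
  rw [Finset.sum_congr rfl (fun b _ => h b), Finset.sum_comm]
  refine Finset.sum_congr rfl fun a _ => ?_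
  simp

lemma pr_le {Ω α β : Type*} [MeasurableSpace Ω] (μ : Measure Ω)
    [IsProbabilityMeasure μ] (Z : Ω → α) (f : α → β) (a : α) :
    (μ (Z ⁻¹' {a})).toReal ≤ (μ ((fun ω => f (Z ω)) ⁻¹' {f a})).toReal := by
  refine ENNReal.toReal_mono (measure_ne_top _ _) (measure_mono ?_)
  intro ω h
  have : Z ω = a := h
  simp [this]

lemma ent_comp_le {Ω α β : Type*} [MeasurableSpace Ω] [Fintype α] [Fintype β] (μ : Measure Ω)
    [IsProbabilityMeasure μ] (Z : Ω → α) (hZ : ∀ a, MeasurableSet (Z ⁻¹' {a})) (f : α → β) :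
    ent μ (fun ω => f (Z ω)) ≤ ent μ Z := by
  rw [ent_comp μ Z hZ f]
  unfold ent
  refine Finset.sum_le_sum fun a _ => ?_
  have h := pr_le μ Z f a
  have h0 : 0 ≤ (μ (Z ⁻¹' {a})).toReal := ENNReal.toReal_nonneg
  rcases h0.eq_or_lt with h0 | h0
  · simp [← h0]
  · have := Real.logb_le_logb_of_le (by norm_num : (1:ℝ) < 2) h0 h
    nlinarith

lemma key_ineq (p a b c : ℝ) (hp : 0 ≤ p) (ha : p ≤ a) (hb : p ≤ b) (hc : p ≤ c) :
    (p - b * c / a) ≤ p * Real.log p + p * Real.log a - p * Real.log b - p * Real.log c := by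
  rcases hp.eq_or_lt with h0 | h0
  · subst h0
    simp only [zero_mul, zero_sub, add_zero, sub_zero]
    have : 0 ≤ b * c / a := by positivity
    linarith
  · have ha' := h0.trans_le ha
    have hb' := h0.trans_le hb
    have hc' := h0.trans_le hc
    have h := Real.log_le_sub_one_of_pos (show 0 < b * c / (a * p) by positivity)
    rw [Real.log_div (by positivity) (by positivity), Real.log_mul (by positivity) (by positivity),
      Real.log_mul (by positivity) (by positivity)] at h
    have h2 := mul_le_mul_of_nonneg_left h hp
    have h3 : p * (b * c / (a * p) - 1) = b * c / a - p := by field_simp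
    rw [h3] at h2
    linarith

lemma ent_submod {Ω α β γ : Type*} [MeasurableSpace Ω] [Fintype α] [Fintype β] [Fintype γ]
    (μ : Measure Ω) [IsProbabilityMeasure μ] (X : Ω → α) (Y : Ω → β) (W : Ω → γ)
    (hZ : ∀ a, MeasurableSet ((fun ω => (X ω, Y ω, W ω)) ⁻¹' {a})) :
    ent μ X + ent μ (fun ω => (X ω, Y ω, W ω)) ≤
      ent μ (fun ω => (X ω, Y ω)) + ent μ (fun ω => (X ω, W ω)) := by
  classical
  set Z : Ω → α × β × γ := fun ω => (X ω, Y ω, W ω) with hZdef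
  have eX := ent_comp μ Z hZ (fun z => z.1)
  have eXY := ent_comp μ Z hZ (fun z => (z.1, z.2.1))
  have eXW := ent_comp μ Z hZ (fun z => (z.1, z.2.2))
  have lX := pr_le μ Z (fun z => z.1)
  have lXY := pr_le μ Z (fun z => (z.1, z.2.1))
  have lXW := pr_le μ Z (fun z => (z.1, z.2.2))
  have pX := pr_comp μ Z hZ (fun z => z.1)
  have pXY := pr_comp μ Z hZ (fun z => (z.1, z.2.1))
  have pXW := pr_comp μ Z hZ (fun z => (z.1, z.2.2))
  simp only [hZdef] at eX eXY eXW lX lXY lXW pX pXY pXW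
  simp only [← hZdef] at eX eXY eXW lX lXY lXW pX pXY pXW
  have eZ : ent μ Z = ∑ a, -((μ (Z ⁻¹' {a})).toReal * Real.logb 2 ((μ (Z ⁻¹' {a})).toReal)) := rfl
  rw [eX, eXY, eXW, eZ]
  set P : α × β × γ → ℝ := fun a => (μ (Z ⁻¹' {a})).toReal with hP
  set A : α → ℝ := fun a => (μ (X ⁻¹' {a})).toReal with hA
  set B : α × β → ℝ := fun a => (μ ((fun ω => (X ω, Y ω)) ⁻¹' {a})).toReal with hB
  set C : α × γ → ℝ := fun a => (μ ((fun ω => (X ω, W ω)) ⁻¹' {a})).toReal with hC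
  have pX' : ∀ a, A a = ∑ b, ∑ c, P (a, b, c) := by
    intro a
    have h := pX a
    rw [Fintype.sum_prod_type, Finset.sum_eq_single a] at h
    · rw [Fintype.sum_prod_type] at h
      simpa using h
    · intro a' _ haa
      simp [haa]
    · simp
  have pXY' : ∀ a b, B (a, b) = ∑ c, P (a, b, c) := by
    intro a b
    have h := pXY (a, b)
    simp only [Fintype.sum_prod_type, Prod.mk.injEq] at h
    rw [Finset.sum_eq_single a (by intro a' _ haa; simp [haa]) (by simp),
      Finset.sum_eq_single b (by intro a' _ haa; simp [haa]) (by simp)] at h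
    simpa using h
  have pXW' : ∀ a c, C (a, c) = ∑ b, P (a, b, c) := by
    intro a c
    have h := pXW (a, c)
    simp only [Fintype.sum_prod_type, Prod.mk.injEq] at h
    rw [Finset.sum_eq_single a (by intro a' _ haa; simp [haa]) (by simp)] at h
    simpa using h
  have hsum : ∑ z : α × β × γ, (P z - B (z.1, z.2.1) * C (z.1, z.2.2) / A z.1) = 0 := by
    simp only [Fintype.sum_prod_type]
    refine Finset.sum_eq_zero fun a _ => ?_
    simp only [Finset.sum_sub_distrib, ← pX' a]
    have h1 : ∑ b, ∑ c, B (a, b) * C (a, c) / A a = (∑ b, B (a, b)) * (∑ c, C (a, c)) / A a := by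
      rw [Finset.sum_mul_sum, Finset.sum_div]
      simp only [Finset.sum_div]
    have h2 : ∑ b, B (a, b) = A a := by simp only [pXY', pX']
    have h3 : ∑ c, C (a, c) = A a := by
      simp only [pXW', pX']
      exact Finset.sum_comm
    rw [h1, h2, h3, mul_self_div_self, sub_self]
  have hkey : 0 ≤ ∑ z : α × β × γ, (P z * Real.log (P z) + P z * Real.log (A z.1)
      - P z * Real.log (B (z.1, z.2.1)) - P z * Real.log (C (z.1, z.2.2))) := by
    rw [← hsum]
    exact Finset.sum_le_sum fun z _ =>
      key_ineq _ _ _ _ ENNReal.toReal_nonneg (lX z) (lXY z) (lXW z)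
  have hl : (0:ℝ) < Real.log 2 := Real.log_pos (by norm_num)
  have hkey2 := div_nonneg hkey hl.le
  rw [Finset.sum_div] at hkey2
  rw [← sub_nonneg, ← Finset.sum_add_distrib, ← Finset.sum_add_distrib, ← Finset.sum_sub_distrib]
  refine hkey2.trans (le_of_eq (Finset.sum_congr rfl fun z _ => ?_))
  simp only [Real.logb, hP, hA, hB, hC]
  ring

lemma ent_prod_indep {Ω α β : Type*} [MeasurableSpace Ω] [Fintype α] [Fintype β]
    (μ : Measure Ω) [IsProbabilityMeasure μ] (X : Ω → α) (Y : Ω → β)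
    (hZ : ∀ a, MeasurableSet ((fun ω => (X ω, Y ω)) ⁻¹' {a}))
    (h : ∀ a b, (μ ((fun ω => (X ω, Y ω)) ⁻¹' {(a, b)})).toReal
      = (μ (X ⁻¹' {a})).toReal * (μ (Y ⁻¹' {b})).toReal) :
    ent μ X + ent μ Y = ent μ (fun ω => (X ω, Y ω)) := by
  have eX := ent_comp μ (fun ω => (X ω, Y ω)) hZ (fun z => z.1)
  have eY := ent_comp μ (fun ω => (X ω, Y ω)) hZ (fun z => z.2)
  simp only at eX eY
  rw [eX, eY, ← Finset.sum_add_distrib]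
  unfold ent
  refine Finset.sum_congr rfl fun z _ => ?_
  obtain ⟨a, b⟩ := z
  simp only
  rw [h]
  by_cases h1 : (μ (X ⁻¹' {a})).toReal = 0
  · simp [h1]
  by_cases h2 : (μ (Y ⁻¹' {b})).toReal = 0
  · simp [h2]
  rw [Real.logb_mul h1 h2]
  ring

lemma ent_fst {Ω Ω₂ α : Type*} [MeasurableSpace Ω] [MeasurableSpace Ω₂] [Fintype α]
    (μ : Measure Ω) (ν : Measure Ω₂) [IsProbabilityMeasure μ] [IsProbabilityMeasure ν]
    (X : Ω → α) : ent (μ.prod ν) (fun ω => X ω.1) = ent μ X := by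
  unfold ent
  refine Finset.sum_congr rfl fun a _ => ?_
  have : (fun ω : Ω × Ω₂ => X ω.1) ⁻¹' {a} = (X ⁻¹' {a}) ×ˢ Set.univ := by
    ext ω
    simp
  rw [this, Measure.prod_prod]
  simp

/-- There are probability measures with the conditional laws of `T` given `S = s`. -/
lemma exists_condlaw {Ω 𝒮 𝒯 : Type} [MeasurableSpace Ω] (μ : Measure Ω) [IsProbabilityMeasure μ]
    [MeasurableSpace 𝒮] [MeasurableSingletonClass 𝒮]
    [MeasurableSpace 𝒯] [MeasurableSingletonClass 𝒯]
    (S : Ω → 𝒮) (T : Ω → 𝒯) (hS : Measurable S) (hT : Measurable T) (s : 𝒮) :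
    ∃ q : Measure 𝒯, IsProbabilityMeasure q ∧
      ∀ t, μ (S ⁻¹' {s} ∩ T ⁻¹' {t}) = μ (S ⁻¹' {s}) * q {t} := by
  by_cases h : μ (S ⁻¹' {s}) = 0
  · refine ⟨μ.map T, Measure.isProbabilityMeasure_map hT.aemeasurable, fun t => ?_⟩
    rw [h, zero_mul]
    exact measure_mono_null Set.inter_subset_left h
  · have := cond_isProbabilityMeasure (μ := μ) h
    refine ⟨(μ[|S ⁻¹' {s}]).map T, Measure.isProbabilityMeasure_map hT.aemeasurable, fun t => ?_⟩
    rw [Measure.map_apply hT (measurableSet_singleton t),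
      cond_apply (hS (measurableSet_singleton s)), ← mul_assoc,
      ENNReal.mul_inv_cancel h (measure_ne_top _ _), one_mul]

/-- **Lower bound `L′₁^r` of Theorem 1 (perfect parity, high-rate regime).** For `H(X|S) ≤ r < H(X)` there is a representation `Y` with `I(Y;S') = 0`, `I(X';Y) ≤ r`, and `I(Y;T') ≥ H(T|S) − H(S|T)`, which equals `H(T) − H(S)`. -/
theorem lower_bound_L1r_prime_perfect_parity
    {Ω 𝒮 𝒳 𝒯 : Type} [MeasurableSpace Ω] (μ : Measure Ω) [IsProbabilityMeasure μ]
    [Fintype 𝒮] [MeasurableSpace 𝒮] [MeasurableSingletonClass 𝒮]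
    [Fintype 𝒳] [MeasurableSpace 𝒳] [MeasurableSingletonClass 𝒳]
    [Fintype 𝒯] [MeasurableSpace 𝒯] [MeasurableSingletonClass 𝒯]
    (S : Ω → 𝒮) (X : Ω → 𝒳) (T : Ω → 𝒯)
    (hS : Measurable S) (hX : Measurable X) (hT : Measurable T)
    (r : ℝ) (hr0 : condEnt μ X S ≤ r) (hr1 : r < ent μ X) :
    ∃ (Ω' : Type) (_ : MeasurableSpace Ω') (μ' : Measure Ω')
      (𝒴 : Type) (_ : Fintype 𝒴) (_ : MeasurableSpace 𝒴)
      (S' : Ω' → 𝒮) (X' : Ω' → 𝒳) (T' : Ω' → 𝒯) (Y : Ω' → 𝒴),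
      IsProbabilityMeasure μ' ∧
      Measurable S' ∧ Measurable X' ∧ Measurable T' ∧ Measurable Y ∧
      IdentDistrib (fun ω => (S ω, X ω, T ω)) (fun ω => (S' ω, X' ω, T' ω)) μ μ' ∧
      mutInf μ' Y S' = 0 ∧ mutInf μ' X' Y ≤ r ∧
      mutInf μ' Y T' ≥ condEnt μ T S - condEnt μ S T ∧
      condEnt μ T S - condEnt μ S T = ent μ T - ent μ S := by
  classical
  choose q hq hqt using exists_condlaw μ S T hS hT
  let ν : Measure (𝒮 → 𝒯) := Measure.pi q
  let Y : Ω × (𝒮 → 𝒯) → (𝒮 → 𝒯) := fun ω s => if S ω.1 = s then T ω.1 else ω.2 s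
  have hY : Measurable Y := by
    refine measurable_pi_iff.mpr fun s => ?_
    refine Measurable.ite ?_ (hT.comp measurable_fst) ((measurable_pi_apply s).comp measurable_snd)
    exact (hS.comp measurable_fst) (measurableSet_singleton s)
  have hS' : Measurable (fun ω : Ω × (𝒮 → 𝒯) => S ω.1) := hS.comp measurable_fst
  have hX' : Measurable (fun ω : Ω × (𝒮 → 𝒯) => X ω.1) := hX.comp measurable_fst
  have hT' : Measurable (fun ω : Ω × (𝒮 → 𝒯) => T ω.1) := hT.comp measurable_fst
  have hjoint : ∀ y s, (μ.prod ν) ((fun ω => (Y ω, S ω.1)) ⁻¹' {(y, s)})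
      = (∏ i, q i {y i}) * μ (S ⁻¹' {s}) := by
    intro y s
    have h1 : (fun ω => (Y ω, S ω.1)) ⁻¹' {(y, s)} = (S ⁻¹' {s} ∩ T ⁻¹' {y s}) ×ˢ
        (Set.univ.pi fun i => if i = s then Set.univ else {y i}) := by
      ext ω
      simp only [Set.mem_preimage, Set.mem_singleton_iff, Prod.mk.injEq, Set.mem_prod,
        Set.mem_inter_iff, Set.mem_pi, Set.mem_univ, true_imp_iff, Y, funext_iff]
      constructor
      · rintro ⟨h, hs⟩
        refine ⟨⟨hs, by simpa [hs] using h s⟩, fun i => ?_⟩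
        by_cases his : i = s
        · simp [his]
        · have := h i
          rw [hs, if_neg (Ne.symm his)] at this
          simp [his, this]
      · rintro ⟨⟨hs, ht⟩, h⟩
        refine ⟨fun i => ?_, hs⟩
        by_cases his : i = s
        · subst his
          simp [hs, ht]
        · have := h i
          rw [if_neg his] at this
          rw [hs, if_neg (Ne.symm his)]
          exact this
    rw [h1, Measure.prod_prod, hqt, Measure.pi_pi,
      ← Finset.mul_prod_erase Finset.univ (fun i => q i {y i}) (Finset.mem_univ s),
      ← Finset.mul_prod_erase Finset.univ (fun i => q i (if i = s then Set.univ else {y i}))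
        (Finset.mem_univ s)]
    have h2 : ∏ i ∈ Finset.univ.erase s, q i (if i = s then Set.univ else {y i})
        = ∏ i ∈ Finset.univ.erase s, q i {y i} := by
      refine Finset.prod_congr rfl fun i hi => ?_
      rw [if_neg (Finset.ne_of_mem_erase hi)]
    rw [h2, if_pos rfl, measure_univ, one_mul]
    ring
  have hSm : ∀ s, (μ.prod ν) ((fun ω => S ω.1) ⁻¹' {s}) = μ (S ⁻¹' {s}) := by
    intro s
    have : (fun ω : Ω × (𝒮 → 𝒯) => S ω.1) ⁻¹' {s} = (S ⁻¹' {s}) ×ˢ Set.univ := by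
      ext ω
      simp
    rw [this, Measure.prod_prod]
    simp
  have hYm : ∀ y, (μ.prod ν) (Y ⁻¹' {y}) = ∏ i, q i {y i} := by
    intro y
    have h1 : Y ⁻¹' {y} = ⋃ s : 𝒮, (fun ω => (Y ω, S ω.1)) ⁻¹' {(y, s)} := by
      ext ω
      simp
    have h3 : ∑ s, μ (S ⁻¹' {s}) = 1 := by
      rw [sum_measure_preimage_singleton (μ := μ) (f := S) Finset.univ
          (fun s _ => hS (measurableSet_singleton s))]
      simp
    rw [h1, measure_iUnion, tsum_fintype]
    · simp only [hjoint]
      rw [← Finset.mul_sum, h3, mul_one]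
    · intro s s' hss
      exact Disjoint.preimage _ (by simpa using hss)
    · intro s
      exact (hY.prodMk hS') (measurableSet_singleton _)
  have hYS : ent (μ.prod ν) Y + ent (μ.prod ν) (fun ω => S ω.1)
      = ent (μ.prod ν) (fun ω => (Y ω, S ω.1)) := by
    refine ent_prod_indep _ _ _ (fun a => (hY.prodMk hS') (measurableSet_singleton a)) ?_
    intro y s
    rw [hjoint, hSm, hYm, ENNReal.toReal_mul]
  have eS : ent (μ.prod ν) (fun ω => S ω.1) = ent μ S := ent_fst μ ν S
  have eX : ent (μ.prod ν) (fun ω => X ω.1) = ent μ X := ent_fst μ ν X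
  have eT : ent (μ.prod ν) (fun ω => T ω.1) = ent μ T := ent_fst μ ν T
  have eXS : ent (μ.prod ν) (fun ω => (X ω.1, S ω.1)) = ent μ (fun ω => (X ω, S ω)) :=
    ent_fst μ ν (fun ω => (X ω, S ω))
  have hsym : ent μ (fun ω => (T ω, S ω)) = ent μ (fun ω => (S ω, T ω)) := by
    apply le_antisymm
    · exact ent_comp_le μ (fun ω => (S ω, T ω))
        (fun a => (hS.prodMk hT) (measurableSet_singleton a)) Prod.swap
    · exact ent_comp_le μ (fun ω => (T ω, S ω))
        (fun a => (hT.prodMk hS) (measurableSet_singleton a)) Prod.swap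
  have hdiff : condEnt μ T S - condEnt μ S T = ent μ T - ent μ S := by
    unfold condEnt
    rw [hsym]
    ring
  have hXYS : Measurable (fun ω : Ω × (𝒮 → 𝒯) => (X ω.1, Y ω, S ω.1)) :=
    hX'.prodMk (hY.prodMk hS')
  refine ⟨Ω × (𝒮 → 𝒯), inferInstance, μ.prod ν, 𝒮 → 𝒯, inferInstance, inferInstance,
    fun ω => S ω.1, fun ω => X ω.1, fun ω => T ω.1, Y, inferInstance, hS', hX', hT', hY,
    ?_, ?_, ?_, ?_, hdiff⟩
  · refine ⟨(hS.prodMk (hX.prodMk hT)).aemeasurable,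
      (hS'.prodMk (hX'.prodMk hT')).aemeasurable, ?_⟩
    have h := Measure.map_map (μ := μ.prod ν) (hS.prodMk (hX.prodMk hT)) measurable_fst
    rw [← Measure.fst, Measure.fst_prod] at h
    exact h
  · unfold mutInf
    linarith
  · have h1 := ent_submod (μ.prod ν) (fun ω => X ω.1) Y (fun ω => S ω.1)
      (fun a => hXYS (measurableSet_singleton a))
    have h2 := ent_comp_le (μ.prod ν) (fun ω => (X ω.1, Y ω, S ω.1))
      (fun a => hXYS (measurableSet_singleton a)) (fun z => z.2)
    simp only at h2
    unfold condEnt at hr0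
    unfold mutInf
    linarith
  · have h1 := ent_comp_le (μ.prod ν) (fun ω => (Y ω, S ω.1))
      (fun a => (hY.prodMk hS') (measurableSet_singleton a)) (fun z => (z.1, z.1 z.2))
    have h2 : (fun ω => (Y ω, Y ω (S ω.1))) = fun ω => (Y ω, T ω.1) := by
      funext ω
      simp [Y]
    simp only at h1
    rw [h2] at h1
    rw [hdiff]
    unfold mutInf
    linarith
end
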